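/- Let p ≥ 2 be an integer. Suppose the structure on ℝ is d-minimal and let M ⊆ ℝⁿ be a D^p submanifold. Then the set of D^p Morse functions on M is dense in the space D^p(M) of D^p functions on M with the D^p topology; concretely: for every D^p function h : M → ℝ, every finite family D₁,…,D_k of D^{p−1} vector fields on M, and every positive definable continuous function ε : M → ℝ, there exists a D^p Morse function g : M → ℝ such that |D_{i₁}⋯D_{i_j}(g − h)| < ε on M for every sequence (i₁,…,i_j) of indices in {1,…,k} of length j ≤ p. -/

import Mathlib

open FirstOrder Set Filter Topology
open scoped Classical

noncomputable section

namespace DMinPaper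

variable (L : FirstOrder.Language) [L.Structure ℝ]

/-- A subset of `ℝ^α` is definable (with parameters from `ℝ`) in the structure `L`. -/
def IsDef {α : Type} (s : Set (α → ℝ)) : Prop :=
  (Set.univ : Set ℝ).Definable L s

/-- Definability of an `ℝ`-valued function on a subset `M ⊆ ℝ^α`, via its graph. -/
def IsDefFunOn {α : Type} (M : Set (α → ℝ)) (f : (α → ℝ) → ℝ) : Prop :=
  IsDef L {z : (α ⊕ Unit) → ℝ |
    (fun i => z (Sum.inl i)) ∈ M ∧ z (Sum.inr ()) = f (fun i => z (Sum.inl i))}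

/-- Definability of a map `M → ℝ^β` on a subset `M ⊆ ℝ^α`, via its graph. -/
def IsDefMapOn {α β : Type} (M : Set (α → ℝ)) (f : (α → ℝ) → (β → ℝ)) : Prop :=
  IsDef L {z : (α ⊕ β) → ℝ |
    (fun i => z (Sum.inl i)) ∈ M ∧ (fun j => z (Sum.inr j)) = f (fun i => z (Sum.inl i))}

/-- Definability of an `ℝ`-valued function on a subset of a product `ℝ^α × ℝ^β`. -/
def IsDefFun2On {α β : Type} (S : Set ((α → ℝ) × (β → ℝ)))
    (f : (α → ℝ) × (β → ℝ) → ℝ) : Prop :=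
  IsDef L {z : ((α ⊕ β) ⊕ Unit) → ℝ |
    ((fun i => z (Sum.inl (Sum.inl i)), fun j => z (Sum.inl (Sum.inr j))) ∈ S) ∧
    z (Sum.inr ()) = f (fun i => z (Sum.inl (Sum.inl i)), fun j => z (Sum.inl (Sum.inr j)))}

/-- Definability of a map into `ℝ^γ` on a subset of a product `ℝ^α × ℝ^β`. -/
def IsDefMap2On {α β γ : Type} (S : Set ((α → ℝ) × (β → ℝ)))
    (f : (α → ℝ) × (β → ℝ) → (γ → ℝ)) : Prop :=
  IsDef L {z : ((α ⊕ β) ⊕ γ) → ℝ |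
    ((fun i => z (Sum.inl (Sum.inl i)), fun j => z (Sum.inl (Sum.inr j))) ∈ S) ∧
    (fun l => z (Sum.inr l)) = f (fun i => z (Sum.inl (Sum.inl i)), fun j => z (Sum.inl (Sum.inr j)))}

/-- Definability of a function `ℝ → ℝ`, via its graph. -/
def IsDefFunR (f : ℝ → ℝ) : Prop :=
  IsDef L {z : Fin 2 → ℝ | z 1 = f (z 0)}

/-- The structure expands the ordered field of real numbers: the order, addition and
multiplication are definable. -/
def ExpandsOrderedField : Prop :=
  IsDef L {x : Fin 2 → ℝ | x 0 < x 1} ∧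
  IsDef L {x : Fin 3 → ℝ | x 2 = x 0 + x 1} ∧
  IsDef L {x : Fin 3 → ℝ | x 2 = x 0 * x 1}

/-- A discrete subset of `ℝ`. -/
def IsDiscreteSet (D : Set ℝ) : Prop :=
  ∀ x ∈ D, ∃ U : Set ℝ, IsOpen U ∧ U ∩ D = {x}

/-- d-minimality: the structure expands the ordered field of reals, and in every definable
family of subsets of `ℝ` each fiber is the union of an open set and `N` discrete sets, where
`N` does not depend on the parameter. -/
def DMinimal : Prop :=
  ExpandsOrderedField L ∧
  ∀ (k : ℕ) (S : Set ((Fin k ⊕ Unit) → ℝ)), IsDef L S →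
    ∃ N : ℕ, ∀ a : Fin k → ℝ,
      ∃ (U : Set ℝ) (D : Fin N → Set ℝ),
        IsOpen U ∧ (∀ i, IsDiscreteSet (D i)) ∧
        {t : ℝ | Sum.elim a (fun _ => t) ∈ S} = U ∪ ⋃ i, D i

variable {E F : Type} [NormedAddCommGroup E] [NormedSpace ℝ E]
  [NormedAddCommGroup F] [NormedSpace ℝ F]

/-- `f` is of class `C^p` on `M` (as a function on the submanifold `M`): near each point of `M`
it coincides on `M` with a `C^p` function defined on an ambient open set. -/
def CpOn (p : ℕ) (f : E → F) (M : Set E) : Prop :=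
  ∀ x ∈ M, ∃ (U : Set E) (g : E → F),
    IsOpen U ∧ x ∈ U ∧ ContDiffOn ℝ p g U ∧ Set.EqOn f g (M ∩ U)

/-- The tangent vectors to `M` at `x`: velocities of differentiable curves through `x`
staying in `M`. -/
def TangentVecs (M : Set E) (x : E) : Set E :=
  {v | ∃ γ : ℝ → E, γ 0 = x ∧ (∀ᶠ t in 𝓝 (0:ℝ), γ t ∈ M) ∧ HasDerivAt γ v 0}

/-- The differential of `f : M → N` at `x` is surjective onto the tangent space of `N`
at `f x`. -/
def SubmersionAtOn (f : E → F) (M : Set E) (N : Set F) (x : E) : Prop :=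
  ∀ w ∈ TangentVecs N (f x), ∃ (γ : ℝ → E) (v : E),
    γ 0 = x ∧ (∀ᶠ t in 𝓝 (0:ℝ), γ t ∈ M) ∧ HasDerivAt γ v 0 ∧
    HasDerivAt (fun t => f (γ t)) w 0

/-- `x` is a critical point of `f : M → ℝ`: the differential of `f` at `x` vanishes on all
tangent vectors of `M` at `x`. -/
def IsCritPtOn (f : E → ℝ) (M : Set E) (x : E) : Prop :=
  x ∈ M ∧ ∀ (γ : ℝ → E) (v : E), γ 0 = x → (∀ᶠ t in 𝓝 (0:ℝ), γ t ∈ M) →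
    HasDerivAt γ v 0 → HasDerivAt (fun t => f (γ t)) 0 0

/-- `x` is a nondegenerate critical point of `f : M → ℝ` on the `d`-dimensional submanifold
`M`: in a local `C²` parametrization `ψ` of `M` at `x`, the Hessian of `f ∘ ψ` is a
nondegenerate bilinear form. -/
def IsNondegCritPtOn (f : E → ℝ) (M : Set E) (d : ℕ) (x : E) : Prop :=
  IsCritPtOn f M x ∧
  ∃ (W : Set (Fin d → ℝ)) (ψ : (Fin d → ℝ) → E) (w0 : Fin d → ℝ),
    IsOpen W ∧ w0 ∈ W ∧ ContDiffOn ℝ 2 ψ W ∧ ψ w0 = x ∧ Set.MapsTo ψ W M ∧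
    Function.Injective (fun u => fderiv ℝ ψ w0 u) ∧
    ∀ v : Fin d → ℝ, v ≠ 0 → ∃ w : Fin d → ℝ,
      iteratedFDeriv ℝ 2 (fun z => f (ψ z)) w0 ![v, w] ≠ 0

/-- `f` is a Morse function on the `d`-dimensional submanifold `M`: all critical points are
nondegenerate and distinct critical points have distinct critical values. -/
def IsMorseOn (f : E → ℝ) (M : Set E) (d : ℕ) : Prop :=
  (∀ x, IsCritPtOn f M x → IsNondegCritPtOn f M d x) ∧
  ∀ x y, IsCritPtOn f M x → IsCritPtOn f M y → x ≠ y → f x ≠ f y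

/-- `M ⊆ ℝⁿ` is a definable `C^p` submanifold of dimension `d`: `M` is definable and every
point of `M` has a definable `C^p` chart of `ℝⁿ` flattening `M` onto `ℝ^d × {0}`. -/
def IsDpSubmanifold (p : ℕ) {n : ℕ} (d : ℕ) (M : Set (Fin n → ℝ)) : Prop :=
  IsDef L M ∧ d ≤ n ∧
  ∀ x ∈ M, ∃ (U V : Set (Fin n → ℝ)) (φ ψ : (Fin n → ℝ) → (Fin n → ℝ)),
    IsOpen U ∧ x ∈ U ∧ IsOpen V ∧ (0 : Fin n → ℝ) ∈ V ∧
    IsDef L U ∧ IsDef L V ∧ IsDefMapOn L U φ ∧ IsDefMapOn L V ψ ∧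
    ContDiffOn ℝ p φ U ∧ ContDiffOn ℝ p ψ V ∧
    Set.MapsTo φ U V ∧ Set.MapsTo ψ V U ∧
    (∀ y ∈ U, ψ (φ y) = y) ∧ (∀ y ∈ V, φ (ψ y) = y) ∧
    φ x = 0 ∧ φ '' (M ∩ U) = V ∩ {y | ∀ i : Fin n, d ≤ (i : ℕ) → y i = 0}

/-- The definable set `X ⊆ ℝⁿ` has dimension at least `d`: some projection of `X` onto `d`
of the coordinates has nonempty interior. -/
def hasDimGE {n : ℕ} (X : Set (Fin n → ℝ)) (d : ℕ) : Prop :=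
  ∃ ι : Fin d → Fin n, StrictMono ι ∧ (interior ((fun x => fun i => x (ι i)) '' X)).Nonempty

/-- The dimension of `X ⊆ ℝⁿ`: the largest `d` such that some coordinate projection of `X`
onto `ℝ^d` has nonempty interior; `⊥` (i.e. `-∞`) for the empty set. -/
noncomputable def dimDef {n : ℕ} (X : Set (Fin n → ℝ)) : WithBot ℕ :=
  if X.Nonempty then ((sSup {d : ℕ | hasDimGE X d} : ℕ) : WithBot ℕ) else ⊥

/-- The coordinate projection `ℝⁿ → ℝ^d` determined by `ι`. -/
def projc {n d : ℕ} (ι : Fin d → Fin n) (x : Fin n → ℝ) : Fin d → ℝ := fun i => x (ι i)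

/-- An open box in `ℝⁿ`: a product of `n` nonempty open intervals. -/
def IsOpenBox {n : ℕ} (U : Set (Fin n → ℝ)) : Prop :=
  ∃ a b : Fin n → ℝ, (∀ i, a i < b i) ∧ U = Set.univ.pi fun i => Set.Ioo (a i) (b i)

/-- `M` is locally, at `x`, the image of a definable `C^p` section `τ` of the coordinate
projection `projc ι`. -/
def MultiGraphPtAt (p : ℕ) {n d : ℕ} (ι : Fin d → Fin n) (M : Set (Fin n → ℝ))
    (x : Fin n → ℝ) : Prop :=
  ∃ U : Set (Fin n → ℝ), IsOpenBox U ∧ x ∈ U ∧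
    ∃ τ : (Fin d → ℝ) → (Fin n → ℝ),
      IsDefMapOn L (projc ι '' U) τ ∧ ContDiffOn ℝ p τ (projc ι '' U) ∧
      M ∩ U = τ '' (projc ι '' U) ∧ ∀ z ∈ projc ι '' U, projc ι (τ z) = z

/-- A `D^p` multi-valued graph with respect to the coordinate projection `projc ι`. -/
def IsMultiGraph (p : ℕ) {n d : ℕ} (ι : Fin d → Fin n) (M : Set (Fin n → ℝ)) : Prop :=
  IsDpSubmanifold L p d M ∧ ∀ x ∈ M, MultiGraphPtAt L p ι M x

/-- The gradient vector `(∂g/∂x₁, …, ∂g/∂x_d)` of `g : ℝ^d → ℝ` at `z`. -/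
noncomputable def gradVec {d : ℕ} (g : (Fin d → ℝ) → ℝ) (z : Fin d → ℝ) : Fin d → ℝ :=
  fun i => fderiv ℝ g z (Pi.single i 1)

/-- The Hessian matrix `(∂²g/∂x_i∂x_j)` of `g : ℝ^d → ℝ` at `z`. -/
noncomputable def hessMat {d : ℕ} (g : (Fin d → ℝ) → ℝ) (z : Fin d → ℝ) :
    Matrix (Fin d) (Fin d) ℝ :=
  Matrix.of fun i j => fderiv ℝ (fun w => fderiv ℝ g w (Pi.single j 1)) z (Pi.single i 1)

/-- The derivative of `f : M → ℝ` at `x` along the vector field `D`: the common value of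
`d_x g (D x)` over all local `C¹` extensions `g` of `f` (and `0` if there is no such common
value). -/
noncomputable def vderiv (M : Set E) (D : E → E) (f : E → ℝ) (x : E) : ℝ :=
  if h : ∃ w : ℝ, ∀ (U : Set E) (g : E → ℝ), IsOpen U → x ∈ U → ContDiffOn ℝ 1 g U →
      Set.EqOn f g (M ∩ U) → fderiv ℝ g x (D x) = w
  then h.choose else 0

/-- Iterated derivative `D_{α₁} ⋯ D_{α_m} f` of `f : M → ℝ` along a finite family of vector
fields, indexed by a list `α`. -/
noncomputable def vderivIter {k : ℕ} (M : Set E) (D : Fin k → E → E) :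
    List (Fin k) → (E → ℝ) → E → ℝ
  | [], f => f
  | i :: l, f => vderiv M (D i) (vderivIter M D l f)

set_option linter.unusedSectionVars false

set_option linter.unusedSectionVars false
section DefTools

/-- Types encoded as finite powers of `ℝ`. -/
class Enc (X : Type) where
  idx : Type
  fin : Finite idx
  e : X ≃ (idx → ℝ)

instance : Enc ℝ := ⟨Unit, inferInstance, (Equiv.funUnique Unit ℝ).symm⟩
instance (ι : Type) [h : Finite ι] : Enc (ι → ℝ) := ⟨ι, h, Equiv.refl _⟩
instance {X Y : Type} [hX : Enc X] [hY : Enc Y] : Enc (X × Y) :=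
  ⟨hX.idx ⊕ hY.idx, by have := hX.fin; have := hY.fin; infer_instance,
    (Equiv.prodCongr hX.e hY.e).trans (Equiv.sumArrowEquivProdArrow _ _ _).symm⟩

variable {L : FirstOrder.Language} [L.Structure ℝ]
variable {X Y Z : Type} [hX : Enc X] [hY : Enc Y] [hZ : Enc Z]

variable (L) in
def DS (s : Set X) : Prop := IsDef L (hX.e.symm ⁻¹' s)

variable (L) in
@[fun_prop]
def DM (f : X → Y) : Prop := DS L {q : X × Y | q.2 = f q.1}

theorem DS.and {P Q : X → Prop} (h1 : DS L {x | P x}) (h2 : DS L {x | Q x}) :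
    DS L {x | P x ∧ Q x} := Definable.inter h1 h2
theorem DS.or {P Q : X → Prop} (h1 : DS L {x | P x}) (h2 : DS L {x | Q x}) :
    DS L {x | P x ∨ Q x} := Definable.union h1 h2
theorem DS.not {P : X → Prop} (h1 : DS L {x | P x}) : DS L {x | ¬ P x} := Definable.compl h1
theorem DS.imp {P Q : X → Prop} (h1 : DS L {x | P x}) (h2 : DS L {x | Q x}) :
    DS L {x | P x → Q x} := by
  simp only [imp_iff_not_or]; exact h1.not.or h2
theorem DS.iff {P Q : X → Prop} (h1 : DS L {x | P x}) (h2 : DS L {x | Q x}) :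
    DS L {x | P x ↔ Q x} := by
  simp only [iff_def]; exact (h1.imp h2).and (h2.imp h1)
theorem DS.cst (P : Prop) : DS L {_x : X | P} := by
  by_cases h : P
  · simp only [h, ofPred_true]; exact definable_univ
  · simp only [h, ofPred_false]; exact definable_empty
theorem DS.ex {P : X → Y → Prop} (h : DS L {q : X × Y | P q.1 q.2}) :
    DS L {x | ∃ y, P x y} := by
  have := hX.fin; have := hY.fin
  have h' := Definable.exists_of_finite h
  unfold DS IsDef
  convert h' using 1
  ext v
  simp only [mem_preimage, mem_ofPred_eq]
  rw [hY.e.symm.surjective.exists]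
  rfl
theorem DS.all {P : X → Y → Prop} (h : DS L {q : X × Y | P q.1 q.2}) :
    DS L {x | ∀ y, P x y} := by
  simpa using (DS.ex (P := fun x y => ¬ P x y) h.not).not
theorem DS.exb {ι : Type} [Finite ι] {P : X → ι → Prop} (h : ∀ i, DS L {x | P x i}) :
    DS L {x | ∃ i, P x i} := by
  have := definable_iUnion_of_finite h
  unfold DS IsDef; convert this using 1; ext; simp
theorem DS.allb {ι : Type} [Finite ι] {P : X → ι → Prop} (h : ∀ i, DS L {x | P x i}) :
    DS L {x | ∀ i, P x i} := by
  simpa using (DS.exb (P := fun x y => ¬ P x y) fun i => (h i).not).not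

/-- reindexing -/
theorem DS.reindex {s : Set Y} (h : DS L s) (f : X → Y) (g : hY.idx → hX.idx)
    (hf : ∀ x i, hY.e (f x) i = hX.e x (g i)) : DS L (f ⁻¹' s) := by
  have := Definable.preimage_comp g h
  unfold DS IsDef; convert this using 1
  ext v
  simp only [mem_preimage]
  have : f (hX.e.symm v) = hY.e.symm (v ∘ g) := by
    apply hY.e.injective; ext i; simp [hf]
  rw [this]
theorem DS.eq' : DS L {q : X × X | q.1 = q.2} := by
  have := hX.fin
  have h : DS L {q : X × X | ∀ i, hX.e q.1 i = hX.e q.2 i} := by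
    refine DS.allb fun i => ?_
    refine ⟨Language.Term.equal (.var (Sum.inl i)) (.var (Sum.inr i)), ?_⟩
    ext v
    change hX.e (hX.e.symm fun i => v (.inl i)) i = hX.e (hX.e.symm fun i => v (.inr i)) i ↔ _
    simp
  convert h using 3
  rename_i q
  rw [← hX.e.injective.eq_iff, funext_iff]
theorem DM.id' : DM L (fun x : X => x) := by
  have := (DS.eq' (L := L) (X := X)).reindex (fun q : X × X => (q.2, q.1)) Sum.swap
    (by rintro _ (i | i) <;> rfl)
  exact this
theorem DS.mem {A : Set Y} {f : X → Y} (hA : DS L A) (hf : DM L f) : DS L {x | f x ∈ A} := by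
  have : DS L {x | ∃ y, y = f x ∧ y ∈ A} :=
    DS.ex (P := fun x y => y = f x ∧ y ∈ A)
      (DS.and hf (hA.reindex (fun q : X × Y => q.2) Sum.inr fun _ _ => rfl))
  simpa using this
theorem DS.mk {A : Set X} {P : X → Prop} (h : DS L {x | P x}) (hA : ∀ x, x ∈ A ↔ P x) : DS L A := by
  convert h; ext x; exact hA x
@[fun_prop] theorem DM.id : DM L (fun x : X => x) := DM.id'
@[fun_prop] theorem DM.comp {f : Y → Z} {g : X → Y} (hf : DM L f) (hg : DM L g) :
    DM L (fun x => f (g x)) := by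
  have : DS L {q : X × Z | ∃ y, y = g q.1 ∧ q.2 = f y} :=
    DS.ex (P := fun (q : X × Z) y => y = g q.1 ∧ q.2 = f y)
      (DS.and (hg.reindex (fun q : (X × Z) × Y => (q.1.1, q.2)) (Sum.elim (fun i => .inl (.inl i)) .inr)
        (by rintro _ (i | i) <;> rfl))
        (hf.reindex (fun q : (X × Z) × Y => (q.2, q.1.2)) (Sum.elim .inr (fun i => .inl (.inr i)))
        (by rintro _ (i | i) <;> rfl)))
  simpa [DM] using this
theorem DM.of_reindex (f : X → Y) (g : hY.idx → hX.idx)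
    (hf : ∀ x i, hY.e (f x) i = hX.e x (g i)) : DM L f :=
  (DM.id' (L := L) (X := Y)).reindex (fun q : X × Y => (f q.1, q.2))
    (Sum.elim (fun i => .inl (g i)) .inr) (by
      rintro q (i | i)
      · exact hf _ _
      · rfl)
@[fun_prop] theorem DM.const (y : Y) : DM L (fun _ : X => y) := by
  have := hX.fin; have := hY.fin
  have h : DS L {q : X × Y | ∀ i, hY.e q.2 i = hY.e y i} := by
    refine DS.allb fun i => ?_
    refine ⟨Language.Term.equal (.var (Sum.inr i))
      (Language.Constants.term (L.con (⟨hY.e y i, trivial⟩ : (univ : Set ℝ)))), ?_⟩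
    ext v
    change hY.e (hY.e.symm fun i => v (.inr i)) i = hY.e y i ↔ _
    simp
  unfold DM
  convert h using 3
  rename_i q
  rw [← hY.e.injective.eq_iff, funext_iff]
@[fun_prop] theorem DM.fst : DM L (fun q : X × Y => q.1) := .of_reindex _ Sum.inl fun _ _ => rfl
@[fun_prop] theorem DM.snd : DM L (fun q : X × Y => q.2) := .of_reindex _ Sum.inr fun _ _ => rfl
@[fun_prop] theorem DM.eval {ι : Type} [Finite ι] (i : ι) : DM L (fun q : ι → ℝ => q i) :=
  .of_reindex _ (fun _ => i) fun _ _ => rfl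
theorem DS.eq {f g : X → Y} (hf : DM L f) (hg : DM L g) : DS L {x | f x = g x} := by
  have : DS L {x | ∃ y, y = f x ∧ y = g x} :=
    DS.ex (P := fun x y => y = f x ∧ y = g x) (hf.and hg)
  convert this using 3
  simp
@[fun_prop] theorem DM.prodMk {f : X → Y} {g : X → Z} (hf : DM L f) (hg : DM L g) :
    DM L (fun x => (f x, g x)) := by
  refine DS.mk (P := fun q : X × Y × Z => q.2.1 = f q.1 ∧ q.2.2 = g q.1)
    (DS.and (DS.eq (by fun_prop) (by fun_prop)) (DS.eq (by fun_prop) (by fun_prop))) ?_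
  rintro ⟨x, y, z⟩; exact Prod.ext_iff
@[fun_prop] theorem DM.pi {ι : Type} [Finite ι] {f : X → ι → ℝ} (hf : ∀ i, DM L (fun x => f x i)) :
    DM L (fun x i => f x i) := by
  refine DS.mk (P := fun q : X × (ι → ℝ) => ∀ i, q.2 i = f q.1 i)
    (DS.allb fun i => (DS.eq (by fun_prop) (by fun_prop))) ?_
  rintro ⟨x, y⟩; exact funext_iff
variable [hL : Fact (DMinimal L)]
theorem DS.lt {f g : X → ℝ} (hf : DM L f) (hg : DM L g) : DS L {x | f x < g x} :=
  DS.mem (A := {x : Fin 2 → ℝ | x 0 < x 1}) (f := fun x => ![f x, g x]) hL.out.1.1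
    (DM.pi fun i => by fin_cases i <;> simpa)
theorem DS.le {f g : X → ℝ} (hf : DM L f) (hg : DM L g) : DS L {x | f x ≤ g x} := by
  simpa using (DS.lt hg hf).not
@[fun_prop] theorem DM.add {f g : X → ℝ} (hf : DM L f) (hg : DM L g) : DM L fun x => f x + g x :=
  DS.mem (A := {x : Fin 3 → ℝ | x 2 = x 0 + x 1}) (f := fun x : X × ℝ => ![f x.1, g x.1, x.2])
    hL.out.1.2.1 (DM.pi fun i => by fin_cases i <;> simp <;> fun_prop)
@[fun_prop] theorem DM.mul {f g : X → ℝ} (hf : DM L f) (hg : DM L g) : DM L fun x => f x * g x :=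
  DS.mem (A := {x : Fin 3 → ℝ | x 2 = x 0 * x 1}) (f := fun x : X × ℝ => ![f x.1, g x.1, x.2])
    hL.out.1.2.2 (DM.pi fun i => by fin_cases i <;> simp <;> fun_prop)
@[fun_prop] theorem DM.ite {P : X → Prop} {f g : X → Y} (hP : DS L {x | P x}) (hf : DM L f)
    (hg : DM L g) : DM L fun x => if P x then f x else g x := by
  refine DS.mk (P := fun q : X × Y => (P q.1 ∧ q.2 = f q.1) ∨ (¬ P q.1 ∧ q.2 = g q.1))
    (DS.or (DS.and (DS.mem (A := {x | P x}) hP DM.fst) hf)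
      (DS.and (DS.not (DS.mem (A := {x | P x}) hP DM.fst)) hg)) ?_
  rintro ⟨x, y⟩; simp; split_ifs <;> simp_all
@[fun_prop] theorem DM.neg {f : X → ℝ} (hf : DM L f) : DM L fun x => - f x := by
  simpa using (DM.const (L := L) (X := X) (-1 : ℝ)).mul hf
@[fun_prop] theorem DM.sub {f g : X → ℝ} (hf : DM L f) (hg : DM L g) : DM L fun x => f x - g x := by
  simpa [sub_eq_add_neg] using hf.add hg.neg
@[fun_prop] theorem DM.abs {f : X → ℝ} (hf : DM L f) : DM L fun x => |f x| := by
  have := DM.ite (DS.le (DM.const 0) hf) hf hf.neg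
  convert this using 2 with x; split_ifs with h
  · exact abs_of_nonneg h
  · exact abs_of_neg (not_le.1 h)
@[fun_prop] theorem DM.max {f g : X → ℝ} (hf : DM L f) (hg : DM L g) : DM L fun x => max (f x) (g x) := by
  simpa [max_def] using DM.ite (DS.le hf hg) hg hf
@[fun_prop] theorem DM.min {f g : X → ℝ} (hf : DM L f) (hg : DM L g) : DM L fun x => min (f x) (g x) := by
  simpa [min_def] using DM.ite (DS.le hf hg) hf hg
@[fun_prop] theorem DM.pow {f : X → ℝ} (hf : DM L f) (n : ℕ) : DM L fun x => f x ^ n := by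
  induction n with
  | zero => simpa using DM.const 1
  | succ n ih => simpa [pow_succ] using ih.mul hf
@[fun_prop] theorem DM.inv {f : X → ℝ} (hf : DM L f) : DM L fun x => (f x)⁻¹ := by
  refine DS.mk (P := fun q : X × ℝ => (f q.1 = 0 ∧ q.2 = 0) ∨ f q.1 * q.2 = 1) (DS.or (DS.and
    (DS.eq (by fun_prop) (by fun_prop)) (DS.eq (by fun_prop) (by fun_prop)))
    (DS.eq (by fun_prop) (by fun_prop))) ?_
  rintro ⟨x, y⟩; simp only [mem_ofPred_eq]
  rcases eq_or_ne (f x) 0 with h | h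
  · simp [h]
  · simp only [h, false_and, false_or]; constructor <;> intro h' <;> [simp [h', h]; exact eq_inv_of_mul_eq_one_right h']
@[fun_prop] theorem DM.div {f g : X → ℝ} (hf : DM L f) (hg : DM L g) : DM L fun x => f x / g x := by
  simpa [div_eq_mul_inv] using hf.mul hg.inv
@[fun_prop] theorem DM.sum {ι : Type} (s : Finset ι) {f : ι → X → ℝ} (hf : ∀ i, DM L (f i)) :
    DM L fun x => ∑ i ∈ s, f i x := by
  induction s using Finset.induction_on with
  | empty => simpa using DM.const 0
  | insert a s ha ih => simp only [Finset.sum_insert ha]; exact (hf a).add ih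

theorem DM.funOn {n : ℕ} {M : Set (Fin n → ℝ)} {f : (Fin n → ℝ) → ℝ} (hM : IsDef L M)
    (hf : IsDefFunOn L M f) : DM L fun x => if x ∈ M then f x else 0 := by
  have h : DS L {q : (Fin n → ℝ) × ℝ | q.1 ∈ M ∧ q.2 = f q.1} := hf
  have hM : DS L M := hM
  refine DS.mk (P := fun q => (q.1 ∈ M ∧ q.2 = f q.1) ∨ (q.1 ∉ M ∧ q.2 = 0))
    (h.or ((DS.mem hM DM.fst).not.and (DS.eq DM.snd (DM.const 0)))) ?_
  rintro ⟨x, y⟩; simp; split_ifs <;> simp_all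
theorem DM.mapOn {n m : ℕ} {M : Set (Fin n → ℝ)} {f : (Fin n → ℝ) → (Fin m → ℝ)} (hM : IsDef L M)
    (hf : IsDefMapOn L M f) : DM L fun x => if x ∈ M then f x else 0 := by
  have h : DS L {q : (Fin n → ℝ) × (Fin m → ℝ) | q.1 ∈ M ∧ q.2 = f q.1} := hf
  have hM : DS L M := hM
  refine DS.mk (P := fun q => (q.1 ∈ M ∧ q.2 = f q.1) ∨ (q.1 ∉ M ∧ q.2 = 0))
    (h.or ((DS.mem hM DM.fst).not.and (DS.eq DM.snd (DM.const 0)))) ?_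
  rintro ⟨x, y⟩; simp; split_ifs <;> simp_all
theorem DM.toFunOn {n : ℕ} {M : Set (Fin n → ℝ)} {f : (Fin n → ℝ) → ℝ} (hM : DS L M)
    (hf : DM L f) : IsDefFunOn L M f := by
  have h : DS L {q : (Fin n → ℝ) × ℝ | q.1 ∈ M ∧ q.2 = f q.1} := (DS.mem hM DM.fst).and hf
  exact h

variable (L) in
class DMet (X : Type) [Enc X] [PseudoMetricSpace X] : Prop where
  dm : DM L fun q : X × X => dist q.1 q.2

@[fun_prop] theorem DM.dist [PseudoMetricSpace Y] [DMet L Y] {f g : X → Y} (hf : DM L f)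
    (hg : DM L g) : DM L fun x => dist (f x) (g x) :=
  DM.comp (f := fun q : Y × Y => Dist.dist q.1 q.2) DMet.dm (hf.prodMk hg)
instance : DMet L ℝ := ⟨by simp only [Real.dist_eq]; fun_prop⟩
instance [PseudoMetricSpace X] [PseudoMetricSpace Y] [DMet L X] [DMet L Y] : DMet L (X × Y) :=
  ⟨by simp only [Prod.dist_eq]; fun_prop⟩
instance {ι : Type} [Fintype ι] : DMet L (ι → ℝ) := ⟨by
  have h : DS L {q : ((ι → ℝ) × (ι → ℝ)) × ℝ | (0 ≤ q.2 ∧ ∀ i, |q.1.1 i - q.1.2 i| ≤ q.2) ∧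
      ∀ r, (0 ≤ r ∧ ∀ i, |q.1.1 i - q.1.2 i| ≤ r) → q.2 ≤ r} :=
    ((DS.le (by fun_prop) (by fun_prop)).and (DS.allb fun i => DS.le (by fun_prop) (by fun_prop))).and
     (DS.all (P := fun (q : ((ι → ℝ) × (ι → ℝ)) × ℝ) r =>
      (0 ≤ r ∧ ∀ i, |q.1.1 i - q.1.2 i| ≤ r) → q.2 ≤ r) ((((DS.le (by fun_prop) (by fun_prop)).and
       (DS.allb fun i => DS.le (by fun_prop) (by fun_prop)))).imp (DS.le (by fun_prop) (by fun_prop))))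
  refine DS.mk h fun q => ?_
  have h2 : ∀ r, (0 ≤ r ∧ ∀ i, |q.1.1 i - q.1.2 i| ≤ r) ↔ Dist.dist q.1.1 q.1.2 ≤ r := fun r =>
    ⟨fun h => (dist_pi_le_iff h.1).2 h.2, fun h => ⟨dist_nonneg.trans h, (dist_pi_le_iff
      (dist_nonneg.trans h)).1 h⟩⟩
  simp only [h2]
  exact ⟨fun h => by rw [mem_ofPred_eq] at h; rw [h]; simp, fun h => le_antisymm (h.2 _ le_rfl) h.1⟩⟩
@[fun_prop] theorem DM.norm {ι : Type} [Fintype ι] {f : X → ι → ℝ} (hf : DM L f) :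
    DM L fun x => ‖f x‖ := by
  simpa using hf.dist (DM.const 0)
theorem DS.nhds [PseudoMetricSpace Y] [DMet L Y] {f : X → Y} {P : X → Y → Prop}
    (h : DS L {q : X × Y | P q.1 q.2}) (hf : DM L f) : DS L {x | ∀ᶠ y in 𝓝 (f x), P x y} := by
  simp only [Metric.eventually_nhds_iff]
  refine DS.ex (P := fun x ε => ε > 0 ∧ ∀ ⦃y : Y⦄, Dist.dist y (f x) < ε → P x y)
    ((DS.lt (by fun_prop) (by fun_prop)).and ?_)
  refine DS.all (P := fun (q : X × ℝ) y => Dist.dist y (f q.1) < q.2 → P q.1 y) ((DS.lt (by fun_prop)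
    (by fun_prop)).imp ?_)
  exact DS.mem (f := fun q : (X × ℝ) × Y => (q.1.1, q.2)) h (by fun_prop)

theorem dsolve {A : Set X} (h : DS L A := by
  with_reducible repeat' (first
    | assumption | apply DS.all | apply DS.ex | apply DS.and
    | apply DS.or | apply DS.not | apply DS.lt | apply DS.le | apply DS.eq | apply DS.iff
    | apply DS.mem | apply DS.imp | apply DS.cst | apply DS.allb | apply DS.exb | apply DS.nhds | intro _
    | fun_prop (disch := assumption))) : DS L A := h

theorem DS.fib {s : Set (X × ℝ)} (h : DS L s) : ∃ N : ℕ, ∀ x : X,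
    ∃ (U : Set ℝ) (D : Fin N → Set ℝ), IsOpen U ∧ (∀ i, IsDiscreteSet (D i)) ∧
        {t : ℝ | (x, t) ∈ s} = U ∪ ⋃ i, D i := by
  have := hX.fin
  obtain ⟨k, ⟨c⟩⟩ := Finite.exists_equiv_fin hX.idx
  obtain ⟨N, hN⟩ := hL.out.2 k _ (Definable.preimage_comp (Sum.map c id) h)
  refine ⟨N, fun x => ?_⟩
  obtain ⟨U, D, h1, h2, h3⟩ := hN (hX.e x ∘ c.symm)
  refine ⟨U, D, h1, h2, ?_⟩
  rw [← h3]; ext t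
  have : ∀ v : hX.idx ⊕ Unit → ℝ, (Enc.e.symm v : X × ℝ) =
    (hX.e.symm fun i => v (.inl i), v (.inr ())) := fun v => rfl
  simp only [mem_ofPred_eq, mem_preimage]
  erw [this]; simp

end DefTools

section Baire
variable {L : FirstOrder.Language} [L.Structure ℝ] [hL : Fact (DMinimal L)]

theorem IsDiscreteSet.avoid {D : Set ℝ} (h : IsDiscreteSet D) {W : Set ℝ} (hW : IsOpen W)
    (hne : W.Nonempty) : ∃ W' ⊆ W, IsOpen W' ∧ W'.Nonempty ∧ ∀ x ∈ W', x ∉ D := by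
  by_cases hD : ∃ x ∈ W, x ∈ D
  · obtain ⟨x, hxW, hxD⟩ := hD
    obtain ⟨U, hU, hUD⟩ := h x hxD
    have hxU : x ∈ U := (hUD.symm.subset rfl).1
    refine ⟨(W ∩ U) ∩ {x}ᶜ, fun y hy => hy.1.1, (hW.inter hU).inter isOpen_compl_singleton, ?_, ?_⟩
    · exact dense_compl_singleton x |>.inter_open_nonempty _ (hW.inter hU) ⟨x, hxW, hxU⟩
    · rintro y ⟨⟨_, hyU⟩, hyx⟩ hyD
      exact hyx (hUD.subset ⟨hyU, hyD⟩)
  · exact ⟨W, le_rfl, hW, hne, fun x hx hxD => hD ⟨x, hx, hxD⟩⟩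

theorem disc_avoid {ι : Type} (s : Finset ι) {D : ι → Set ℝ} (h : ∀ i, IsDiscreteSet (D i)) {W : Set ℝ}
    (hW : IsOpen W) (hne : W.Nonempty) :
    ∃ W' ⊆ W, IsOpen W' ∧ W'.Nonempty ∧ ∀ x ∈ W', ∀ i ∈ s, x ∉ D i := by
  induction s using Finset.induction_on with
  | empty => exact ⟨W, le_rfl, hW, hne, by simp⟩
  | insert a s ha ih =>
    obtain ⟨W1, h1, h2, h3, h4⟩ := ih
    obtain ⟨W2, h5, h6, h7, h8⟩ := (h a).avoid h2 h3
    refine ⟨W2, h5.trans h1, h6, h7, fun x hx i hi => ?_⟩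
    rcases Finset.mem_insert.1 hi with rfl | hi
    · exact h8 x hx
    · exact h4 x (h5 hx) i hi

theorem DS.struct {A : Set ℝ} (hA : DS L A) : ∃ (N : ℕ) (U : Set ℝ) (D : Fin N → Set ℝ),
    IsOpen U ∧ (∀ i, IsDiscreteSet (D i)) ∧ A = U ∪ ⋃ i, D i := by
  obtain ⟨N, h⟩ := DS.fib (L := L) (s := {q : ℝ × ℝ | q.2 ∈ A}) dsolve
  exact ⟨N, h 0⟩

theorem one_dim {A : Set ℝ} (hA : DS L A) {W : Set ℝ} (hW : IsOpen W) (hne : W.Nonempty) :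
    ∃ a b : ℚ, a < b ∧ Ioo (a : ℝ) b ⊆ W ∧ (Ioo (a : ℝ) b ⊆ A ∨ ∀ x ∈ Ioo (a : ℝ) b, x ∉ A) := by
  obtain ⟨N, U, D, hU, hD, rfl⟩ := hA.struct
  suffices ∃ W' ⊆ W, IsOpen W' ∧ W'.Nonempty ∧ (W' ⊆ U ∪ ⋃ i, D i ∨ ∀ x ∈ W', x ∉ U ∪ ⋃ i, D i) by
    obtain ⟨W', h1, h2, ⟨x, hx⟩, h4⟩ := this
    obtain ⟨ε, hε, hb⟩ := Metric.isOpen_iff.1 h2 x hx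
    obtain ⟨a, ha1, ha2⟩ := exists_rat_btwn (show x - ε < x by linarith)
    obtain ⟨b, hb1, hb2⟩ := exists_rat_btwn (show x < x + ε by linarith)
    have : Ioo (a : ℝ) b ⊆ W' := fun y hy => hb (by
      rw [Real.ball_eq_Ioo]; exact ⟨by linarith [hy.1], by linarith [hy.2]⟩)
    refine ⟨a, b, by exact_mod_cast ha2.trans hb1, this.trans h1, ?_⟩
    exact h4.imp this.trans fun h y hy => h y (this hy)
  by_cases h : (W ∩ U).Nonempty
  · exact ⟨W ∩ U, inter_subset_left, hW.inter hU, h, .inl fun x hx => .inl hx.2⟩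
  · obtain ⟨W1, h1, h2, h3, h4⟩ := disc_avoid Finset.univ hD hW hne
    refine ⟨W1, h1, h2, h3, .inr fun x hx => ?_⟩
    rintro (hxU | hx')
    · exact h ⟨x, h1 hx, hxU⟩
    · obtain ⟨i, hi⟩ := mem_iUnion.1 hx'
      exact h4 x hx i (Finset.mem_univ _) hi

theorem DS.countable {A : Set ℝ} (hA : DS L A) (h : interior A = ∅) : A.Countable := by
  obtain ⟨N, U, D, hU, hD, rfl⟩ := hA.struct
  have : U = ∅ := subset_empty_iff.1 (h ▸ interior_maximal subset_union_left hU)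
  rw [this, empty_union]
  refine countable_iUnion fun i => ?_
  have : DiscreteTopology (D i) := by
    rw [← isDiscrete_iff_discreteTopology, isDiscrete_iff_forall_mem_exists_isOpen]
    intro x hx
    obtain ⟨V, h1, h2⟩ := hD i x hx
    exact ⟨V, h1, by rw [h2]⟩
  exact (HereditarilyLindelofSpace.isHereditarilyLindelof_univ _ (subset_univ _)).countable this

theorem baire_cover {X : Type} [TopologicalSpace X] [BaireSpace X] {ι : Type} [Countable ι]
    {U : Set X} (hU : IsOpen U) (hne : U.Nonempty) {S : ι → Set X} (h : U ⊆ ⋃ i, S i) :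
    ∃ i, (U ∩ interior (closure (S i))).Nonempty := by
  by_contra! hc
  refine not_isMeagre_of_isOpen hU hne ((isMeagre_iUnion fun i => ?_).mono
    (by rw [← inter_iUnion]; exact subset_inter le_rfl h) : IsMeagre U)
  refine IsNowhereDense.isMeagre (isNowhereDense_iff_disjoint.2 (disjoint_left.2 fun x hx hx' => ?_))
  exact (hc i).subset ⟨hx.1, interior_mono (closure_mono inter_subset_right) hx'⟩

variable (L) in
def Good (X : Type) [Enc X] [TopologicalSpace X] : Prop :=
  ∀ A : Set X, DS L A → interior (closure A) ⊆ closure (interior A)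


variable {X Y : Type} [Enc X] [TopologicalSpace X] [Enc Y] [TopologicalSpace Y]
theorem Good.cover [BaireSpace X] (hX : Good L X) {ι : Type} [Countable ι] {U : Set X}
    (hU : IsOpen U) (hne : U.Nonempty) {S : ι → Set X} (hS : ∀ i, DS L (S i)) (h : U ⊆ ⋃ i, S i) :
    ∃ i, (U ∩ interior (S i)).Nonempty := by
  obtain ⟨i, x, hx⟩ := baire_cover hU hne h
  exact ⟨i, mem_closure_iff.1 (hX _ (hS i) hx.2) U hU hx.1⟩

theorem Good.dense (hX : Good L X) {A : Set X} (hA : DS L A) (h : Dense A) : Dense (interior A) := by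
  intro x; apply hX A hA; rw [h.closure_eq]; simp

theorem Good.prod [BaireSpace X] (hX : Good L X) : Good L (X × ℝ) := by
  intro A hA w hw
  rw [mem_closure_iff]
  intro O hO hwO
  obtain ⟨U, V, hU, hV, hwU, hwV, hUV⟩ := isOpen_prod_iff.1 (isOpen_interior.inter hO) w.1 w.2 ⟨hw, hwO⟩
  let S : (ℚ × ℚ) × Bool → Set X := fun j => if j.1.1 < j.1.2 ∧ Ioo (j.1.1 : ℝ) j.1.2 ⊆ V then
    (bif j.2 then {x | ∀ t, (j.1.1 : ℝ) < t ∧ t < j.1.2 → (x, t) ∈ A} else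
      {x | ∀ t, (j.1.1 : ℝ) < t ∧ t < j.1.2 → ¬ (x, t) ∈ A}) else ∅
  have hS : ∀ j, DS L (S j) := by
    rintro ⟨j, b⟩
    simp only [S]
    split_ifs
    · cases b
      · rw [cond_false]; exact dsolve
      · rw [cond_true]; exact dsolve
    · exact DS.cst False
  obtain ⟨⟨⟨a, b⟩, c⟩, x, hxU, hx⟩ := hX.cover hU ⟨w.1, hwU⟩ hS fun x hx => by
    obtain ⟨a, b, h1, h2, h3⟩ := one_dim (L := L) (A := {t | (x, t) ∈ A}) dsolve hV ⟨w.2, hwV⟩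
    rw [mem_iUnion]
    rcases h3 with h3 | h3
    · exact ⟨((a, b), true), by simpa [S, h1, h2] using fun t ha hb => h3 ⟨ha, hb⟩⟩
    · exact ⟨((a, b), false), by simpa [S, h1, h2] using fun t ha hb => h3 t ⟨ha, hb⟩⟩
  by_cases hab : a < b ∧ Ioo (a : ℝ) b ⊆ V
  swap
  · simp [S, hab] at hx
  obtain ⟨t, ht⟩ : (Ioo (a : ℝ) b).Nonempty := nonempty_Ioo.2 (by exact_mod_cast hab.1)
  have hopen : IsOpen ((U ∩ interior (S ((a, b), c))) ×ˢ Ioo (a : ℝ) b) :=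
    (hU.inter isOpen_interior).prod isOpen_Ioo
  cases c with
  | true =>
    refine ⟨(x, t), (hUV ⟨hxU, hab.2 ht⟩).2, mem_interior.2 ⟨_, ?_, hopen, ⟨hxU, hx⟩, ht⟩⟩
    rintro ⟨y, u⟩ ⟨⟨_, hy⟩, hu⟩
    have := interior_subset hy
    simp only [S, hab, and_self, if_true, cond_true] at this
    exact this u hu
  | false =>
    exfalso
    obtain ⟨⟨y, u⟩, ⟨⟨_, hy⟩, hu⟩, hA'⟩ := mem_closure_iff.1
      (interior_subset (hUV (show (x, t) ∈ U ×ˢ V from ⟨hxU, hab.2 ht⟩)).1) _ hopen ⟨⟨hxU, hx⟩, ht⟩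
    have := interior_subset hy
    simp only [S, hab, and_self, if_true, cond_false] at this
    exact this u hu hA'

theorem Good.transport (hX : Good L X) (e : X ≃ₜ Y) (he : DM L e) : Good L Y := by
  intro A hA
  have := hX (e ⁻¹' A) (DS.mem hA he)
  rw [← e.preimage_closure, ← e.preimage_interior, ← e.preimage_interior, ← e.preimage_closure] at this
  intro y hy
  simpa using this (show e.symm y ∈ _ by simpa using hy)

theorem goodFin (m : ℕ) : Good L (Fin m → ℝ) := by
  induction m with
  | zero =>
    intro A _
    rcases Subsingleton.eq_empty_or_singleton (subsingleton_of_subsingleton (s := A)) with h | ⟨x, h⟩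
    · simp [h]
    · rw [h, show ({x} : Set (Fin 0 → ℝ)) = univ from by ext; simp [Subsingleton.elim _ x] ]; simp
  | succ m ih =>
    let e : (Fin m → ℝ) × ℝ ≃ₜ (Fin (m + 1) → ℝ) :=
      { toFun := fun q => Fin.cons q.2 q.1
        invFun := fun v => (fun i => v i.succ, v 0)
        left_inv := fun q => by simp
        right_inv := fun v => Fin.cons_self_tail v
        continuous_toFun := continuous_pi fun i => by
          refine Fin.cases ?_ (fun i => ?_) i <;> simp <;> fun_prop
        continuous_invFun := by fun_prop }
    refine ih.prod.transport e (DM.pi fun i => ?_)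
    change DM L fun q : (Fin m → ℝ) × ℝ => (Fin.cons q.2 q.1 : Fin (m + 1) → ℝ) i
    refine Fin.cases ?_ (fun i => ?_) i <;> simp <;> fun_prop

theorem goodR : Good L ℝ :=
  (goodFin 1).transport (Homeomorph.funUnique (Fin 1) ℝ) (DM.eval (L := L) (0 : Fin 1))

end Baire

section Generic
open MeasureTheory
variable {L : FirstOrder.Language} [L.Structure ℝ] [hL : Fact (DMinimal L)]

theorem cb {X : Type} [TopologicalSpace X] [T1Space X] {ι : Type} {D : ι → Set X}
    (hD : ∀ i, ∀ x ∈ D i, ∃ U : Set X, IsOpen U ∧ U ∩ D i = {x}) {S : ℕ → Set X}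
    (hS : ∀ j, S (j + 1) ⊆ S j) (hacc : ∀ j, ∀ x ∈ S (j + 1), ∃ᶠ y in 𝓝[≠] x, y ∈ S j)
    (s : Finset ι) : ∀ U : Set X, IsOpen U → (∀ x ∈ S 0, x ∈ U → ∃ i ∈ s, x ∈ D i) →
      ∀ x ∈ U, x ∉ S s.card := by
  have hS0 : ∀ j, S j ⊆ S 0 := fun j => by
    induction j with
    | zero => exact le_rfl
    | succ j ih => exact (hS j).trans ih
  obtain ⟨K, hK⟩ : ∃ K, s.card = K := ⟨_, rfl⟩
  induction K generalizing s with
  | zero =>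
    intro U _ h x hxU hx
    obtain ⟨i, hi, _⟩ := h x (hS0 _ hx) hxU
    simp [Finset.card_eq_zero.1 hK] at hi
  | succ K ih =>
    intro U hU h x hxU hx
    obtain ⟨i, hi, hxi⟩ := h x (hS0 _ hx) hxU
    obtain ⟨V, hV, hVD⟩ := hD i x hxi
    have hxV : x ∈ V := (hVD.symm.subset rfl).1
    rw [hK] at hx
    have hcard : (s.erase i).card = K := by rw [Finset.card_erase_of_mem hi, hK]; rfl
    have h1 := ih (s.erase i) hcard ((U ∩ V) ∩ {x}ᶜ) ((hU.inter hV).inter isOpen_compl_singleton) ?_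
    · rw [hcard] at h1
      refine hacc K x hx ?_
      filter_upwards [mem_nhdsWithin_of_mem_nhds ((hU.inter hV).mem_nhds ⟨hxU, hxV⟩),
        self_mem_nhdsWithin] with y hy1 hy2
      exact h1 y ⟨hy1, hy2⟩
    · rintro y hy ⟨⟨hyU, hyV⟩, hyx⟩
      obtain ⟨j, hj, hyj⟩ := h y hy hyU
      refine ⟨j, Finset.mem_erase.2 ⟨?_, hj⟩, hyj⟩
      rintro rfl
      exact hyx (hVD.subset ⟨hyV, hyj⟩)

section
variable {X Y Z : Type} [Enc X] [Enc Y] [Enc Z] [PseudoMetricSpace X] [PseudoMetricSpace Y] [DMet L X] [DMet L Y]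

theorem DS.contAt {f : Z → X → Y} (hf : DM L fun q : Z × X => f q.1 q.2) :
    DS L {q : Z × X | ContinuousAt (f q.1) q.2} := by
  simp only [ContinuousAt, Metric.tendsto_nhds]
  have : DM L fun q : ((Z × X) × ℝ) × X => f q.1.1.1 q.1.1.2 :=
    DM.comp (f := fun q : Z × X => f q.1 q.2) hf (by fun_prop)
  have : DM L fun q : ((Z × X) × ℝ) × X => f q.1.1.1 q.2 :=
    DM.comp (f := fun q : Z × X => f q.1 q.2) (g := fun q : ((Z × X) × ℝ) × X => (q.1.1.1, q.2)) hf (by fun_prop)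
  exact dsolve

theorem Good.gcont [BaireSpace X] (hX : Good L X) {f : X → ℝ} (hf : DM L f) :
    Dense (interior {x | ContinuousAt f x}) := by
  have h0 : DS L {x | ContinuousAt f x} := by
    have := DS.contAt (L := L) (Z := ℝ) (f := fun _ => f) (by fun_prop)
    exact DS.mem (f := fun x : X => ((0 : ℝ), x)) this (by fun_prop)
  refine hX.dense h0 ?_
  have h1 : ∀ n : ℕ, Dense (⋃ q : ℚ, interior {x | (q : ℝ) < f x ∧ f x < q + 1 / (n + 1)}) := by
    intro n
    refine dense_iff_inter_open.2 fun U hU hne => ?_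
    obtain ⟨q, x, h1, h2⟩ := hX.cover (L := L) hU hne (S := fun q : ℚ => {x | (q : ℝ) < f x ∧ f x < q + 1 / (n + 1)})
      (fun q => dsolve) fun x _ => by
        obtain ⟨q, hq1, hq2⟩ := exists_rat_btwn (show f x - 1 / (n + 1) < f x by
          have : (0 : ℝ) < 1 / (n + 1) := by positivity
          linarith)
        exact mem_iUnion.2 ⟨q, hq2, by linarith⟩
    exact ⟨x, h1, mem_iUnion.2 ⟨q, h2⟩⟩
  refine (dense_iInter_of_isOpen (fun n => isOpen_iUnion fun q => isOpen_interior) h1).mono fun x hx => ?_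
  rw [mem_ofPred_eq, Metric.continuousAt_iff']
  intro ε hε
  obtain ⟨n, hn⟩ := exists_nat_one_div_lt hε
  obtain ⟨q, hq⟩ := mem_iUnion.1 (mem_iInter.1 hx n)
  have hx1 := interior_subset hq
  filter_upwards [mem_interior_iff_mem_nhds.1 hq] with y hy
  rw [Real.dist_eq, abs_lt]
  constructor <;> linarith [hx1.1, hx1.2, hy.1, hy.2]
end

theorem mono_of_right {f : ℝ → ℝ} {a b : ℝ} (hf : ContinuousOn f (Ioo a b))
    (h : ∀ x ∈ Ioo a b, ∀ᶠ y in 𝓝[>] x, f x ≤ f y) : MonotoneOn f (Ioo a b) := by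
  intro x hx y hy hxy
  have hsub : Icc x y ⊆ Ioo a b := fun z hz => ⟨hx.1.trans_le hz.1, hz.2.trans_lt hy.2⟩
  have := IsClosed.Icc_subset_of_forall_exists_gt (s := {z | f x ≤ f z}) (a := x) (b := y) ?_ (le_refl (f x)) ?_
  · exact this ⟨hxy, le_rfl⟩
  · have := (hf.mono hsub).preimage_isClosed_of_isClosed isClosed_Icc (isClosed_Ici (a := f x))
    rwa [inter_comm]
  · rintro z ⟨hz1, hz2⟩ w hw
    have h1 := h z (hsub ⟨hz2.1, hz2.2.le⟩)
    obtain ⟨u, hu1, hu2⟩ := (h1.and (Ioc_mem_nhdsGT hw)).exists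
    exact ⟨u, le_trans hz1 hu1, hu2⟩

theorem mono_gen {f : ℝ → ℝ} (hf : DM L f) {W : Set ℝ} (hW : IsOpen W) (hne : W.Nonempty)
    (hc : ContinuousOn f W) : ∃ a b, a < b ∧ Ioo a b ⊆ W ∧
      (MonotoneOn f (Ioo a b) ∨ AntitoneOn f (Ioo a b)) := by
  have d1 : DS L {x | ∀ᶠ y in 𝓝[>] x, f x ≤ f y} := by
    simp only [eventually_nhdsWithin_iff, mem_Ioi]; exact dsolve
  have d2 : DS L {x | ∀ᶠ y in 𝓝[>] x, f y ≤ f x} := by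
    simp only [eventually_nhdsWithin_iff, mem_Ioi]; exact dsolve
  obtain ⟨a, b, hab, hs, h⟩ := one_dim d1 hW hne
  have hab' : (a : ℝ) < b := by exact_mod_cast hab
  rcases h with h | h
  · exact ⟨a, b, hab', hs, .inl (mono_of_right (hc.mono hs) h)⟩
  obtain ⟨c, d, hcd, hs', h'⟩ := one_dim d2 (isOpen_Ioo (a := (a : ℝ)) (b := b)) (nonempty_Ioo.2 hab')
  have hcd' : (c : ℝ) < d := by exact_mod_cast hcd
  rcases h' with h' | h'
  · refine ⟨c, d, hcd', hs'.trans hs, .inr ?_⟩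
    have := mono_of_right (f := fun x => - f x) (hc.mono (hs'.trans hs)).neg
      fun x hx => (mem_ofPred.1 (h' hx)).mono fun y hy => neg_le_neg hy
    exact fun x hx y hy hxy => neg_le_neg_iff.1 (this hx hy hxy)
  exfalso
  obtain ⟨x₀, hx₀⟩ := nonempty_Ioo.2 hcd'
  let S : Set ℝ := {x | ((c : ℝ) < x ∧ x < d) ∧ f x = f x₀}
  have hS : DS L S := dsolve
  have hacc : ∀ x ∈ S, ∃ᶠ y in 𝓝[>] x, y ∈ S := by
    rintro x ⟨hx, hfx⟩
    have h1 := h x (hs' hx)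
    have h2 := h' x hx
    simp only [mem_ofPred_eq, not_eventually, not_le] at h1 h2
    rw [frequently_nhdsWithin_iff, Metric.nhds_basis_ball.frequently_iff] at *
    intro ε hε
    have hδ : 0 < min ε (d - x) := lt_min hε (by linarith [hx.2])
    obtain ⟨y, hy, hyf, hyx⟩ := h1 _ hδ
    obtain ⟨z, hz, hzf, hzx⟩ := h2 _ hδ
    rw [Real.ball_eq_Ioo] at hy hz
    have hm1 := min_le_left ε (d - x); have hm2 := min_le_right ε (d - x)
    have hI : uIcc y z ⊆ Ioo x (x + min ε (d - x)) :=
      (ordConnected_Ioo).uIcc_subset ⟨hyx, hy.2⟩ ⟨hzx, hz.2⟩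
    have hcon : ContinuousOn f (uIcc y z) := hc.mono fun u hu => hs (hs' ⟨by linarith [(hI hu).1, hx.1],
      by linarith [(hI hu).2]⟩)
    obtain ⟨u, hu, hfu⟩ := intermediate_value_uIcc hcon (show f x ∈ uIcc (f y) (f z) from by
      rw [uIcc_of_le (hyf.le.trans hzf.le)]; exact ⟨hyf.le, hzf.le⟩)
    have := hI hu
    refine ⟨u, ?_, ⟨⟨by linarith [hx.1, this.1], by linarith [this.2]⟩, hfu.trans hfx⟩, this.1⟩
    rw [Real.ball_eq_Ioo]; constructor <;> linarith [this.1, this.2]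
  obtain ⟨N, U, D, hU, hD, hSU⟩ := hS.struct
  have hU0 : U = ∅ := by
    rw [eq_empty_iff_forall_notMem]
    intro x hx
    have hx' : x ∈ S := hSU ▸ .inl hx
    refine h x (hs' hx'.1) ?_
    filter_upwards [mem_nhdsWithin_of_mem_nhds (hU.mem_nhds hx)] with y hy
    have hy' : y ∈ S := hSU ▸ .inl hy
    rw [hy'.2, hx'.2]
  refine cb hD (S := fun _ => S) (fun _ => le_rfl) (fun _ x hx => (hacc x hx).filter_mono
    (nhdsWithin_mono _ fun y hy => ne_of_gt hy)) Finset.univ univ isOpen_univ (fun x hx _ => ?_) x₀ trivial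
    ⟨hx₀, rfl⟩
  rw [hSU, hU0, empty_union] at hx
  obtain ⟨i, hi⟩ := mem_iUnion.1 hx
  exact ⟨i, Finset.mem_univ _, hi⟩

theorem diff_dense {f : ℝ → ℝ} (hf : DM L f) {W : Set ℝ} (hW : IsOpen W) (hne : W.Nonempty) :
    ∃ x ∈ W, DifferentiableAt ℝ f x := by
  have h1 := (goodR (L := L)).gcont hf
  obtain ⟨a, b, hab, hs, h⟩ := mono_gen hf (hW.inter isOpen_interior)
    (h1.inter_open_nonempty W hW hne) fun x hx =>
      (show ContinuousAt f x from interior_subset hx.2).continuousWithinAt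
  have h2 : ∀ᵐ x, x ∈ Ioo a b → DifferentiableWithinAt ℝ f (Ioo a b) x := by
    rcases h with h | h
    · exact h.ae_differentiableWithinAt_of_mem
    · filter_upwards [h.neg.ae_differentiableWithinAt_of_mem] with x hx hx'
      simpa using (hx hx').neg
  have h3 : ∃ᵐ x, x ∈ Ioo a b := frequently_ae_mem_iff.2 (by simp [hab])
  obtain ⟨x, hx, hx'⟩ := (h3.and_eventually h2).exists
  exact ⟨x, (hs hx).1, (hx' hx).differentiableAt (isOpen_Ioo.mem_nhds hx)⟩
end Generic

section GenCp
variable {L : FirstOrder.Language} [L.Structure ℝ] [hL : Fact (DMinimal L)]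
variable {m : ℕ}

def pd (i : Fin m) (f : (Fin m → ℝ) → ℝ) (x : Fin m → ℝ) : ℝ :=
  deriv (fun t => f (Function.update x i t)) (x i)
def ld (i : Fin m) (f : (Fin m → ℝ) → ℝ) (x : Fin m → ℝ) : Prop :=
  DifferentiableAt ℝ (fun t => f (Function.update x i t)) (x i)

theorem pd_tele {f : (Fin m → ℝ) → ℝ} {x : Fin m → ℝ} {c : Fin m → ℝ} {ε δ : ℝ}
    (h : ∀ y ∈ Metric.ball x δ, ∀ i, ld i f y ∧ |pd i f y - c i| ≤ ε) (s : Finset (Fin m)) :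
    ∀ y ∈ Metric.ball x δ, (∀ i ∉ s, y i = x i) →
      |f y - f x - ∑ i ∈ s, c i * (y i - x i)| ≤ ε * ∑ i ∈ s, |y i - x i| := by
  induction s using Finset.induction_on with
  | empty =>
    intro y _ hy
    have : y = x := funext fun i => hy i (by simp)
    simp [this]
  | insert a s ha ih =>
    intro y hy hys
    have hδ : 0 < δ := dist_nonneg.trans_lt hy
    have hb : ∀ t, |t - x a| ≤ |y a - x a| → Function.update y a t ∈ Metric.ball x δ := by
      intro t ht
      rw [Metric.mem_ball, dist_pi_lt_iff hδ] at *
      intro j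
      rcases eq_or_ne j a with rfl | hj
      · simpa [Real.dist_eq] using ht.trans_lt (hy j)
      · simpa [hj] using hy j
    have h1 := ih (Function.update y a (x a)) (hb _ (by simp)) (fun i hi => by
      rcases eq_or_ne i a with rfl | hj
      · simp
      · simpa [hj] using hys i (by simp [hi, hj]))
    have hmv : ∀ t ∈ uIcc (x a) (y a), HasDerivWithinAt (fun t => f (Function.update y a t) - c a * t)
        (pd a f (Function.update y a t) - c a) (uIcc (x a) (y a)) t := by
      intro t ht
      have h2 := (h _ (hb t (by
        have := abs_sub_left_of_mem_uIcc ht; simpa [abs_sub_comm] using this)) a).1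
      have h3 : HasDerivAt (fun t => f (Function.update y a t)) (pd a f (Function.update y a t)) t := by
        have := h2.hasDerivAt
        simpa [ld, pd] using this
      simpa using (h3.fun_sub ((hasDerivAt_id' t).const_mul (c a))).hasDerivWithinAt
    have h4 := (convex_uIcc (x a) (y a)).norm_image_sub_le_of_norm_hasDerivWithin_le (C := ε) hmv
      (fun t ht => (h _ (hb t (by
        have := abs_sub_left_of_mem_uIcc ht; simpa [abs_sub_comm] using this)) a).2)
      left_mem_uIcc right_mem_uIcc
    rw [Finset.sum_insert ha, Finset.sum_insert ha]
    have e1 : ∀ g : ℝ → ℝ → ℝ, ∑ i ∈ s, g (c i) (Function.update y a (x a) i - x i) =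
        ∑ i ∈ s, g (c i) (y i - x i) := fun g => Finset.sum_congr rfl fun i hi => by
      rw [Function.update_of_ne (ne_of_mem_of_not_mem hi ha)]
    have e2 := e1 fun u v => u * v
    have e3 := e1 fun u v => |v|
    rw [e2, e3] at h1
    simp only [Function.update_eq_self, Real.norm_eq_abs] at h4
    calc _ = |(f y - c a * y a - (f (Function.update y a (x a)) - c a * x a)) +
        (f (Function.update y a (x a)) - f x - ∑ i ∈ s, c i * (y i - x i))| := by congr 1; ring
      _ ≤ _ := (abs_add_le _ _).trans (by linarith)

theorem fd_of_pd {f : (Fin m → ℝ) → ℝ} {x : Fin m → ℝ} (h1 : ∀ᶠ y in 𝓝 x, ∀ i, ld i f y)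
    (h2 : ∀ i, ContinuousAt (pd i f) x) :
    HasFDerivAt f (∑ i, pd i f x • (ContinuousLinearMap.proj i : (Fin m → ℝ) →L[ℝ] ℝ)) x := by
  rw [hasFDerivAt_iff_isLittleO, Asymptotics.isLittleO_iff]
  intro c hc
  have hε : 0 < c / (m + 1) := by positivity
  have h3 : ∀ᶠ y in 𝓝 x, ∀ i, |pd i f y - pd i f x| ≤ c / (m + 1) := eventually_all.2 fun i =>
    ((Metric.continuousAt_iff'.1 (h2 i)) _ hε).mono fun y hy => le_of_lt hy
  obtain ⟨δ, hδ, hb⟩ := Metric.eventually_nhds_iff_ball.1 (h1.and h3)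
  filter_upwards [Metric.ball_mem_nhds x hδ] with y hy
  have := pd_tele (fun y hy i => ⟨(hb y hy).1 i, (hb y hy).2 i⟩) Finset.univ y hy (by simp)
  simp only [sum_apply, smul_apply, ContinuousLinearMap.proj_apply,
    Pi.sub_apply, smul_eq_mul, Real.norm_eq_abs]
  refine this.trans ?_
  have h5 : ∑ i, |y i - x i| ≤ m * ‖y - x‖ := by
    have := Finset.sum_le_card_nsmul (Finset.univ : Finset (Fin m)) (fun i => |y i - x i|) ‖y - x‖
      fun i _ => norm_le_pi_norm (y - x) i
    simpa using this
  calc _ ≤ c / (m + 1) * (m * ‖y - x‖) := by gcongr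
    _ = c * ‖y - x‖ * (m / (m + 1)) := by ring
    _ ≤ c * ‖y - x‖ * 1 := by gcongr; rw [div_le_one (by positivity)]; linarith
    _ = _ := mul_one _

theorem contDiffAt_succ_pd {f : (Fin m → ℝ) → ℝ} {x : Fin m → ℝ} {p : ℕ} :
    ContDiffAt ℝ (p + 1 : ℕ) f x ↔ (∀ᶠ y in 𝓝 x, ∀ i, ld i f y) ∧ ∀ i, ContDiffAt ℝ p (pd i f) x := by
  constructor
  · intro h
    have h1 : ∀ᶠ y in 𝓝 x, ∀ i, HasDerivAt (fun t => f (Function.update y i t))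
        (fderiv ℝ f y (Pi.single i 1)) (y i) := by
      filter_upwards [h.eventually (by simp)] with y hy i
      have := (hy.differentiableAt (by simp)).hasFDerivAt
      have h3 : HasFDerivAt f (fderiv ℝ f y) (Function.update y i (y i)) := by simpa using this
      exact h3.comp_hasDerivAt _ (hasDerivAt_update y i (y i))
    refine ⟨h1.mono fun y hy i => (hy i).differentiableAt, fun i => ?_⟩
    have h2 : ContDiffAt ℝ p (fun y => fderiv ℝ f y (Pi.single i 1)) x :=
      (h.fderiv_right (m := p) (by simp)).clm_apply contDiffAt_const
    exact h2.congr_of_eventuallyEq (h1.mono fun y hy => (hy i).deriv)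
  · rintro ⟨h1, h2⟩
    rw [Nat.cast_add, Nat.cast_one, contDiffAt_succ_iff_hasFDerivAt]
    refine ⟨fun x => ∑ i, pd i f x • (ContinuousLinearMap.proj i : (Fin m → ℝ) →L[ℝ] ℝ), ⟨_, ?_, fun y hy => hy⟩,
      ContDiffAt.sum fun i _ => (h2 i).smul contDiffAt_const⟩
    filter_upwards [eventually_eventually_nhds.2 h1,
      eventually_all.2 fun i => (h2 i).eventually (by simp)] with y hy1 hy2
    exact fd_of_pd hy1 fun i => (hy2 i).continuousAt

@[fun_prop] theorem DM.update {X : Type} [Enc X] {a : X → Fin m → ℝ} {b : X → ℝ} (i : Fin m)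
    (ha : DM L a) (hb : DM L b) : DM L fun x => Function.update (a x) i (b x) := by
  refine DM.pi fun j => ?_
  rcases eq_or_ne j i with rfl | h
  · simpa using hb
  · simp only [Function.update_of_ne h]; fun_prop

variable {X : Type} [Enc X]
theorem DS.hasDeriv {f : X → ℝ → ℝ} (hf : DM L fun q : X × ℝ => f q.1 q.2) {a v : X → ℝ} (ha : DM L a)
    (hv : DM L v) : DS L {q | HasDerivAt (f q) (v q) (a q)} := by
  simp only [hasDerivAt_iff_isLittleO, Asymptotics.isLittleO_iff, Real.norm_eq_abs, smul_eq_mul]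
  have : DM L fun q : (X × ℝ) × ℝ => f q.1.1 q.2 :=
    DM.comp (f := fun q : X × ℝ => f q.1 q.2) (g := fun q : (X × ℝ) × ℝ => (q.1.1, q.2)) hf (by fun_prop)
  have : DM L fun q : (X × ℝ) × ℝ => f q.1.1 (a q.1.1) :=
    DM.comp (f := fun q : X × ℝ => f q.1 q.2) (g := fun q : (X × ℝ) × ℝ => (q.1.1, a q.1.1)) hf (by fun_prop)
  exact dsolve

theorem DS.diffAt {f : X → ℝ → ℝ} (hf : DM L fun q : X × ℝ => f q.1 q.2) {a : X → ℝ} (ha : DM L a) :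
    DS L {q | DifferentiableAt ℝ (f q) (a q)} := by
  have : DS L {q | ∃ v, HasDerivAt (f q) v (a q)} :=
    DS.ex (P := fun q v => HasDerivAt (f q) v (a q)) (DS.hasDeriv (f := fun q : X × ℝ => f q.1)
    (DM.comp (f := fun q : X × ℝ => f q.1 q.2) (g := fun q : (X × ℝ) × ℝ => (q.1.1, q.2)) hf (by fun_prop))
    (by fun_prop) (by fun_prop))
  exact this.mk fun q => ⟨fun h => ⟨_, h.hasDerivAt⟩, fun ⟨v, h⟩ => h.differentiableAt⟩

theorem DM.deriv {f : X → ℝ → ℝ} (hf : DM L fun q : X × ℝ => f q.1 q.2) {a : X → ℝ} (ha : DM L a) :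
    DM L fun q => deriv (f q) (a q) := by
  have h1 := DS.diffAt hf ha
  have h2 : DS L {q : X × ℝ | HasDerivAt (f q.1) q.2 (a q.1)} := DS.hasDeriv (f := fun q : X × ℝ => f q.1)
    (DM.comp (f := fun q : X × ℝ => f q.1 q.2) (g := fun q : (X × ℝ) × ℝ => (q.1.1, q.2)) hf (by fun_prop))
    (by fun_prop) (by fun_prop)
  have h3 : DS L {q : X × ℝ | DifferentiableAt ℝ (f q.1) (a q.1)} := DS.mem (f := fun q : X × ℝ => q.1) h1 (by fun_prop)
  refine DS.mk (P := fun q : X × ℝ => HasDerivAt (f q.1) q.2 (a q.1) ∨ (¬ DifferentiableAt ℝ (f q.1) (a q.1) ∧ q.2 = 0))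
    dsolve ?_
  rintro ⟨x, y⟩
  by_cases h : DifferentiableAt ℝ (f x) (a x)
  · simp only [mem_ofPred_eq, h, not_true, false_and, or_false]
    exact ⟨fun e => e ▸ h.hasDerivAt, fun e => e.deriv.symm⟩
  · simp only [mem_ofPred_eq, h, not_false_eq_true, true_and]
    rw [deriv_zero_of_not_differentiableAt h]
    exact ⟨.inr, fun e => e.elim (fun e => (h e.differentiableAt).elim) fun e => e⟩

theorem DM.pd {f : X → (Fin m → ℝ) → ℝ} (hf : DM L fun q : X × (Fin m → ℝ) => f q.1 q.2) (i : Fin m) :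
    DM L fun q : X × (Fin m → ℝ) => pd i (f q.1) q.2 :=
  DM.deriv (f := fun (q : X × (Fin m → ℝ)) t => f q.1 (Function.update q.2 i t))
    (DM.comp (f := fun q : X × (Fin m → ℝ) => f q.1 q.2)
    (g := fun q : (X × (Fin m → ℝ)) × ℝ => (q.1.1, Function.update q.1.2 i q.2)) hf (by fun_prop)) (by fun_prop)

theorem DS.ld {f : X → (Fin m → ℝ) → ℝ} (hf : DM L fun q : X × (Fin m → ℝ) => f q.1 q.2) (i : Fin m) :
    DS L {q : X × (Fin m → ℝ) | ld i (f q.1) q.2} :=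
  DS.diffAt (f := fun (q : X × (Fin m → ℝ)) t => f q.1 (Function.update q.2 i t))
    (DM.comp (f := fun q : X × (Fin m → ℝ) => f q.1 q.2)
    (g := fun q : (X × (Fin m → ℝ)) × ℝ => (q.1.1, Function.update q.1.2 i q.2)) hf (by fun_prop)) (by fun_prop)

theorem contDiffAt_zero' {f : (Fin m → ℝ) → ℝ} {x : Fin m → ℝ} :
    ContDiffAt ℝ (0 : ℕ) f x ↔ ∀ᶠ y in 𝓝 x, ContinuousAt f y := by
  rw [Nat.cast_zero, contDiffAt_zero]
  constructor
  · rintro ⟨u, hu, h⟩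
    filter_upwards [eventually_mem_nhds_iff.2 hu] with y hy using h.continuousAt hy
  · exact fun h => ⟨_, h, fun y hy => ContinuousAt.continuousWithinAt hy⟩

theorem DS.contDiffAt (p : ℕ) : ∀ {f : X → (Fin m → ℝ) → ℝ} (_ : DM L fun q : X × (Fin m → ℝ) => f q.1 q.2),
    DS L {q : X × (Fin m → ℝ) | ContDiffAt ℝ p (f q.1) q.2} := by
  induction p with
  | zero =>
    intro f hf
    simp only [contDiffAt_zero']
    have := DS.contAt hf
    exact DS.nhds (DS.mem (f := fun q : (X × (Fin m → ℝ)) × (Fin m → ℝ) => (q.1.1, q.2)) this (by fun_prop)) (by fun_prop)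
  | succ p ih =>
    intro f hf
    simp only [contDiffAt_succ_pd]
    refine DS.and ?_ (DS.allb fun i => ih (f := fun x => DMinPaper.pd i (f x)) (DM.pd hf i))
    refine DS.nhds (DS.allb fun i => ?_) (by fun_prop)
    exact (DS.mem (f := fun q : (X × (Fin m → ℝ)) × (Fin m → ℝ) => (q.1.1, q.2)) (DS.ld hf i) (by fun_prop))

theorem gen_ld {f : (Fin m → ℝ) → ℝ} (hf : DM L f) (i : Fin m) : Dense (interior {x | ld i f x}) := by
  refine (goodFin (L := L) m).dense (DS.mem (f := fun x : Fin m → ℝ => ((0 : ℝ), x))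
    (DS.ld (X := ℝ) (f := fun _ => f) (by fun_prop) i) (by fun_prop)) ?_
  refine dense_iff_inter_open.2 fun U hU ⟨x, hx⟩ => ?_
  have hc : Continuous fun t : ℝ => Function.update x i t := continuous_const.update i continuous_id
  obtain ⟨t, ht, hd⟩ := diff_dense (L := L) (f := fun t => f (Function.update x i t)) (by fun_prop)
    (hU.preimage hc) ⟨x i, by simpa⟩
  exact ⟨_, ht, by simpa [ld] using hd⟩

theorem gen_cp (p : ℕ) : ∀ {f : (Fin m → ℝ) → ℝ} (_ : DM L f), Dense (interior {x | ContDiffAt ℝ p f x}) := by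
  induction p with
  | zero =>
    intro f hf
    refine ((goodFin (L := L) m).gcont hf).mono (interior_maximal (fun x hx => ?_) isOpen_interior)
    exact contDiffAt_zero'.2 (mem_interior_iff_mem_nhds.1 hx)
  | succ p ih =>
    intro f hf
    have hpd : ∀ i, DM L (pd i f) := fun i => DM.comp (g := fun x : Fin m → ℝ => ((0 : ℝ), x))
      (DM.pd (X := ℝ) (f := fun _ => f) (by fun_prop) i) (by fun_prop)
    have h1 : Dense ((⋂ i, interior {x | ld i f x}) ∩ ⋂ i, interior {x | ContDiffAt ℝ p (pd i f) x}) :=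
      (dense_iInter_of_isOpen (fun i => isOpen_interior) fun i => gen_ld hf i).inter_of_isOpen_left
      (dense_iInter_of_isOpen (fun i => isOpen_interior) fun i => ih (hpd i))
      (isOpen_iInter_of_finite fun i => isOpen_interior)
    refine h1.mono (interior_maximal (fun x hx => ?_) ((isOpen_iInter_of_finite fun i => isOpen_interior).inter
      (isOpen_iInter_of_finite fun i => isOpen_interior)))
    rw [mem_inter_iff, mem_iInter, mem_iInter] at hx
    exact contDiffAt_succ_pd.2 ⟨eventually_all.2 fun i => mem_interior_iff_mem_nhds.1 (hx.1 i),
      fun i => (interior_subset (hx.2 i) :)⟩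
end GenCp

section Tower
variable {L : FirstOrder.Language} [L.Structure ℝ] [hL : Fact (DMinimal L)]

theorem dense_of_compl {X : Type} [TopologicalSpace X] {S : Set X} (h : interior Sᶜ = ∅) : Dense S := by
  simpa using interior_eq_empty_iff_dense_compl.1 h

def uch {Y : Type} [Zero Y] (P : Y → Prop) : Y := if h : ∃! y, P y then h.choose else 0
theorem uch_spec {Y : Type} [Zero Y] {P : Y → Prop} (h : ∃! y, P y) : P (uch P) := by
  rw [uch, dif_pos h]; exact h.choose_spec.1
theorem uch_eq {Y : Type} [Zero Y] {P : Y → Prop} (h : ∃! y, P y) {y : Y} (hy : P y) : y = uch P :=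
  h.unique hy (uch_spec h)
theorem DM.uch {X Y : Type} [Enc X] [Enc Y] [Zero Y] {P : X → Y → Prop} (h : DS L {q : X × Y | P q.1 q.2}) :
    DM L fun x => uch (P x) := by
  have h2 : DS L {q : (X × Y) × Y | P q.1.1 q.2} :=
    DS.mem (f := fun q : (X × Y) × Y => (q.1.1, q.2)) h (by fun_prop)
  have h3 : DS L {q : (X × Y) × Y | ∀ y', P q.1.1 y' → y' = q.2} :=
    DS.all (DS.imp (DS.mem (f := fun q : ((X × Y) × Y) × Y => (q.1.1.1, q.2)) h (by fun_prop))
      (DS.eq (by fun_prop) (by fun_prop)))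
  have h4 : DS L {q : X × Y | ∃! y, P q.1 y} := DS.ex (h2.and h3)
  refine DS.mk (P := fun q : X × Y => ((∃! y, P q.1 y) ∧ P q.1 q.2) ∨ (¬ (∃! y, P q.1 y) ∧ q.2 = 0))
    ((h4.and h).or (h4.not.and (DS.eq (by fun_prop) (by fun_prop)))) ?_
  rintro ⟨x, y⟩
  simp only [mem_ofPred_eq]
  by_cases hu : ∃! y, P x y
  · simp only [hu, true_and, not_true, false_and, or_false]
    exact ⟨fun e => e ▸ uch_spec hu, fun e => uch_eq hu e⟩
  · simp [hu, DMinPaper.uch]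

@[fun_prop] theorem DM.projc {X : Type} [Enc X] {m n : ℕ} {ι : Fin m → Fin n} {f : X → Fin n → ℝ} (hf : DM L f) :
    DM L fun x => projc ι (f x) := DM.pi fun i => DM.comp (f := fun z : Fin n → ℝ => z (ι i)) (by fun_prop) hf

theorem continuous_projc {m n : ℕ} (ι : Fin m → Fin n) : Continuous (projc ι) :=
  continuous_pi fun i => continuous_apply (ι i)

variable {n m : ℕ} (p : ℕ) (ι : Fin m → Fin n) (A : Set (Fin n → ℝ))
abbrev SP (q : (Fin n → ℝ) × ℝ) (x : Fin m → ℝ) (z : Fin n → ℝ) : Prop := z ∈ A ∧ dist z q.1 < q.2 ∧ projc ι z = x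
def RP (q : (Fin n → ℝ) × ℝ) (x : Fin m → ℝ) : Prop :=
  (∃! z, SP ι A q x z) ∧ ∀ j, ContDiffAt ℝ p (fun x => uch (SP ι A q x) j) x
def RR : Set (Fin n → ℝ) := {z | ∃ q, ∃ v : (Fin m → ℝ) × ℝ, dist z q.1 < q.2 ∧ dist (projc ι z) v.1 < v.2 ∧
  ∀ x, dist x v.1 < v.2 → RP p ι A q x}
def TT : Set (Fin n → ℝ) := {z | z ∈ A ∧ ¬ z ∈ RR p ι A}

variable {p ι A}
theorem SP.ds (hA : DS L A) : DS L {w : (((Fin n → ℝ) × ℝ) × (Fin m → ℝ)) × (Fin n → ℝ) | SP ι A w.1.1 w.1.2 w.2} :=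
  dsolve
theorem TT.ds (hA : DS L A) : DS L (TT p ι A) := by
  have h1 := SP.ds (ι := ι) hA
  have h2 : DS L {w : ((Fin n → ℝ) × ℝ) × (Fin m → ℝ) | ∃! z, SP ι A w.1 w.2 z} := by
    unfold ExistsUnique; exact dsolve
  have h3 : ∀ j, DS L {w : ((Fin n → ℝ) × ℝ) × (Fin m → ℝ) |
      ContDiffAt ℝ p (fun x => uch (SP ι A w.1 x) j) w.2} := fun j => by
    have := DM.uch (P := fun w : ((Fin n → ℝ) × ℝ) × (Fin m → ℝ) => SP ι A w.1 w.2) h1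
    exact DS.contDiffAt p (f := fun q x => uch (SP ι A q x) j) (by fun_prop)
  have h4 : DS L {w : ((Fin n → ℝ) × ℝ) × (Fin m → ℝ) | RP p ι A w.1 w.2} := h2.and (DS.allb h3)
  have h5 : DS L {w : (((Fin n → ℝ) × ((Fin n → ℝ) × ℝ)) × ((Fin m → ℝ) × ℝ)) × (Fin m → ℝ) |
    RP p ι A w.1.1.2 w.2} := DS.mem (f := fun w : (((Fin n → ℝ) × ((Fin n → ℝ) × ℝ)) × ((Fin m → ℝ) × ℝ)) × (Fin m → ℝ) =>
    (w.1.1.2, w.2)) h4 (by fun_prop)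
  have h6 : DS L (RR p ι A) := by unfold RR; exact dsolve
  unfold TT
  exact dsolve

theorem TT.closed (hA : IsClosed A) : IsClosed (TT p ι A) := by
  have : IsOpen (RR p ι A) := by
    rw [isOpen_iff_mem_nhds]
    rintro z ⟨q, v, h1, h2, h3⟩
    have h4 : ∀ᶠ y in 𝓝 z, dist y q.1 < q.2 := (continuous_id.dist continuous_const).continuousAt.eventually_lt_const h1
    have h5 : ∀ᶠ y in 𝓝 z, dist (projc ι y) v.1 < v.2 :=
      ((continuous_projc ι).dist continuous_const).continuousAt.eventually_lt_const h2
    filter_upwards [h4, h5] with y hy1 hy2 using ⟨q, v, hy1, hy2, h3⟩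
  exact hA.inter this.isClosed_compl

theorem RR.spec {z : Fin n → ℝ} (hz : z ∈ RR p ι A) : ∃ (U : Set (Fin n → ℝ)) (V : Set (Fin m → ℝ))
    (σ : (Fin m → ℝ) → (Fin n → ℝ)), IsOpen U ∧ IsOpen V ∧ z ∈ U ∧ projc ι z ∈ V ∧ ContDiffOn ℝ p σ V ∧
      (∀ x ∈ V, σ x ∈ A ∧ σ x ∈ U ∧ projc ι (σ x) = x) ∧ ∀ y ∈ A, y ∈ U → projc ι y ∈ V → y = σ (projc ι y) := by
  obtain ⟨q, v, h1, h2, h3⟩ := hz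
  refine ⟨Metric.ball q.1 q.2, Metric.ball v.1 v.2, fun x => uch (SP ι A q x), Metric.isOpen_ball,
    Metric.isOpen_ball, h1, h2, fun x hx => ContDiffAt.contDiffWithinAt (contDiffAt_pi.2 fun j => (h3 x hx).2 j),
    fun x hx => uch_spec (h3 x hx).1, fun y hy hyU hyV => uch_eq (h3 _ hyV).1 ⟨hy, hyU, rfl⟩⟩

/-- fibres of `TT` consist generically of accumulation points -/
theorem TT.gen (hA : DS L A) : Dense (interior {x | ∀ z, z ∈ TT p ι A → projc ι z = x →
    ∀ r, 0 < r → ∃ z', z' ∈ A ∧ projc ι z' = x ∧ dist z' z < r ∧ z' ≠ z}) := by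
  have hT := TT.ds (p := p) (ι := ι) hA
  refine (goodFin (L := L) m).dense dsolve ?_
  refine dense_of_compl ?_
  by_contra hne
  rw [← ne_eq, ← nonempty_iff_ne_empty] at hne
  let S : (Fin n → ℚ) × ℚ → Set (Fin m → ℝ) := fun c => {x | ∃ z, z ∈ TT p ι A ∧ projc ι z = x ∧
    dist z (fun i => (c.1 i : ℝ)) < c.2 ∧ ∀ z', z' ∈ A → projc ι z' = x → dist z' (fun i => (c.1 i : ℝ)) < c.2 → z' = z}
  obtain ⟨c, hc⟩ := (goodFin (L := L) m).cover isOpen_interior hne (S := S) (fun c => dsolve) (by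
    intro x hx
    have hx := interior_subset hx
    simp only [mem_compl_iff, mem_ofPred_eq] at hx
    push Not at hx
    obtain ⟨z, hz, hzx, r, hr, h⟩ := hx
    have : DenseRange (fun (c : Fin n → ℚ) i => (c i : ℝ)) := by
      exact DenseRange.piMap fun _ => Rat.denseRange_cast
    obtain ⟨c, hc⟩ := this.exists_dist_lt z (show 0 < r / 4 by linarith)
    obtain ⟨s, hs1, hs2⟩ := exists_rat_btwn (show r / 4 < r / 2 by linarith)
    refine mem_iUnion.2 ⟨(c, s), z, hz, hzx, hc.trans hs1, fun z' hz' hz'x hd => ?_⟩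
    refine h z' hz' hz'x ?_
    have := dist_triangle_right z' z (fun i => (c i : ℝ))
    linarith [show dist z' (fun i => (c i : ℝ)) < s from hd])
  have hex : ∀ x ∈ interior (S c), ∃! z, SP ι A (fun i => (c.1 i : ℝ), (c.2 : ℝ)) x z := fun x hx => by
    obtain ⟨z, h1, h2, h3, h4⟩ := interior_subset hx
    exact ⟨z, ⟨h1.1, h3, h2⟩, fun z' hz' => h4 z' hz'.1 hz'.2.2 hz'.2.1⟩
  have hd : Dense (⋂ j, interior {x | ContDiffAt ℝ p (fun x => uch (SP ι A (fun i => (c.1 i : ℝ), (c.2 : ℝ)) x) j) x}) := by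
    refine dense_iInter_of_isOpen (fun j => isOpen_interior) fun j => gen_cp (L := L) p ?_
    have h1 := DM.uch (P := fun w : ((Fin n → ℝ) × ℝ) × (Fin m → ℝ) => SP ι A w.1 w.2) (SP.ds hA)
    have h2 : DM L fun x => uch (SP ι A (fun i => (c.1 i : ℝ), (c.2 : ℝ)) x) :=
      DM.comp (g := fun x : Fin m → ℝ => (((fun i => (c.1 i : ℝ)), (c.2 : ℝ)), x)) h1 (by fun_prop)
    fun_prop
  obtain ⟨e, he1, he2⟩ := hd.inter_open_nonempty _ isOpen_interior (hc.mono inter_subset_right)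
  obtain ⟨δ, hδ, hb⟩ := Metric.isOpen_iff.1 (isOpen_interior.inter (isOpen_iInter_of_finite fun j => isOpen_interior))
    e ⟨he1, he2⟩
  obtain ⟨z, h1, h2, h3, h4⟩ := interior_subset he1
  refine h1.2 ⟨_, (e, δ), h3, by simpa [h2], fun x hx => ⟨hex x (hb hx).1, fun j => ?_⟩⟩
  exact interior_subset (mem_iInter.1 (hb hx).2 j)

variable (m) in
def Small (A : Set (Fin n → ℝ)) : Prop := ∀ ι : Fin m → Fin n, interior (projc ι '' A) = ∅

theorem DS.proj (hA : DS L A) : DS L (projc ι '' A) := by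
  refine DS.mk (P := fun x => ∃ z, z ∈ A ∧ projc ι z = x) dsolve fun x => Iff.rfl

theorem Small.gen (hA : DS L A) (hs : Small (m + 1) A) (i : Fin n) :
    Dense (interior {x | ∀ a b : ℝ, a < b → ∃ t, a < t ∧ t < b ∧ ¬ ∃ z, z ∈ A ∧ projc ι z = x ∧ z i = t}) := by
  refine (goodFin (L := L) m).dense dsolve ?_
  refine dense_of_compl ?_
  by_contra hne
  rw [← ne_eq, ← nonempty_iff_ne_empty] at hne
  let S : ℚ × ℚ → Set (Fin m → ℝ) := fun c => {x | (c.1 : ℝ) < c.2 ∧ ∀ t, (c.1 : ℝ) < t → t < c.2 →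
    ∃ z, z ∈ A ∧ projc ι z = x ∧ z i = t}
  obtain ⟨c, x, hc⟩ := (goodFin (L := L) m).cover isOpen_interior hne (S := S) (fun c => dsolve) (by
    intro x hx
    have hx := interior_subset hx
    simp only [mem_compl_iff, mem_ofPred_eq] at hx
    push Not at hx
    obtain ⟨a, b, hab, h⟩ := hx
    obtain ⟨s, hs1, hs2⟩ := exists_rat_btwn hab
    obtain ⟨s', hs1', hs2'⟩ := exists_rat_btwn hs2
    exact mem_iUnion.2 ⟨(s, s'), hs1', fun t h1 h2 => h t (hs1.trans h1) (h2.trans hs2')⟩)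
  have hcx := interior_subset hc.2
  have ho : IsOpen ((fun w : Fin (m + 1) → ℝ => (w 0, Fin.tail w)) ⁻¹' (Ioo (c.1 : ℝ) c.2 ×ˢ interior (S c))) := by
    refine (isOpen_Ioo.prod isOpen_interior).preimage ?_
    exact (continuous_apply 0).prodMk (continuous_pi fun j => continuous_apply _)
  obtain ⟨t, ht⟩ := exists_between hcx.1
  have : Fin.cons t x ∈ interior (projc (Fin.cons i ι : Fin (m + 1) → Fin n) '' A) := by
    refine mem_interior.2 ⟨_, ?_, ho, by simpa using ⟨ht, hc.2⟩⟩
    rintro w ⟨h1, h2⟩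
    obtain ⟨z, h3, h4, h5⟩ := (interior_subset h2).2 (w 0) h1.1 h1.2
    refine ⟨z, h3, funext fun j => ?_⟩
    refine Fin.cases ?_ (fun j => ?_) j
    · exact h5
    · exact congrFun h4 j
  rw [hs] at this
  exact this

theorem Small.step (hA : DS L A) (hs : Small (m + 1) A) (ι : Fin m → Fin n) :
    ∃ K, interior (projc ι '' ((TT p ι)^[K] A)) = ∅ := by
  have hN : ∀ i : Fin n, ∃ N : ℕ, ∀ x : Fin m → ℝ, ∃ (U : Set ℝ) (D : Fin N → Set ℝ), IsOpen U ∧ (∀ i, IsDiscreteSet (D i)) ∧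
        {t : ℝ | ∃ z, z ∈ A ∧ projc ι z = x ∧ z i = t} = U ∪ ⋃ i, D i := fun i =>
    DS.fib (L := L) (s := {q : (Fin m → ℝ) × ℝ | ∃ z, z ∈ A ∧ projc ι z = q.1 ∧ z i = q.2}) dsolve
  choose N hN using hN
  let K := (Finset.univ : Finset (∀ i, Fin (N i))).card
  have hds : ∀ j, DS L ((TT p ι)^[j] A) := fun j => by
    induction j with
    | zero => exact hA
    | succ j ih => rw [Function.iterate_succ_apply']; exact TT.ds ih
  refine ⟨K, ?_⟩
  by_contra hne
  rw [← ne_eq, ← nonempty_iff_ne_empty] at hne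
  have hd : Dense (⋂ i : Fin n, interior {x | ∀ a b : ℝ, a < b → ∃ t, a < t ∧ t < b ∧ ¬ ∃ z, z ∈ A ∧ projc ι z = x ∧ z i = t}) :=
    dense_iInter_of_isOpen (fun j => isOpen_interior) fun i => Small.gen hA hs i
  obtain ⟨x, ⟨hx1, hx2⟩, hx3⟩ := (dense_iInter_of_isOpen (ι := ℕ) (fun j => isOpen_interior)
    fun j => TT.gen (p := p) (ι := ι) (hds j)).inter_open_nonempty _ (isOpen_interior.inter
      (isOpen_iInter_of_finite fun j => isOpen_interior)) (hd.inter_open_nonempty _ isOpen_interior hne)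
  obtain ⟨z, hz, hzx⟩ := interior_subset hx1
  choose U D hU hD hUD using fun i => hN i x
  have hU0 : ∀ i, U i = ∅ := fun i => by
    by_contra h
    obtain ⟨t, ht⟩ := nonempty_iff_ne_empty.2 h
    obtain ⟨ε, hε, hb⟩ := Metric.isOpen_iff.1 (hU i) t ht
    obtain ⟨s, hs1, hs2, hs3⟩ := interior_subset (mem_iInter.1 hx2 i) (t - ε) (t + ε) (by linarith)
    have : s ∈ {t : ℝ | ∃ z, z ∈ A ∧ projc ι z = x ∧ z i = t} := by
      rw [hUD]; exact .inl (hb (by rw [Real.ball_eq_Ioo]; exact ⟨hs1, hs2⟩))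
    exact hs3 this
  refine cb (X := Fin n → ℝ) (ι := ∀ i, Fin (N i)) (D := fun f => {z | ∀ i, z i ∈ D i (f i)}) ?_
    (S := fun j => {z | z ∈ (TT p ι)^[j] A ∧ projc ι z = x}) ?_ ?_ Finset.univ univ isOpen_univ ?_ z (mem_univ _) ⟨hz, hzx⟩
  · intro f w hw
    choose V hV hVD using fun i => hD i (f i) (w i) (hw i)
    refine ⟨{y | ∀ i, y i ∈ V i}, ?_, ?_⟩
    · have := isOpen_set_pi (finite_univ (α := Fin n)) (s := V) fun i _ => hV i
      convert this using 1; ext; simp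
    · ext y
      have : ∀ i, y i ∈ V i ∧ y i ∈ D i (f i) ↔ y i = w i := fun i => by
        rw [← mem_inter_iff, hVD]; rfl
      simp only [mem_inter_iff, mem_ofPred_eq, ← forall_and, this, mem_singleton_iff, funext_iff]
  · intro j y hy
    rw [mem_ofPred_eq, Function.iterate_succ_apply'] at hy
    exact ⟨hy.1.1, hy.2⟩
  · intro j y hy
    rw [mem_ofPred_eq, Function.iterate_succ_apply'] at hy
    have := interior_subset (mem_iInter.1 hx3 j) y hy.1 hy.2
    rw [frequently_nhdsWithin_iff, (Metric.nhds_basis_ball).frequently_iff]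
    intro r hr
    obtain ⟨z', h1, h2, h3, h4⟩ := this r hr
    exact ⟨z', h3, ⟨h1, h2⟩, h4⟩
  · intro y hy _
    have : ∀ i, ∃ j, y i ∈ D i j := fun i => by
      have : y i ∈ {t : ℝ | ∃ z, z ∈ A ∧ projc ι z = x ∧ z i = t} := ⟨y, hy.1, hy.2, rfl⟩
      rw [hUD, hU0, empty_union] at this
      exact mem_iUnion.1 this
    choose f hf using this
    exact ⟨f, Finset.mem_univ _, hf⟩

theorem TT.sub : TT p ι A ⊆ A := fun _ h => h.1
theorem Small.mono {B : Set (Fin n → ℝ)} (h : Small m A) (hB : B ⊆ A) : Small m B := fun ι =>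
  subset_empty_iff.1 ((interior_mono (image_mono hB)).trans (h ι).subset)

variable (L p) in
theorem tower (Pr : Set (Fin n → ℝ) → Prop) (h0 : Pr ∅)
    (hs : ∀ m (ι : Fin m → Fin n) A, IsClosed A → DS L A → Pr (TT p ι A) → Pr A) :
    ∀ A, IsClosed A → DS L A → Pr A := by
  have key : ∀ m A, IsClosed A → DS L A → Small m A → Pr A := by
    intro m
    induction m with
    | zero =>
      intro A hA hAD hS
      have : projc (Fin.elim0 : Fin 0 → Fin n) '' A = ∅ := by
        rw [← hS]; exact ((isOpen_discrete _).interior_eq).symm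
      rw [image_eq_empty.1 this]; exact h0
    | succ m ih =>
      suffices ∀ s : Finset (Fin m → Fin n), ∀ A, IsClosed A → DS L A → Small (m + 1) A →
          (∀ ι ∉ s, interior (projc ι '' A) = ∅) → Pr A from
        fun A h1 h2 h3 => this Finset.univ A h1 h2 h3 (by simp)
      intro s
      induction s using Finset.induction_on with
      | empty => exact fun A h1 h2 _ h4 => ih A h1 h2 fun ι => h4 ι (by simp)
      | insert ι s _ ih2 =>
        intro A h1 h2 h3 h4
        obtain ⟨K, hK⟩ := Small.step (p := p) h2 h3 ι
        suffices ∀ K A, IsClosed A → DS L A → Small (m + 1) A →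
          (∀ ι' ∉ insert ι s, interior (projc ι' '' A) = ∅) → interior (projc ι '' ((TT p ι)^[K] A)) = ∅ → Pr A from
          this K A h1 h2 h3 h4 hK
        intro K
        induction K with
        | zero =>
          intro A h1 h2 h3 h4 h5
          refine ih2 A h1 h2 h3 fun ι' hι' => ?_
          rcases eq_or_ne ι' ι with rfl | h
          · exact h5
          · exact h4 ι' (by simp [h, hι'])
        | succ K ih3 =>
          intro A h1 h2 h3 h4 h5
          exact hs m ι A h1 h2 (ih3 _ (TT.closed h1) (TT.ds h2) (h3.mono TT.sub)
            (fun ι' h => subset_empty_iff.1 ((interior_mono (image_mono TT.sub)).trans (h4 ι' h).subset)) h5)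
  refine fun A h1 h2 => key (n + 1) A h1 h2 fun ι => ?_
  obtain ⟨a, b, hab, h⟩ := Fintype.exists_ne_map_eq_of_card_lt ι (by simp)
  rw [← not_nonempty_iff_eq_empty]
  rintro ⟨w, hw⟩
  have hc : Continuous fun t : ℝ => Function.update w a t := continuous_const.update a continuous_id
  have := (isOpen_interior.preimage hc).mem_nhds (x := w a) (by simpa using hw)
  obtain ⟨ε, hε, hb⟩ := Metric.mem_nhds_iff.1 this
  have : ∀ v ∈ projc ι '' A, v a = v b := by
    rintro _ ⟨z, _, rfl⟩; simp [projc, h]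
  have h1 := this w (interior_subset hw)
  have h2 := this (Function.update w a (w a + ε / 2)) (interior_subset (hb (by simp [abs_of_pos hε, hε])))
  rw [Function.update_self, Function.update_of_ne hab.symm] at h2
  linarith
end Tower

section Flat
variable {L : FirstOrder.Language} [L.Structure ℝ] [hL : Fact (DMinimal L)]

def AC (S : Set ℝ) : Set ℝ := {x | 0 < x ∧ ∀ ε, 0 < ε → ∃ y, y ∈ S ∧ y ≠ x ∧ |y - x| < ε}

variable (L) in
def EvC : Prop := ∀ B : Set ℝ, DS L B → (∀ᶠ t in 𝓝[>] (0 : ℝ), t ∈ B) ∨ (∀ᶠ t in 𝓝[>] (0 : ℝ), t ∉ B)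
variable (L) in
def SeqS (S : Set ℝ) : Prop := DS L S ∧ S ⊆ Ioi 0 ∧ (∀ ε, 0 < ε → ∃ s ∈ S, s < ε) ∧ ∀ δ, 0 < δ → (S ∩ Ici δ).Finite

variable (L) in
theorem dich : (∃ S : Set ℝ, SeqS L S) ∨ EvC L := by
  refine or_iff_not_imp_right.2 fun h => ?_
  unfold EvC at h
  push Not at h
  obtain ⟨B, hB, h1, h2⟩ := h
  let S0 : Set ℝ := {x | 0 < x ∧ ∀ ε, 0 < ε → (∃ y, y ∈ B ∧ |y - x| < ε) ∧ ∃ y, ¬ y ∈ B ∧ |y - x| < ε}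
  have hS0 : DS L S0 := dsolve
  have hfr : ∀ x, 0 < x → x ∈ frontier B → x ∈ S0 := fun x hx h => by
    rw [frontier_eq_closure_inter_closure, mem_inter_iff, Metric.mem_closure_iff, Metric.mem_closure_iff] at h
    refine ⟨hx, fun ε hε => ?_⟩
    obtain ⟨y, hy, hy2⟩ := h.1 ε hε
    obtain ⟨z, hz, hz2⟩ := h.2 ε hε
    rw [dist_comm] at hy2 hz2
    exact ⟨⟨y, hy, hy2⟩, z, hz, hz2⟩
  let S : ℕ → Set ℝ := fun j => AC^[j] S0
  have hSs : ∀ j, S (j + 1) = AC (S j) := fun j => Function.iterate_succ_apply' _ _ _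
  have hSd : ∀ j, DS L (S j) := fun j => by
    induction j with
    | zero => exact hS0
    | succ j ih => rw [hSs]; unfold AC; exact dsolve
  have hSc : ∀ j, ∀ x, 0 < x → (∀ ε, 0 < ε → ∃ y, y ∈ S j ∧ |y - x| < ε) → x ∈ S j := fun j => by
    induction j with
    | zero =>
      refine fun x hx h => ⟨hx, fun ε hε => ?_⟩
      obtain ⟨y, hy, hyx⟩ := h (ε / 2) (half_pos hε)
      obtain ⟨⟨a, ha, hay⟩, b, hb, hby⟩ := hy.2 (ε / 2) (half_pos hε)
      exact ⟨⟨a, ha, by have := abs_sub_le a y x; linarith⟩, b, hb, by have := abs_sub_le b y x; linarith⟩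
    | succ j ih =>
      intro x hx h
      rw [hSs] at h ⊢
      refine ⟨hx, fun ε hε => ?_⟩
      obtain ⟨y, hy, hyx⟩ := h (ε / 2) (half_pos hε)
      rcases eq_or_ne y x with rfl | hne
      · exact hy.2 ε hε
      · obtain ⟨z, hz, hzy, hd⟩ := hy.2 (min (ε / 2) |y - x|) (lt_min (half_pos hε) (abs_pos.2 (sub_ne_zero.2 hne)))
        refine ⟨z, hz, fun e => ?_, ?_⟩
        · rw [e, abs_sub_comm] at hd; exact (hd.trans_le (min_le_right _ _)).false
        · have := abs_sub_le z y x; have := hd.trans_le (min_le_left _ _); linarith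
  have hSm : ∀ j, S (j + 1) ⊆ S j := fun j x hx => by
    rw [hSs] at hx
    exact hSc j x hx.1 fun ε hε => (hx.2 ε hε).imp fun y hy => ⟨hy.1, hy.2.2⟩
  obtain ⟨N, U, D, hU, hD, hUD⟩ := hS0.struct
  have hU0 : U = ∅ := by
    by_contra hne
    obtain ⟨a, b, hab, hW, h | h⟩ := one_dim hB hU (nonempty_iff_ne_empty.2 hne)
    all_goals
      obtain ⟨x, hx⟩ := exists_between (show (a : ℝ) < b by exact_mod_cast hab)
      have hxS : x ∈ S0 := by rw [hUD]; exact .inl (hW hx)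
      obtain ⟨⟨y, hy, hyx⟩, z, hz, hzx⟩ := hxS.2 (min (x - a) (b - x)) (lt_min (by linarith [hx.1]) (by linarith [hx.2]))
      rw [lt_min_iff, abs_lt, abs_lt] at hyx hzx
    · exact hz (h ⟨by linarith, by linarith⟩)
    · exact h y ⟨by linarith, by linarith⟩ hy
  have hSN : ∀ x, x ∉ S N := fun x => by
    have := cb (D := D) hD hSm (fun j x hx => ?_) Finset.univ univ isOpen_univ (fun x hx _ => ?_) x trivial
    · simpa using this
    · rw [hSs] at hx
      rw [frequently_nhdsWithin_iff, (Metric.nhds_basis_ball).frequently_iff]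
      intro r hr
      obtain ⟨y, h1, h2, h3⟩ := hx.2 r hr
      exact ⟨y, h3, h1, h2⟩
    · have hx : x ∈ S0 := hx
      rw [hUD, hU0, empty_union] at hx
      simpa using hx
  obtain ⟨j, hj1, hj2⟩ : ∃ j, (∀ ε, 0 < ε → ∃ s ∈ S j, s < ε) ∧ ¬ ∀ ε, 0 < ε → ∃ s ∈ S (j + 1), s < ε := by
    by_contra! hc
    have : ∀ j, ∀ ε, 0 < ε → ∃ s ∈ S j, s < ε := fun j => by
      induction j with
      | zero =>
        intro ε hε
        obtain ⟨x, hx1, hx2⟩ := (h2.and_eventually (Ioo_mem_nhdsGT hε)).exists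
        obtain ⟨y, hy1, hy2⟩ := (h1.and_eventually (Ioo_mem_nhdsGT hε)).exists
        obtain ⟨z, hz, hz2⟩ := isPreconnected_closed_iff.1 (isPreconnected_Ioo (a := 0) (b := ε)) (closure B) (closure Bᶜ) isClosed_closure
          isClosed_closure (fun w _ => (em (w ∈ B)).imp (fun h => subset_closure h) fun h => subset_closure h)
          ⟨x, hx2, subset_closure hx1⟩ ⟨y, hy2, subset_closure hy1⟩
        exact ⟨z, hfr z hz.1 (by rwa [frontier_eq_closure_inter_closure]), hz.2⟩
      | succ j ih => exact hc j ih
    obtain ⟨s, hs, _⟩ := this N 1 one_pos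
    exact hSN s hs
  push Not at hj2
  obtain ⟨ε, hε, hj2⟩ := hj2
  have hpos : ∀ x ∈ S j, 0 < x := fun x hx => by
    cases j with
    | zero => exact hx.1
    | succ j => rw [hSs] at hx; exact hx.1
  have := hSd j
  refine ⟨{x | x ∈ S j ∧ x ≤ ε / 2}, dsolve, fun x hx => hpos x hx.1, fun δ hδ => ?_, fun δ hδ => ?_⟩
  · obtain ⟨s, hs, hs2⟩ := hj1 (min δ (ε / 2)) (lt_min hδ (half_pos hε))
    exact ⟨s, ⟨hs, (hs2.trans_le (min_le_right _ _)).le⟩, hs2.trans_le (min_le_left _ _)⟩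
  · by_contra hinf
    obtain ⟨x, hx, hacc⟩ := Set.Infinite.exists_accPt_of_subset_isCompact hinf (isCompact_Icc (a := δ) (b := ε / 2))
      fun x hx => ⟨hx.2, hx.1.2⟩
    have : x ∈ S (j + 1) := by
      rw [hSs]
      refine ⟨hδ.trans_le hx.1, fun r hr => ?_⟩
      obtain ⟨y, hy, hyx⟩ := accPt_iff_nhds.1 hacc _ (Metric.ball_mem_nhds x hr)
      exact ⟨y, hy.2.1.1, hyx, hy.1⟩
    have := hj2 x this
    linarith [hx.2]

theorem evCp (hE : EvC L) (p : ℕ) {f : ℝ → ℝ} (hf : DM L f) : ∀ᶠ t in 𝓝[>] (0 : ℝ), ContDiffAt ℝ p f t := by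
  have hcoe : ∀ x : Fin 1 → ℝ, ContDiffAt ℝ p (fun x : Fin 1 → ℝ => f (x 0)) x ↔ ContDiffAt ℝ p f (x 0) := fun x => by
    constructor
    · intro h
      have h1 : ContDiffAt ℝ p (fun t : ℝ => (fun _ : Fin 1 => t)) (x 0) :=
        contDiffAt_pi.2 fun _ => contDiffAt_id
      exact ContDiffAt.comp (x 0) (g := fun x : Fin 1 → ℝ => f (x 0)) (f := fun t : ℝ => (fun _ : Fin 1 => t))
        (by convert h using 2; rename_i i; fin_cases i; rfl) h1
    · intro h
      exact ContDiffAt.comp x (g := f) (f := fun x : Fin 1 → ℝ => x 0) h (contDiff_apply ℝ ℝ (0 : Fin 1)).contDiffAt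
  have hd := (gen_cp p (f := fun x : Fin 1 → ℝ => f (x 0)) (L := L) (by fun_prop)).mono interior_subset
  have hD : DS L {t : ℝ | ContDiffAt ℝ p (fun x : Fin 1 → ℝ => f (x 0)) (fun _ => t)} :=
    DS.mem (f := fun t : ℝ => ((0 : ℝ), fun _ : Fin 1 => t)) (DS.contDiffAt (X := ℝ) p (f := fun _ (x : Fin 1 → ℝ) => f (x 0)) (by fun_prop))
      (by fun_prop)
  rcases hE _ hD with h | h
  · exact h.mono fun t ht => (hcoe _).1 ht
  · obtain ⟨ε, hε, hb⟩ := mem_nhdsGT_iff_exists_Ioo_subset.1 h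
    obtain ⟨x, hx1, hx2⟩ := hd.inter_open_nonempty ((fun x : Fin 1 → ℝ => x 0) ⁻¹' Ioo 0 ε) (isOpen_Ioo.preimage (continuous_apply 0))
      ⟨fun _ => ε / 2, ⟨half_pos hε, half_lt_self hε⟩⟩
    exact (hb hx1 ((hcoe _).2 ((hcoe x).1 hx2))).elim

theorem evDiff (hE : EvC L) {f : ℝ → ℝ} (hf : DM L f) : ∀ᶠ t in 𝓝[>] (0 : ℝ), DifferentiableAt ℝ f t :=
  (evCp hE 1 hf).mono fun t h => h.differentiableAt (by simp)

theorem DM.deriv1 {f : ℝ → ℝ} (hf : DM L f) : DM L (_root_.deriv f) :=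
  DM.deriv (f := fun _ => f) (a := fun t => t) (by fun_prop) (by fun_prop)

theorem ev_deriv_aux (hE : EvC L) {u : ℝ → ℝ} (hu : DM L u) (hb : ∀ᶠ t in 𝓝[>] (0 : ℝ), |u t| ≤ 1) :
    ∀ᶠ t in 𝓝[>] (0 : ℝ), deriv u t * t ^ 2 ≤ 1 := by
  have hd := DM.deriv1 hu
  rcases hE {t | deriv u t * t ^ 2 ≤ 1} dsolve with h | h
  · exact h
  · exfalso
    obtain ⟨ε, hε, hc⟩ := mem_nhdsGT_iff_exists_Ioo_subset.1 (h.and (hb.and (evDiff hE hu)))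
    have hε : 0 < ε := hε
    have hmono : StrictMonoOn (fun t => u t + t⁻¹) (Ioo 0 ε) := by
      have hder : ∀ t ∈ Ioo 0 ε, HasDerivAt (fun t => u t + t⁻¹) (deriv u t + -(t ^ 2)⁻¹) t := fun t ht =>
        (hc ht).2.2.hasDerivAt.add (hasDerivAt_inv ht.1.ne')
      refine strictMonoOn_of_deriv_pos (convex_Ioo 0 ε) (fun t ht => (hder t ht).continuousAt.continuousWithinAt) fun t ht => ?_
      rw [interior_Ioo] at ht
      rw [(hder t ht).deriv]
      have h1 := not_le.1 (show ¬ (deriv u t * t ^ 2 ≤ 1) from (hc ht).1)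
      have h2 : 0 < t ^ 2 := pow_pos ht.1 2
      rw [← sub_eq_add_neg, sub_pos, inv_lt_iff_one_lt_mul₀ h2]; linarith
    have he : ε / 2 ∈ Ioo 0 ε := ⟨by linarith, by linarith⟩
    set K := u (ε / 2) + (ε / 2)⁻¹
    have h1 : ∀ t ∈ Ioo 0 (ε / 2), t⁻¹ ≤ K + 1 := fun t ht => by
      have h3 := hmono ⟨ht.1, by linarith [ht.2]⟩ he ht.2
      have h4 := (abs_le.1 (hc (show t ∈ Ioo 0 ε from ⟨ht.1, by linarith [ht.2]⟩)).2.1).1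
      simp only at h3
      linarith
    have h2 : ∀ᶠ t in 𝓝[>] (0 : ℝ), K + 1 < t⁻¹ := tendsto_inv_nhdsGT_zero.eventually_gt_atTop _
    obtain ⟨t, ht1, ht2⟩ := (h2.and (Ioo_mem_nhdsGT (half_pos hε))).exists
    linarith [h1 t ht2]

theorem ev_deriv (hE : EvC L) {u : ℝ → ℝ} (hu : DM L u) (hb : ∀ᶠ t in 𝓝[>] (0 : ℝ), |u t| ≤ 1) :
    ∀ᶠ t in 𝓝[>] (0 : ℝ), |deriv u t| * t ^ 2 ≤ 1 := by
  have h2 := ev_deriv_aux hE (u := fun t => - u t) (by fun_prop) (by simpa using hb)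
  filter_upwards [ev_deriv_aux hE hu hb, h2] with t h1 h2
  rw [deriv.fun_neg, neg_mul] at h2
  rw [← abs_of_nonneg (sq_nonneg t), ← abs_mul, abs_le]
  constructor <;> linarith

variable (L) in
/-- definable and `O(t^{-N})` -/
def PB (N : ℕ) (h : ℝ → ℝ) : Prop := DM L h ∧ ∀ᶠ t in 𝓝[>] (0 : ℝ), |h t| * t ^ N ≤ 1

theorem PB.deriv (hE : EvC L) {N : ℕ} {h : ℝ → ℝ} (hh : PB L N h) : PB L (N + 3) (deriv h) := by
  refine ⟨hh.1.deriv1, ?_⟩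
  have h1 := hh.1
  have h2 := ev_deriv hE (u := fun t => h t * t ^ N) (by fun_prop) (by
    filter_upwards [hh.2, self_mem_nhdsWithin] with t ht h0
    rw [abs_mul, abs_of_nonneg (a := t ^ N) (pow_nonneg (le_of_lt (h0 : (0 : ℝ) < t)) N)]; exact ht)
  filter_upwards [h2, hh.2, self_mem_nhdsWithin, evDiff hE h1, Ioo_mem_nhdsGT (show (0 : ℝ) < 1 / (N + 1) by positivity)]
    with t ht1 ht2 h0 hd hsm
  have h0 : 0 < t := h0
  have hN : t * (N + 1) < 1 := by rw [← lt_div_iff₀ (by positivity)]; exact hsm.2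
  have hder : HasDerivAt (fun t => h t * t ^ N) (_root_.deriv h t * t ^ N + h t * (N * t ^ (N - 1))) t :=
    hd.hasDerivAt.mul (hasDerivAt_pow N t)
  rw [hder.deriv] at ht1
  have e1 : |_root_.deriv h t * t ^ N| ≤ |_root_.deriv h t * t ^ N + h t * (N * t ^ (N - 1))| + |h t * (N * t ^ (N - 1))| := by
    have := abs_sub (_root_.deriv h t * t ^ N + h t * (N * t ^ (N - 1))) (h t * (N * t ^ (N - 1)))
    simpa using this
  have e2 : |h t * (N * t ^ (N - 1))| * t ≤ N := by
    rcases N with _ | N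
    · simp
    · have : |h t * ((N + 1 : ℕ) * t ^ (N + 1 - 1))| * t = (N + 1 : ℕ) * (|h t| * t ^ (N + 1)) := by
        rw [abs_mul, abs_mul, abs_of_nonneg (a := t ^ _) (pow_nonneg h0.le _), Nat.abs_cast, Nat.add_sub_cancel]; ring
      rw [this]
      have := mul_le_mul_of_nonneg_left ht2 (show (0 : ℝ) ≤ (N + 1 : ℕ) by positivity)
      linarith
  rw [abs_mul (_root_.deriv h t), abs_of_nonneg (pow_nonneg h0.le N)] at e1
  calc |_root_.deriv h t| * t ^ (N + 3) = (|_root_.deriv h t| * t ^ N) * t ^ 3 := by ring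
    _ ≤ (|_root_.deriv h t * t ^ N + h t * (N * t ^ (N - 1))| + |h t * (N * t ^ (N - 1))|) * t ^ 3 := by gcongr
    _ = (|_root_.deriv h t * t ^ N + h t * (N * t ^ (N - 1))| * t ^ 2) * t + (|h t * (N * t ^ (N - 1))| * t) * t ^ 2 := by ring
    _ ≤ 1 * t + N * t ^ 2 := by gcongr
    _ ≤ 1 := by
      have ht1 : t ≤ 1 := by nlinarith [Nat.cast_nonneg (α := ℝ) N]
      nlinarith [mul_nonneg (mul_nonneg (Nat.cast_nonneg (α := ℝ) N) h0.le) (sub_nonneg.2 ht1)]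

theorem ev_theta (hE : EvC L) {θ : ℝ → ℝ} (hθ : DM L θ) (h1 : ∀ᶠ t in 𝓝[>] (0 : ℝ), |θ t| ≤ 1) (i : ℕ) :
    ∀ (k N : ℕ) (h : ℝ → ℝ), PB L N h → ∃ g, PB L (N + 5 * i) g ∧
      ∀ᶠ t in 𝓝[>] (0 : ℝ), deriv^[i] (fun t => θ t ^ (k + i) * h t) t = θ t ^ k * g t := by
  induction i with
  | zero => exact fun k N h hh => ⟨h, hh, by simp⟩
  | succ i ih =>
    intro k N h hh
    obtain ⟨g, hg, he⟩ := ih (k + 1) N h hh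
    have hP : PB L 0 θ := ⟨hθ, by simpa using h1⟩
    have hP' := hP.deriv hE
    have hg' := hg.deriv hE
    have a1 := hP'.1
    have a2 := hg'.1
    have a3 := hg.1
    refine ⟨fun t => (k + 1 : ℕ) * deriv θ t * g t + θ t * deriv g t, ⟨by fun_prop, ?_⟩, ?_⟩
    · filter_upwards [h1, hP'.2, hg'.2, hg.2, self_mem_nhdsWithin, Ioo_mem_nhdsGT (show (0 : ℝ) < 1 / (k + 2) by positivity)] with t b1 b2 b3 b4 h0 hsm
      have h0 : 0 < t := h0
      have hN : t * (k + 2) < 1 := by rw [← lt_div_iff₀ (by positivity)]; exact hsm.2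
      have ht1 : t ≤ 1 := by nlinarith [Nat.cast_nonneg (α := ℝ) k]
      rw [zero_add] at b2
      calc |((k + 1 : ℕ) : ℝ) * deriv θ t * g t + θ t * deriv g t| * t ^ (N + 5 * (i + 1))
          ≤ (((k + 1 : ℕ) : ℝ) * |deriv θ t| * |g t| + |θ t| * |deriv g t|) * t ^ (N + 5 * (i + 1)) := by
            gcongr; refine (abs_add_le _ _).trans ?_; rw [abs_mul, abs_mul, abs_mul, Nat.abs_cast]
        _ = ((k + 1 : ℕ) * ((|deriv θ t| * t ^ 3) * (|g t| * t ^ (N + 5 * i))) * t + (|θ t| * (|deriv g t| * t ^ (N + 5 * i + 3))) * t) * t := by ring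
        _ ≤ ((k + 1 : ℕ) * (1 * 1) * t + (1 * 1) * t) * t := by gcongr
        _ = (t * (k + 2)) * t := by push_cast; ring
        _ ≤ 1 := by nlinarith
    · have he2 : ∀ᶠ t in 𝓝[>] (0 : ℝ), (deriv^[i] fun t => θ t ^ (k + 1 + i) * h t) =ᶠ[𝓝 t] fun t => θ t ^ (k + 1) * g t := by
        obtain ⟨ε, hε, hc⟩ := mem_nhdsGT_iff_exists_Ioo_subset.1 he
        filter_upwards [Ioo_mem_nhdsGT hε] with t ht
        filter_upwards [isOpen_Ioo.mem_nhds ht] with s hs using hc hs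
      filter_upwards [he2, evDiff hE hθ, evDiff hE hg.1] with t c1 c2 c3
      rw [show k + (i + 1) = k + 1 + i by ring, Function.iterate_succ_apply', c1.deriv_eq]
      have := (c2.hasDerivAt.fun_pow (k + 1)).mul c3.hasDerivAt
      rw [show deriv (fun t => θ t ^ (k + 1) * g t) t = _ from this.deriv, Nat.add_sub_cancel]
      ring

theorem flatB (hE : EvC L) (p : ℕ) {θ : ℝ → ℝ} (hθ : DM L θ) (hpos : ∀ t, 0 < t → 0 < θ t) : ∃ φ : ℝ → ℝ, DM L φ ∧
    ∀ᶠ t in 𝓝[>] (0 : ℝ), ContDiffAt ℝ p φ t ∧ 0 < φ t ∧ ∀ i ≤ p, |iteratedDeriv i φ t| ≤ θ t := by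
  have hT : DM L fun t => min (θ t) t := by fun_prop
  have h1 : ∀ᶠ t in 𝓝[>] (0 : ℝ), |min (θ t) t| ≤ 1 := by
    filter_upwards [Ioo_mem_nhdsGT (one_pos (α := ℝ))] with t ht
    rw [abs_of_pos (lt_min (hpos t ht.1) ht.1)]; exact (min_le_right _ _).trans ht.2.le
  refine ⟨fun t => min (θ t) t ^ (6 * p + 1), by fun_prop, ?_⟩
  have h2 : ∀ i ≤ p, ∀ᶠ t in 𝓝[>] (0 : ℝ), |iteratedDeriv i (fun t => min (θ t) t ^ (6 * p + 1)) t| ≤ θ t := by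
    intro i hi
    obtain ⟨g, hg, he⟩ := ev_theta hE hT h1 i (6 * p + 1 - i) 0 (fun _ => 1) ⟨by fun_prop, by simp⟩
    rw [show 6 * p + 1 - i + i = 6 * p + 1 by omega] at he
    simp only [mul_one] at he
    filter_upwards [he, hg.2, Ioo_mem_nhdsGT (one_pos (α := ℝ))] with t h3 h4 ht
    have hp := lt_min (hpos t ht.1) ht.1
    rw [iteratedDeriv_eq_iterate, h3, show 6 * p + 1 - i = 1 + (0 + 5 * i) + (6 * p - 6 * i) by omega, pow_add, pow_add, pow_one,
      abs_mul, abs_mul, abs_mul, abs_of_pos hp, abs_of_pos (pow_pos hp _), abs_of_pos (pow_pos hp _)]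
    have e1 : min (θ t) t ^ (6 * p - 6 * i) ≤ 1 := pow_le_one₀ hp.le ((min_le_right _ _).trans ht.2.le)
    have e2 : min (θ t) t ^ (0 + 5 * i) * |g t| ≤ 1 := by
      refine le_trans ?_ h4
      rw [mul_comm]; gcongr; exact min_le_right _ _
    calc _ = min (θ t) t * (min (θ t) t ^ (0 + 5 * i) * |g t|) * min (θ t) t ^ (6 * p - 6 * i) := by ring
      _ ≤ min (θ t) t * 1 * 1 := by gcongr
      _ ≤ θ t := by rw [mul_one, mul_one]; exact min_le_left _ _
  have h3 : ∀ᶠ t in 𝓝[>] (0 : ℝ), ∀ i : Fin (p + 1), |iteratedDeriv i (fun t => min (θ t) t ^ (6 * p + 1)) t| ≤ θ t :=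
    eventually_all.2 fun i => h2 i (by omega)
  filter_upwards [h3, evCp hE p (f := fun t => min (θ t) t ^ (6 * p + 1)) (by fun_prop), self_mem_nhdsWithin] with t a1 a2 a3
  exact ⟨a2, pow_pos (lt_min (hpos t a3) a3) _, fun i hi => a1 ⟨i, by omega⟩⟩
end Flat

section FlatA
variable {L : FirstOrder.Language} [L.Structure ℝ] [hL : Fact (DMinimal L)]

theorem hasDerivAt_maxpow (p : ℕ) (x : ℝ) : HasDerivAt (fun x : ℝ => max 0 x ^ (p + 2)) ((p + 2 : ℕ) * max 0 x ^ (p + 1)) x := by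
  rcases lt_trichotomy x 0 with h | h | h
  · rw [max_eq_left h.le]
    refine ((hasDerivAt_const x (0 : ℝ)).congr_of_eventuallyEq ?_).congr_deriv (by simp)
    filter_upwards [Iio_mem_nhds h] with y hy
    rw [max_eq_left (le_of_lt hy)]; simp
  · subst h
    have : HasFDerivAt (fun x : ℝ => max 0 x ^ (p + 2)) (0 : ℝ →L[ℝ] ℝ) 0 := by
      refine Asymptotics.IsBigO.hasFDerivAt (n := p + 2) (Asymptotics.IsBigO.of_bound 1 (Eventually.of_forall fun y => ?_)) (by omega)
      rw [one_mul, sub_zero, norm_pow, norm_pow, norm_norm]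
      gcongr
      rw [Real.norm_eq_abs, Real.norm_eq_abs, abs_of_nonneg (le_max_left _ _)]
      exact max_le (abs_nonneg _) (le_abs_self _)
    simpa using this.hasDerivAt
  · rw [max_eq_right h.le]
    refine ((hasDerivAt_pow (p + 2) x).congr_of_eventuallyEq ?_)
    filter_upwards [Ioi_mem_nhds h] with y hy
    rw [max_eq_right (le_of_lt hy)]

theorem contDiff_maxpow (p : ℕ) : ContDiff ℝ p (fun x : ℝ => max 0 x ^ (p + 1)) := by
  induction p with
  | zero => exact contDiff_zero.2 (by fun_prop)
  | succ p ih =>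
    refine contDiff_succ_iff_deriv.2 ⟨fun x => (hasDerivAt_maxpow p x).differentiableAt, fun h => (WithTop.natCast_ne_top _ h).elim, ?_⟩
    rw [show deriv (fun x : ℝ => max 0 x ^ (p + 1 + 1)) = fun x => ((p + 2 : ℕ) : ℝ) * max 0 x ^ (p + 1) from
      funext fun x => (hasDerivAt_maxpow p x).deriv]
    exact contDiff_const.mul ih

/-- smooth step -/
def om (p : ℕ) (x : ℝ) : ℝ := max 0 x ^ (p + 1) / (max 0 x ^ (p + 1) + max 0 (1 - x) ^ (p + 1))

theorem om_den (p : ℕ) (x : ℝ) : 0 < max 0 x ^ (p + 1) + max 0 (1 - x) ^ (p + 1) := by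
  rcases lt_or_ge 0 x with h | h
  · exact add_pos_of_pos_of_nonneg (pow_pos (lt_max_of_lt_right h) _) (pow_nonneg (le_max_left _ _) _)
  · exact add_pos_of_nonneg_of_pos (pow_nonneg (le_max_left _ _) _) (pow_pos (lt_max_of_lt_right (by linarith)) _)

theorem om_cd (p : ℕ) : ContDiff ℝ p (om p) :=
  (contDiff_maxpow p).div ((contDiff_maxpow p).add ((contDiff_maxpow p).comp (contDiff_const.sub contDiff_id)))
    fun x => (om_den p x).ne'

theorem om_zero {p : ℕ} {x : ℝ} (h : x ≤ 0) : om p x = 0 := by simp [om, max_eq_left h]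
theorem om_one {p : ℕ} {x : ℝ} (h : 1 ≤ x) : om p x = 1 := by
  unfold om
  rw [max_eq_left (a := (0 : ℝ)) (b := 1 - x) (by linarith), max_eq_right (by linarith : (0 : ℝ) ≤ x)]
  have : x ^ (p + 1) ≠ 0 := pow_ne_zero _ (by linarith)
  simp [this]
theorem om_nonneg (p : ℕ) (x : ℝ) : 0 ≤ om p x := div_nonneg (pow_nonneg (le_max_left _ _) _) (om_den p x).le
theorem om_lt {p : ℕ} {x : ℝ} (h : x < 1) : om p x < 1 := by
  rw [om, div_lt_one (om_den p x)]
  have : 0 < max 0 (1 - x) ^ (p + 1) := pow_pos (lt_max_of_lt_right (by linarith)) _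
  linarith

theorem om_bd (p : ℕ) : ∃ C : ℝ, 0 ≤ C ∧ ∀ i ≤ p, ∀ x, |iteratedDeriv i (om p) x| ≤ C := by
  have h1 : ∀ i : ℕ, i ≤ p → ∃ C : ℝ, ∀ x, |iteratedDeriv i (om p) x| ≤ C := fun i hi => by
    obtain ⟨C, hC⟩ := isCompact_Icc.exists_bound_of_continuousOn (s := Icc (0 : ℝ) 1)
      ((om_cd p).continuous_iteratedDeriv i (by exact_mod_cast hi)).continuousOn
    refine ⟨max 1 C, fun x => ?_⟩
    by_cases hx : x ∈ Icc (0 : ℝ) 1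
    · exact (hC x hx).trans (le_max_right _ _)
    · refine le_max_of_le_left ?_
      have : ∃ c : ℝ, |c| ≤ 1 ∧ om p =ᶠ[𝓝 x] fun _ => c := by
        rcases not_and_or.1 hx with h | h
        · exact ⟨0, by simp, by filter_upwards [Iio_mem_nhds (not_le.1 h)] with y hy using om_zero (le_of_lt hy)⟩
        · exact ⟨1, by simp, by filter_upwards [Ioi_mem_nhds (not_le.1 h)] with y hy using om_one (le_of_lt hy)⟩
      obtain ⟨c, hc, he⟩ := this
      rw [he.iteratedDeriv_eq, iteratedDeriv_const]
      split_ifs <;> simp [hc]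
  choose! C hC using h1
  refine ⟨∑ i ∈ Finset.range (p + 1), |C i|, Finset.sum_nonneg fun _ _ => abs_nonneg _, fun i hi x => ?_⟩
  exact (hC i hi x).trans ((le_abs_self _).trans (Finset.single_le_sum (f := fun i => |C i|) (fun _ _ => abs_nonneg _)
    (Finset.mem_range.2 (by omega))))

theorem om_scale {p i : ℕ} (hi : i ≤ p) {C : ℝ} (hC : ∀ i ≤ p, ∀ x, |iteratedDeriv i (om p) x| ≤ C) {A B a l : ℝ} (hl : 0 < l)
    (hl1 : l ≤ 1) (hA : |A| ≤ B * l ^ p) (hB : 0 ≤ B) (t : ℝ) :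
    |iteratedDeriv i (fun t => A * om p ((t - a) / l)) t| ≤ B * C := by
  have e : (fun t => om p ((t - a) / l)) = fun t => (fun z => om p (l⁻¹ * z)) (t - a) := by
    ext t; simp only; rw [div_eq_inv_mul]
  rw [iteratedDeriv_const_mul_field, e, iteratedDeriv_comp_sub_const i (fun z => om p (l⁻¹ * z)) a, iteratedDeriv_comp_const_mul
    ((om_cd p).of_le (by exact_mod_cast hi))]
  simp only
  rw [abs_mul, abs_mul, abs_of_pos (pow_pos (inv_pos.2 hl) i)]
  have h1 := hC i hi (l⁻¹ * (t - a))
  have h2 : l ^ p * (l⁻¹) ^ i ≤ 1 := by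
    rw [inv_pow, ← div_eq_mul_inv, div_le_one (by positivity)]
    exact pow_le_pow_of_le_one hl.le hl1 hi
  calc |A| * (l⁻¹ ^ i * |iteratedDeriv i (om p) (l⁻¹ * (t - a))|) ≤ (B * l ^ p) * (l⁻¹ ^ i * C) := by gcongr
    _ = B * (l ^ p * l⁻¹ ^ i) * C := by ring
    _ ≤ B * 1 * C := by
      have : 0 ≤ C := (abs_nonneg _).trans h1
      gcongr
    _ = _ := by ring

theorem flatA {S : Set ℝ} (hS : SeqS L S) (p : ℕ) {θ : ℝ → ℝ} (hθ : DM L θ) (hpos : ∀ t, 0 < t → 0 < θ t)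
    (hmono : ∀ s t, 0 < s → s ≤ t → θ s ≤ θ t) : ∃ φ : ℝ → ℝ, DM L φ ∧
    ∀ᶠ t in 𝓝[>] (0 : ℝ), ContDiffAt ℝ p φ t ∧ 0 < φ t ∧ ∀ i ≤ p, |iteratedDeriv i φ t| ≤ θ t := by
  obtain ⟨C, hC0, hC⟩ := om_bd p
  set κ : ℝ := 1 / (1 + 2 * C) with hκ
  have hκ0 : 0 < κ := by positivity
  set fl : ℝ → ℝ := fun t => uch fun c => c ∈ S ∧ c ≤ t ∧ ∀ s, s ∈ S → s ≤ t → s ≤ c with hfl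
  set pr : ℝ → ℝ := fun t => uch fun c => c ∈ S ∧ c < t ∧ ∀ s, s ∈ S → s < t → s ≤ c with hpr
  set sc : ℝ → ℝ := fun t => uch fun c => c ∈ S ∧ t < c ∧ ∀ s, s ∈ S → t < s → c ≤ s with hsc
  have hSd := hS.1
  have dS1 : DS L {q : (ℝ × ℝ) × ℝ | q.2 ∈ S} := DS.mem (f := fun q : (ℝ × ℝ) × ℝ => q.2) hSd (by fun_prop)
  have dS2 : DS L {q : ℝ × ℝ | q.2 ∈ S} := DS.mem (f := fun q : ℝ × ℝ => q.2) hSd (by fun_prop)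
  have dfl : DM L fl := DM.uch (P := fun t c => c ∈ S ∧ c ≤ t ∧ ∀ s, s ∈ S → s ≤ t → s ≤ c) dsolve
  have dpr : DM L pr := DM.uch (P := fun t c => c ∈ S ∧ c < t ∧ ∀ s, s ∈ S → s < t → s ≤ c) dsolve
  have dsc : DM L sc := DM.uch (P := fun t c => c ∈ S ∧ t < c ∧ ∀ s, s ∈ S → t < s → c ≤ s) dsolve
  have ufl : ∀ t c, (c ∈ S ∧ c ≤ t ∧ ∀ s, s ∈ S → s ≤ t → s ≤ c) → fl t = c := fun t c h =>
    (uch_eq ⟨c, h, fun d hd => le_antisymm (h.2.2 d hd.1 hd.2.1) (hd.2.2 c h.1 h.2.1)⟩ h).symm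
  have upr : ∀ t c, (c ∈ S ∧ c < t ∧ ∀ s, s ∈ S → s < t → s ≤ c) → pr t = c := fun t c h =>
    (uch_eq ⟨c, h, fun d hd => le_antisymm (h.2.2 d hd.1 hd.2.1) (hd.2.2 c h.1 h.2.1)⟩ h).symm
  have usc : ∀ t c, (c ∈ S ∧ t < c ∧ ∀ s, s ∈ S → t < s → c ≤ s) → sc t = c := fun t c h =>
    (uch_eq ⟨c, h, fun d hd => le_antisymm (hd.2.2 c h.1 h.2.1) (h.2.2 d hd.1 hd.2.1)⟩ h).symm
  have great : ∀ T ⊆ S, T.Nonempty → ∃ c ∈ T, ∀ s ∈ T, s ≤ c := fun T hT ⟨s, hs⟩ => by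
    obtain ⟨c, hc, hm⟩ := Set.exists_max_image (T ∩ Ici s) id
      ((hS.2.2.2 s (hS.2.1 (hT hs))).subset (inter_subset_inter_left _ hT)) ⟨s, hs, self_mem_Ici⟩
    exact ⟨c, hc.1, fun r hr => (le_total s r).elim (fun h => hm r ⟨hr, h⟩) fun h => h.trans hc.2⟩
  set v : ℝ → ℝ := fun c => κ * min (θ (pr c) * |c - pr c| ^ p) (θ c * |sc c - c| ^ p) with hv
  have dθ1 : DM L fun c => θ (pr c) := DM.comp hθ dpr
  have dv : DM L v := by fun_prop
  have dv1 : DM L fun t => v (fl t) := DM.comp dv dfl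
  have dv2 : DM L fun t => v (sc t) := DM.comp dv dsc
  have dom : DM L (om p) := by unfold om; fun_prop
  have dom' : DM L fun t => om p ((t - fl t) / (sc t - fl t)) := DM.comp (f := om p) (g := fun t => (t - fl t) / (sc t - fl t)) dom (by fun_prop)
  refine ⟨fun t => v (fl t) + (v (sc t) - v (fl t)) * om p ((t - fl t) / (sc t - fl t)), by fun_prop, ?_⟩
  obtain ⟨s1, hs1, hs11⟩ := hS.2.2.1 1 one_pos
  filter_upwards [Ioo_mem_nhdsGT (show (0 : ℝ) < s1 from hS.2.1 hs1)] with t0 ht0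
  obtain ⟨c, hc, hcm⟩ := great (S ∩ Iic t0) inter_subset_left (by
    obtain ⟨s, hs, h⟩ := hS.2.2.1 t0 ht0.1; exact ⟨s, hs, h.le⟩)
  have hc0 : 0 < c := hS.2.1 hc.1
  obtain ⟨a, ha, ham⟩ := great (S ∩ Iio c) inter_subset_left (by
    obtain ⟨s, hs, h⟩ := hS.2.2.1 c hc0; exact ⟨s, hs, h⟩)
  have ha0 : 0 < a := hS.2.1 ha.1
  obtain ⟨b, hb, hbm⟩ := Set.exists_min_image (S ∩ Ioi t0) id
    ((hS.2.2.2 t0 ht0.1).subset (inter_subset_inter_right _ Ioi_subset_Ici_self)) ⟨s1, hs1, ht0.2⟩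
  have hac : a < c := ha.2
  have hct : c ≤ t0 := hc.2
  have htb : t0 < b := hb.2
  have hb1 : b ≤ s1 := hbm s1 ⟨hs1, ht0.2⟩
  have hcm : ∀ s ∈ S, s ≤ t0 → s ≤ c := fun s h1 h2 => hcm s ⟨h1, h2⟩
  have ham : ∀ s ∈ S, s < c → s ≤ a := fun s h1 h2 => ham s ⟨h1, h2⟩
  have hbm : ∀ s ∈ S, t0 < s → b ≤ s := fun s h1 h2 => hbm s ⟨h1, h2⟩
  have gapl : ∀ s ∈ S, s < b → s ≤ c := fun s h1 h2 => hcm s h1 (not_lt.1 fun h => (hbm s h1 h).not_gt h2)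
  have gapr : ∀ s ∈ S, c < s → b ≤ s := fun s h1 h2 => not_lt.1 fun h => (gapl s h1 h).not_gt h2
  have gapr' : ∀ s ∈ S, a < s → c ≤ s := fun s h1 h2 => not_lt.1 fun h => (ham s h1 h).not_gt h2
  have e1 : pr c = a := upr c a ⟨ha.1, hac, fun s h1 h2 => ham s h1 h2⟩
  have e2 : sc c = b := usc c b ⟨hb.1, by linarith, fun s h1 h2 => gapr s h1 h2⟩
  have e3 : sc a = c := usc a c ⟨hc.1, hac, fun s h1 h2 => gapr' s h1 h2⟩
  have e4 : pr b = c := upr b c ⟨hc.1, by linarith, fun s h1 h2 => gapl s h1 h2⟩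
  have hca : 0 < c - a := by linarith
  have hbc : 0 < b - c := by linarith
  have hθa := hpos a ha0
  have hθc := hpos c hc0
  have vc1 : v c ≤ κ * θ a * (c - a) ^ p := by
    simp only [hv, e1, abs_of_pos hca]; rw [mul_assoc]; gcongr; exact min_le_left _ _
  have vc2 : v c ≤ κ * θ c * (b - c) ^ p := by
    simp only [hv, e2, abs_of_pos hbc]; rw [mul_assoc]; gcongr; exact min_le_right _ _
  have va : v a ≤ κ * θ a * (c - a) ^ p := by
    simp only [hv, e3, abs_of_pos hca]; rw [mul_assoc]; gcongr; exact min_le_right _ _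
  have vb : v b ≤ κ * θ c * (b - c) ^ p := by
    simp only [hv, e4, abs_of_pos hbc]; rw [mul_assoc]; gcongr; exact min_le_left _ _
  have vcp : 0 < v c := by
    simp only [hv, e1, e2, abs_of_pos hca, abs_of_pos hbc]; positivity
  have vap : 0 ≤ v a := by
    obtain ⟨s, hs, hsm⟩ := great (S ∩ Iio a) inter_subset_left (by
      obtain ⟨s, hs, h⟩ := hS.2.2.1 a ha0; exact ⟨s, hs, h⟩)
    have := hpos s (hS.2.1 hs.1)
    simp only [hv, upr a s ⟨hs.1, hs.2, fun r h1 h2 => hsm r ⟨h1, h2⟩⟩]; positivity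
  have vbp : 0 ≤ v b := by
    have := hpos b (hS.2.1 hb.1)
    simp only [hv, e4]; positivity
  have heq : (fun t => v (fl t) + (v (sc t) - v (fl t)) * om p ((t - fl t) / (sc t - fl t))) =ᶠ[𝓝 t0]
      fun t => v a + ((v c - v a) * om p ((t - a) / (c - a)) + (v b - v c) * om p ((t - c) / (b - c))) := by
    filter_upwards [Ioo_mem_nhds (show a < t0 by linarith) htb] with t ht
    rcases lt_or_ge t c with h | h
    · rw [ufl t a ⟨ha.1, ht.1.le, fun s h1 h2 => ham s h1 (by linarith)⟩, usc t c ⟨hc.1, h, fun s h1 h2 => gapr' s h1 (by linarith [ht.1])⟩,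
        om_zero (x := (t - c) / (b - c)) (div_nonpos_of_nonpos_of_nonneg (by linarith) hbc.le)]
      ring
    · rw [ufl t c ⟨hc.1, h, fun s h1 h2 => gapl s h1 (by linarith [ht.2])⟩, usc t b ⟨hb.1, ht.2, fun s h1 h2 => gapr s h1 (by linarith)⟩,
        om_one (x := (t - a) / (c - a)) (by rw [le_div_iff₀ hca]; linarith)]
      ring
  have cd : ∀ (A l r : ℝ), ContDiff ℝ p fun t => A * om p ((t - r) / l) := fun A l r =>
    contDiff_const.mul ((om_cd p).comp ((contDiff_id.sub contDiff_const).div_const _))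
  refine ⟨(contDiff_const.add ((cd _ _ _).add (cd _ _ _))).contDiffAt.congr_of_eventuallyEq heq, ?_, fun i hi => ?_⟩
  · refine lt_of_lt_of_eq ?_ heq.eq_of_nhds.symm
    rw [om_one (x := (t0 - a) / (c - a)) (by rw [le_div_iff₀ hca]; linarith)]
    have h1 := om_nonneg p ((t0 - c) / (b - c))
    have h2 : om p ((t0 - c) / (b - c)) < 1 := om_lt (by rw [div_lt_one hbc]; linarith)
    nlinarith
  · rw [heq.iteratedDeriv_eq, iteratedDeriv_fun_add contDiffAt_const
      (((cd _ _ _).add (cd _ _ _)).contDiffAt.of_le (by exact_mod_cast hi)), iteratedDeriv_fun_add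
      ((cd _ _ _).contDiffAt.of_le (by exact_mod_cast hi)) ((cd _ _ _).contDiffAt.of_le (by exact_mod_cast hi))]
    have t1 : |iteratedDeriv i (fun t => (v c - v a) * om p ((t - a) / (c - a))) t0| ≤ κ * θ a * C :=
      om_scale hi hC hca (by linarith) (abs_le.2 ⟨by linarith, by linarith⟩) (by positivity) t0
    have t2 : |iteratedDeriv i (fun t => (v b - v c) * om p ((t - c) / (b - c))) t0| ≤ κ * θ c * C :=
      om_scale hi hC hbc (by linarith) (abs_le.2 ⟨by linarith, by linarith⟩) (by positivity) t0
    have t3 : |iteratedDeriv i (fun _ : ℝ => v a) t0| ≤ κ * θ a := by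
      have : v a ≤ κ * θ a := va.trans (mul_le_of_le_one_right (by positivity) (pow_le_one₀ hca.le (by linarith)))
      rw [iteratedDeriv_const]; split_ifs
      · rw [abs_of_nonneg vap]; exact this
      · rw [abs_zero]; positivity
    have h1 := hmono a t0 ha0 (by linarith)
    have h2 := hmono c t0 hc0 (by linarith)
    calc _ ≤ κ * θ a + (κ * θ a * C + κ * θ c * C) :=
          (abs_add_le _ _).trans (add_le_add t3 ((abs_add_le _ _).trans (add_le_add t1 t2)))
      _ ≤ κ * θ t0 + (κ * θ t0 * C + κ * θ t0 * C) := by gcongr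
      _ = θ t0 := by rw [hκ]; field_simp; ring
end FlatA

section FL
variable {L : FirstOrder.Language} [L.Structure ℝ] [hL : Fact (DMinimal L)]

theorem iteratedDeriv_scale (f : ℝ → ℝ) (c : ℝ) (i : ℕ) : iteratedDeriv i (fun x => f (c * x)) = fun x => c ^ i * iteratedDeriv i f (c * x) := by
  induction i with
  | zero => simp
  | succ i ih =>
    ext x
    rw [iteratedDeriv_succ, ih, deriv_const_mul_field, deriv_comp_mul_left c (iteratedDeriv i f) x, iteratedDeriv_succ, smul_eq_mul]; ring

theorem FL (p : ℕ) {θ : ℝ → ℝ} (hθ : DM L θ) (hpos : ∀ t, 0 < t → 0 < θ t)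
    (hmono : ∀ s t, 0 < s → s ≤ t → θ s ≤ θ t) : ∃ φ : ℝ → ℝ, DM L φ ∧
    ∀ t ∈ Ioo (0 : ℝ) 2, ContDiffAt ℝ p φ t ∧ 0 < φ t ∧ ∀ i ≤ p, |iteratedDeriv i φ t| ≤ θ t := by
  obtain ⟨φ, hφ, hev⟩ : ∃ φ : ℝ → ℝ, DM L φ ∧
      ∀ᶠ t in 𝓝[>] (0 : ℝ), ContDiffAt ℝ p φ t ∧ 0 < φ t ∧ ∀ i ≤ p, |iteratedDeriv i φ t| ≤ θ t := by
    rcases dich L with ⟨S, hS⟩ | h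
    · exact flatA hS p hθ hpos hmono
    · exact flatB h p hθ hpos
  obtain ⟨δ, hδ, hc⟩ := mem_nhdsGT_iff_exists_Ioo_subset.1 hev
  have hδ : 0 < δ := hδ
  set c : ℝ := min 1 (δ / 2)
  have hc0 : 0 < c := lt_min one_pos (half_pos hδ)
  have hc1 : c ≤ 1 := min_le_left _ _
  have hc2 : c ≤ δ / 2 := min_le_right _ _
  refine ⟨fun t => φ (c * t), by fun_prop, fun t ht => ?_⟩
  have hct : c * t ∈ Ioo 0 δ := ⟨mul_pos hc0 ht.1, by nlinarith [ht.1, ht.2]⟩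
  obtain ⟨h1, h2, h3⟩ := hc hct
  refine ⟨ContDiffAt.comp t (g := φ) (f := fun t => c * t) h1 (by fun_prop), h2, fun i hi => ?_⟩
  rw [iteratedDeriv_scale]
  simp only
  rw [abs_mul, abs_of_pos (pow_pos hc0 i)]
  calc c ^ i * |iteratedDeriv i φ (c * t)| ≤ 1 * θ (c * t) := by
        gcongr
        · exact pow_le_one₀ hc0.le hc1
        · exact h3 i hi
    _ ≤ θ t := by rw [one_mul]; exact hmono _ _ hct.1 (by nlinarith [ht.1])

theorem FL' (p : ℕ) {X : Type} [Enc X] {M : Set X} {F v : X → ℝ} (hM : DS L M) (hF : DM L F) (hv : DM L v)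
    (hF1 : ∀ z ∈ M, 0 < F z ∧ F z ≤ 1) (hc : ∀ t, 0 < t → ∃ r, 0 < r ∧ ∀ z ∈ M, t ≤ F z → r ≤ v z) :
    ∃ φ : ℝ → ℝ, DM L φ ∧ (∀ t ∈ Ioo (0 : ℝ) 2, ContDiffAt ℝ p φ t ∧ 0 < φ t) ∧
      ∀ z ∈ M, ∀ i ≤ p, |iteratedDeriv i φ (F z)| ≤ v z := by
  set R : ℝ → ℝ → Prop := fun t r => r ≤ 1 ∧ ∀ z, z ∈ M → t ≤ F z → r ≤ v z with hR
  have d1 : DS L {q : (ℝ × ℝ) × X | q.2 ∈ M} := DS.mem (f := fun q : (ℝ × ℝ) × X => q.2) hM (by fun_prop)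
  have dR : DS L {q : ℝ × ℝ | R q.1 q.2} := dsolve
  have dR' : DS L {q : (ℝ × ℝ) × ℝ | R q.1.1 q.2} := DS.mem (f := fun q : (ℝ × ℝ) × ℝ => (q.1.1, q.2)) dR (by fun_prop)
  set P : ℝ → ℝ → Prop := fun t y => R t y ∧ ∀ r, R t r → r ≤ y with hP
  have dP : DS L {q : ℝ × ℝ | P q.1 q.2} := dsolve
  have hex : ∀ t, 0 < t → ∃ y, 0 < y ∧ P t y := fun t ht => by
    obtain ⟨r, hr, h⟩ := hc t ht
    have hlub := isLUB_csSup (s := {r | R t r}) ⟨min r 1, min_le_right _ _, fun z hz h1 => (min_le_left _ _).trans (h z hz h1)⟩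
      ⟨1, fun r hr => hr.1⟩
    refine ⟨_, lt_of_lt_of_le (lt_min hr one_pos) (hlub.1 (show R t (min r 1) from ⟨min_le_right _ _, fun z hz h1 => (min_le_left _ _).trans (h z hz h1)⟩)),
      ⟨hlub.2 fun r hr => hr.1, fun z hz h1 => hlub.2 fun r hr => hr.2 z hz h1⟩, fun r hr => hlub.1 hr⟩
  have hθ : ∀ t, 0 < t → 0 < uch (P t) ∧ P t (uch (P t)) := fun t ht => by
    obtain ⟨y, hy, h⟩ := hex t ht
    have := uch_eq (P := P t) ⟨y, h, fun z hz => le_antisymm (h.2 z hz.1) (hz.2 y h.1)⟩ h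
    rw [← this]; exact ⟨hy, h⟩
  obtain ⟨φ, h1, h2⟩ := FL p (θ := fun t => uch (P t)) (L := L) (DM.uch dP) (fun t ht => (hθ t ht).1) fun s t hs hst =>
    (hθ t (hs.trans_le hst)).2.2 _ ⟨(hθ s hs).2.1.1, fun z hz h => (hθ s hs).2.1.2 z hz (hst.trans h)⟩
  refine ⟨φ, h1, fun t ht => ⟨(h2 t ht).1, (h2 t ht).2.1⟩, fun z hz i hi => ?_⟩
  have := hF1 z hz
  exact ((h2 (F z) ⟨this.1, by linarith⟩).2.2 i hi).trans ((hθ _ this.1).2.1.2 z hz le_rfl)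
end FL

section Tube
variable {L : FirstOrder.Language} [L.Structure ℝ] [hL : Fact (DMinimal L)] {n : ℕ}

variable (L) in
/-- `W` carries a definable `C^p` function proper to `(0,1]`. -/
def Nice (p : ℕ) (W : Set (Fin n → ℝ)) : Prop := ∃ F : (Fin n → ℝ) → ℝ, DM L F ∧ ContDiffOn ℝ p F W ∧
  (∀ x ∈ W, 0 < F x ∧ F x ≤ 1) ∧ ∀ t, 0 < t → IsCompact {x | x ∈ W ∧ t ≤ F x}

/-- squared euclidean distance -/
def qd (z w : Fin n → ℝ) : ℝ := ∑ i, (w i - z i) ^ 2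

theorem dist_lt_of_qd {z w : Fin n → ℝ} {r : ℝ} (hr : 0 < r) (h : qd z w < r ^ 2) : dist z w < r := by
  rw [dist_pi_lt_iff hr]
  intro i
  have h1 : (w i - z i) ^ 2 ≤ qd z w := Finset.single_le_sum (f := fun i => (w i - z i) ^ 2) (fun _ _ => sq_nonneg _) (Finset.mem_univ i)
  rw [Real.dist_eq, abs_sub_comm]
  exact abs_lt_of_sq_lt_sq (by linarith) hr.le

theorem qd_nonneg (z w : Fin n → ℝ) : 0 ≤ qd z w := Finset.sum_nonneg fun _ _ => sq_nonneg _

theorem qd_eq {z w : Fin n → ℝ} (h : qd z w ≤ 0) : w = z := by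
  ext i
  have h1 : (w i - z i) ^ 2 ≤ qd z w := Finset.single_le_sum (f := fun i => (w i - z i) ^ 2) (fun _ _ => sq_nonneg _) (Finset.mem_univ i)
  nlinarith

@[fun_prop] theorem DM.qd {X : Type} [Enc X] {f g : X → Fin n → ℝ} (hf : DM L f) (hg : DM L g) : DM L fun x => qd (f x) (g x) := by
  unfold DMinPaper.qd; fun_prop

theorem contDiff_qd (p : ℕ) : ContDiff ℝ p fun q : (Fin n → ℝ) × (Fin n → ℝ) => qd q.1 q.2 := by
  unfold qd; fun_prop

theorem nice_univ (p : ℕ) : Nice L p (univ : Set (Fin n → ℝ)) := by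
  have hp : ∀ x : Fin n → ℝ, 0 < 1 + qd 0 x := fun x => by linarith [qd_nonneg 0 x]
  have hc : ContDiff ℝ p fun x : Fin n → ℝ => 1 / (1 + qd 0 x) :=
    contDiff_const.div (contDiff_const.add ((contDiff_qd p).comp (contDiff_const.prodMk contDiff_id))) fun x => (hp x).ne'
  refine ⟨fun x => 1 / (1 + qd 0 x), by fun_prop, hc.contDiffOn, fun x _ => ⟨by have := hp x; positivity, ?_⟩, fun t ht => ?_⟩
  · rw [div_le_one (hp x)]; linarith [qd_nonneg 0 x]
  · refine (isCompact_closedBall (0 : Fin n → ℝ) (1 / t + 1)).of_isClosed_subset ?_ ?_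
    · simp only [mem_univ, true_and]
      exact isClosed_le continuous_const hc.continuous
    · intro x hx
      rw [Metric.mem_closedBall, dist_comm]
      refine (dist_lt_of_qd (by positivity) ?_).le
      have h1 : t ≤ 1 / (1 + qd 0 x) := hx.2
      rw [le_div_iff₀ (hp x), mul_comm, ← le_div_iff₀ ht] at h1
      have : 0 < 1 / t := by positivity
      nlinarith

theorem sep {m p : ℕ} {ι : Fin m → Fin n} {A K : Set (Fin n → ℝ)} (hK : IsCompact K) (hKR : K ⊆ RR p ι A) (hKA : K ⊆ A) :
    ∃ r, 0 < r ∧ ∀ z ∈ K, ∀ z' ∈ A, z ≠ z' → projc ι z' = projc ι z → r ≤ dist z z' := by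
  refine hK.induction_on (p := fun K => ∃ r, 0 < r ∧ ∀ z ∈ K, ∀ z' ∈ A, z ≠ z' → projc ι z' = projc ι z → r ≤ dist z z') ⟨1, one_pos, by simp⟩
    (fun s t hst ⟨r, hr, h⟩ => ⟨r, hr, fun z hz => h z (hst hz)⟩)
    (fun s t ⟨r, hr, h⟩ ⟨r', hr', h'⟩ => ⟨min r r', lt_min hr hr', fun z hz z' h1 h2 h3 => hz.elim
      (fun hz => (min_le_left _ _).trans (h z hz z' h1 h2 h3)) fun hz => (min_le_right _ _).trans (h' z hz z' h1 h2 h3)⟩) fun z0 hz0 => ?_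
  obtain ⟨U, V, σ, hU, hV, hzU, hzV, -, -, hu⟩ := RR.spec (hKR hz0)
  obtain ⟨η, hη, hb⟩ := Metric.isOpen_iff.1 (hU.inter (hV.preimage (continuous_projc ι))) z0 ⟨hzU, hzV⟩
  refine ⟨K ∩ Metric.ball z0 (η / 2), inter_mem_nhdsWithin _ (Metric.ball_mem_nhds _ (half_pos hη)), η / 2, half_pos hη, fun z hz z' hz' hne hp => ?_⟩
  by_contra! hd
  have h1 := Metric.mem_ball.1 hz.2
  obtain ⟨a1, a2⟩ := hb (show z ∈ Metric.ball z0 η from Metric.mem_ball.2 (by linarith))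
  obtain ⟨b1, b2⟩ := hb (show z' ∈ Metric.ball z0 η from Metric.mem_ball.2 (by linarith [dist_triangle z' z z0, dist_comm z z']))
  exact hne (by rw [hu z (hKA hz.1) a1 a2, hu z' hz' b1 b2, hp])

theorem tube (p m : ℕ) (ι : Fin m → Fin n) (A : Set (Fin n → ℝ)) (hA : IsClosed A) (hAd : DS L A)
    (hN : Nice L p (TT p ι A)ᶜ) : Nice L p Aᶜ := by
  obtain ⟨F, dF, cF, hF, hK⟩ := hN
  have hTc := TT.closed (p := p) (ι := ι) hA
  have hTd := TT.ds (p := p) (ι := ι) hAd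
  set W := (TT p ι A)ᶜ with hW
  have hWo : IsOpen W := hTc.isOpen_compl
  have hWd : DS L W := DS.not (P := fun x => x ∈ TT p ι A) hTd
  set M := A ∩ W with hMdef
  have hMR : M ⊆ RR p ι A := fun z hz => by by_contra h; exact hz.2 ⟨hz.1, h⟩
  have dM : DS L M := DS.and (P := fun x => x ∈ A) (Q := fun x => x ∈ W) hAd hWd
  have hKM : ∀ t, 0 < t → IsCompact {x | x ∈ M ∧ t ≤ F x} := fun t ht => by
    have := (hK t ht).inter_left hA
    convert this using 1
    ext x; exact and_assoc
  -- choose the radius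
  have d1 : DS L {q : (Fin n → ℝ) × (Fin n → ℝ) | q.1 ∈ M} := DS.mem (f := fun q : (Fin n → ℝ) × (Fin n → ℝ) => q.1) dM (by fun_prop)
  have d2 : DS L {q : (Fin n → ℝ) × (Fin n → ℝ) | q.2 ∈ M} := DS.mem (f := fun q : (Fin n → ℝ) × (Fin n → ℝ) => q.2) dM (by fun_prop)
  have d3 : DS L {q : (Fin n → ℝ) × (Fin n → ℝ) | q.1 ∈ M ∧ q.2 ∈ M ∧ projc ι q.2 = projc ι q.1} := dsolve
  have d3' : DM L fun q : (Fin n → ℝ) × (Fin n → ℝ) => if q.1 = q.2 then F q.1 else min (dist q.1 q.2 / 3) (F q.1) := by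
    convert DM.ite (P := fun q : (Fin n → ℝ) × (Fin n → ℝ) => q.1 = q.2) (DS.eq' (L := L)) (f := fun q => F q.1)
      (g := fun q => min (dist q.1 q.2 / 3) (F q.1)) (by fun_prop) (by fun_prop)
  obtain ⟨φ, dφ, cφ, bφ⟩ := FL' (L := L) p (M := {q : (Fin n → ℝ) × (Fin n → ℝ) | q.1 ∈ M ∧ q.2 ∈ M ∧ projc ι q.2 = projc ι q.1})
    (F := fun q => F q.1) (v := fun q => if q.1 = q.2 then F q.1 else min (dist q.1 q.2 / 3) (F q.1)) d3 (by fun_prop)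
    d3' (fun z hz => hF _ hz.1.2) (fun t ht => by
      obtain ⟨r, hr, h⟩ := sep (p := p) (ι := ι) (A := A) (hKM t ht) (fun x hx => hMR hx.1) (fun x hx => hx.1.1)
      refine ⟨min (r / 3) t, lt_min (by positivity) ht, fun q hq hq2 => ?_⟩
      split_ifs with h1
      · exact (min_le_right _ _).trans hq2
      · exact min_le_min (by linarith [h q.1 ⟨hq.1, hq2⟩ q.2 hq.2.1.1 h1 hq.2.2]) hq2)
  set ρ : (Fin n → ℝ) → ℝ := fun z => φ (F z) with hρ
  have dρ : DM L ρ := DM.comp dφ dF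
  have hFI : ∀ x ∈ W, F x ∈ Ioo (0 : ℝ) 2 := fun x hx => ⟨(hF x hx).1, by linarith [(hF x hx).2]⟩
  have ρpos : ∀ x ∈ W, 0 < ρ x := fun x hx => (cφ _ (hFI x hx)).2
  have cFa : ∀ x ∈ W, ContDiffAt ℝ p F x := fun x hx => cF.contDiffAt (hWo.mem_nhds hx)
  have cρ : ∀ x ∈ W, ContDiffAt ℝ p ρ x := fun x hx => ContDiffAt.comp x (g := φ) (cφ _ (hFI x hx)).1 (cFa x hx)
  have ρF : ∀ z ∈ M, ρ z ≤ F z := fun z hz => by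
    have := bφ (z, z) ⟨hz, hz, rfl⟩ 0 (Nat.zero_le _)
    simp only [iteratedDeriv_zero, if_true] at this
    exact (le_abs_self _).trans this
  have ρd : ∀ z ∈ M, ∀ z' ∈ M, z ≠ z' → projc ι z' = projc ι z → ρ z ≤ dist z z' / 3 := fun z hz z' hz' h1 h2 => by
    have := bφ (z, z') ⟨hz, hz', h2⟩ 0 (Nat.zero_le _)
    simp only [iteratedDeriv_zero, if_neg h1] at this
    exact (le_abs_self _).trans (this.trans (min_le_left _ _))
  -- uniqueness
  have huniq : ∀ w, ∀ z ∈ M, ∀ z' ∈ M, projc ι z = projc ι w → projc ι z' = projc ι w → qd z w < (3 / 2 * ρ z) ^ 2 → qd z' w < ρ z' ^ 2 → z' = z := by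
    intro w z hz z' hz' h1 h2 h3 h4
    by_contra hne
    have e1 := dist_lt_of_qd (by linarith [ρpos z hz.2]) h3
    have e2 := dist_lt_of_qd (ρpos z' hz'.2) h4
    have e3 := ρd z hz z' hz' (Ne.symm hne) (h2.trans h1.symm)
    have e4 := ρd z' hz' z hz hne (h1.trans h2.symm)
    have := dist_triangle z w z'
    rw [dist_comm w z'] at this
    rw [dist_comm z' z] at e4
    linarith [dist_nonneg (x := z) (y := z'), ρpos z hz.2]
  set P : (Fin n → ℝ) → ℝ → Prop := fun w y => ∃ z, z ∈ M ∧ projc ι z = projc ι w ∧ qd z w < ρ z ^ 2 ∧ y = 1 - qd z w / ρ z ^ 2 with hP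
  have d4 : DS L {q : ((Fin n → ℝ) × ℝ) × (Fin n → ℝ) | q.2 ∈ M} := DS.mem (f := fun q : ((Fin n → ℝ) × ℝ) × (Fin n → ℝ) => q.2) dM (by fun_prop)
  set b : (Fin n → ℝ) → ℝ := fun w => uch (P w) with hb
  have db : DM L b := DM.uch dsolve
  have weak : ∀ z ∈ M, ∀ w, qd z w < ρ z ^ 2 → qd z w < (3 / 2 * ρ z) ^ 2 := fun z hz w h => by nlinarith [ρpos z hz.2]
  have b1 : ∀ w, ∀ z ∈ M, projc ι z = projc ι w → qd z w < ρ z ^ 2 → b w = 1 - qd z w / ρ z ^ 2 := fun w z hz h1 h2 =>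
    (uch_eq ⟨_, ⟨z, hz, h1, h2, rfl⟩, fun y ⟨z', hz', h3, h4, h5⟩ => by rw [h5, huniq w z hz z' hz' h1 h3 (weak z hz w h2) h4]⟩ ⟨z, hz, h1, h2, rfl⟩).symm
  have b0 : ∀ w, (¬ ∃ z, z ∈ M ∧ projc ι z = projc ι w ∧ qd z w < ρ z ^ 2) → b w = 0 := fun w h =>
    dif_neg fun ⟨y, ⟨z, h1, h2, h3, _⟩, _⟩ => h ⟨z, h1, h2, h3⟩
  have bI : ∀ w, 0 ≤ b w ∧ b w ≤ 1 ∧ (b w = 1 → w ∈ M) := fun w => by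
    by_cases h : ∃ z, z ∈ M ∧ projc ι z = projc ι w ∧ qd z w < ρ z ^ 2
    · obtain ⟨z, h1, h2, h3⟩ := h
      have hr := pow_pos (ρpos z h1.2) 2
      have h4 : qd z w / ρ z ^ 2 < 1 := (div_lt_one hr).2 h3
      have h5 : 0 ≤ qd z w / ρ z ^ 2 := div_nonneg (qd_nonneg _ _) hr.le
      rw [b1 w z h1 h2 h3]
      refine ⟨by linarith, by linarith, fun h6 => ?_⟩
      have : qd z w / ρ z ^ 2 = 0 := by linarith
      rcases div_eq_zero_iff.1 this with h | h
      · rwa [qd_eq h.le]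
      · exact absurd h hr.ne'
    · rw [b0 w h]; simp
  have bM : ∀ w ∈ M, b w = 1 := fun w hw => by
    have : qd w w = 0 := by simp [qd]
    rw [b1 w w hw rfl (by rw [this]; exact pow_pos (ρpos w hw.2) 2), this]; simp
  have cb : ∀ w0 ∈ W, ContDiffAt ℝ p (fun w => b w ^ (p + 1)) w0 := by
    intro w0 hw0
    by_cases h : ∃ z, z ∈ M ∧ projc ι z = projc ι w0 ∧ qd z w0 < (3 / 2 * ρ z) ^ 2
    · obtain ⟨z0, hz0, hp0, hq0⟩ := h
      obtain ⟨U, V, σ, hU, hV, hzU, hzV, hσ, hσ2, hu⟩ := RR.spec (hMR hz0)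
      have hcp : ContDiff ℝ p (projc ι) := contDiff_pi.2 fun i => contDiff_apply ℝ ℝ (ι i)
      have e0 : σ (projc ι w0) = z0 := by rw [← hp0, ← hu z0 hz0.1 hzU hzV]
      have cS : ContDiffAt ℝ p (fun w => σ (projc ι w)) w0 :=
        ContDiffAt.comp w0 (g := σ) (hσ.contDiffAt (hV.mem_nhds (hp0 ▸ hzV))) hcp.contDiffAt
      have cR : ContDiffAt ℝ p (fun w => ρ (σ (projc ι w))) w0 :=
        ContDiffAt.comp w0 (g := ρ) (f := fun w => σ (projc ι w)) (cρ _ (e0 ▸ hz0.2)) cS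
      have cQ : ContDiffAt ℝ p (fun w => qd (σ (projc ι w)) w) w0 :=
        ContDiffAt.comp w0 (g := fun q : (Fin n → ℝ) × (Fin n → ℝ) => qd q.1 q.2) (f := fun w => (σ (projc ι w), w)) (contDiff_qd p).contDiffAt
          (cS.prodMk contDiffAt_id)
      have cB : ContDiffAt ℝ p (fun w => max 0 (1 - qd (σ (projc ι w)) w / ρ (σ (projc ι w)) ^ 2) ^ (p + 1)) w0 :=
        ContDiffAt.comp w0 (g := fun x : ℝ => max 0 x ^ (p + 1)) (f := fun w => 1 - qd (σ (projc ι w)) w / ρ (σ (projc ι w)) ^ 2)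
          (contDiff_maxpow p).contDiffAt (contDiffAt_const.sub (cQ.div (cR.pow 2) (pow_pos (ρpos _ (e0 ▸ hz0.2)) 2).ne'))
      refine cB.congr_of_eventuallyEq ?_
      filter_upwards [(hV.preimage (continuous_projc ι)).mem_nhds (show projc ι w0 ∈ V from hp0 ▸ hzV),
        cS.continuousAt.preimage_mem_nhds (hWo.mem_nhds (show σ (projc ι w0) ∈ W from e0 ▸ hz0.2)),
        cQ.continuousAt.eventually_lt ((continuousAt_const.mul cR.continuousAt).pow 2) (by simpa [e0] using hq0)] with w h1 h2 h3
      obtain ⟨a1, -, a3⟩ := hσ2 _ h1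
      have hzM : σ (projc ι w) ∈ M := ⟨a1, h2⟩
      have hr := pow_pos (ρpos _ h2) 2
      by_cases h4 : qd (σ (projc ι w)) w < ρ (σ (projc ι w)) ^ 2
      · rw [b1 w _ hzM a3 h4, max_eq_right]
        linarith [(div_lt_one hr).2 h4]
      · rw [b0 w, max_eq_left]
        · linarith [(one_le_div hr).2 (not_lt.1 h4)]
        · rintro ⟨z, hz, hz1, hz2⟩
          have := huniq w _ hzM z hz a3 hz1 h3 hz2
          exact h4 (this ▸ hz2)
    · push Not at h
      refine (contDiffAt_const (c := (0 : ℝ))).congr_of_eventuallyEq ?_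
      have hF0 := (hF w0 hw0).1
      obtain ⟨δ, hδ, hball⟩ := Metric.mem_nhds_iff.1 ((cFa w0 hw0).continuousAt.eventually (lt_mem_nhds (half_lt_self hF0)))
      have hKt := hKM (min (δ / 2) (F w0 / 2)) (lt_min (half_pos hδ) (half_pos hF0))
      have hev := hKt.eventually_forall_of_forall_eventually (x₀ := w0) (P := fun w z => projc ι z = projc ι w → ρ z ^ 2 < qd z w) (fun z hz => by
        by_cases hpz : projc ι z = projc ι w0
        · have h1 := h z hz.1 hpz
          have hρz := ρpos z hz.1.2
          have c1 : ContinuousAt (fun q : (Fin n → ℝ) × (Fin n → ℝ) => ρ q.2 ^ 2) (w0, z) :=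
            (ContinuousAt.comp (g := ρ) (f := fun q : (Fin n → ℝ) × (Fin n → ℝ) => q.2) (cρ z hz.1.2).continuousAt continuous_snd.continuousAt).pow 2
          have c2 : ContinuousAt (fun q : (Fin n → ℝ) × (Fin n → ℝ) => qd q.2 q.1) (w0, z) := by
            unfold qd; fun_prop
          exact (c1.eventually_lt c2 (by show ρ z ^ 2 < qd z w0; nlinarith)).mono fun q hq _ => hq
        · have c1 : ContinuousAt (fun q : (Fin n → ℝ) × (Fin n → ℝ) => projc ι q.2) (w0, z) := ((continuous_projc ι).comp continuous_snd).continuousAt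
          have c2 : ContinuousAt (fun q : (Fin n → ℝ) × (Fin n → ℝ) => projc ι q.1) (w0, z) := ((continuous_projc ι).comp continuous_fst).continuousAt
          exact ((c1.prodMk c2).eventually (isOpen_ne_fun continuous_fst continuous_snd |>.mem_nhds hpz)).mono fun q hq h => (hq h).elim)
      filter_upwards [hev, Metric.ball_mem_nhds w0 (half_pos hδ)] with w hw hwb
      rw [b0 w]
      · simp
      · rintro ⟨z, hz, hz1, hz2⟩
        have hd := dist_lt_of_qd (ρpos z hz.2) hz2
        have hFz : min (δ / 2) (F w0 / 2) ≤ F z := by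
          by_contra! hlt
          have h1 := lt_min_iff.1 hlt
          have : z ∈ Metric.ball w0 δ := by
            rw [Metric.mem_ball]; linarith [dist_triangle z w w0, Metric.mem_ball.1 hwb, ρF z hz]
          have : F w0 / 2 < F z := hball this
          linarith
        exact (hw z ⟨hz, hFz⟩ hz1).not_gt hz2
  have hsub : Aᶜ ⊆ W := compl_subset_compl.2 TT.sub
  have cG : ∀ w ∈ W, ContDiffAt ℝ p (fun w => F w * (1 - b w ^ (p + 1))) w := fun w hw => (cFa w hw).mul (contDiffAt_const.sub (cb w hw))
  have hg1 : ∀ w, 0 ≤ 1 - b w ^ (p + 1) ∧ 1 - b w ^ (p + 1) ≤ 1 := fun w => by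
    have := pow_nonneg (bI w).1 (p + 1)
    have := pow_le_one₀ (n := p + 1) (bI w).1 (bI w).2.1
    constructor <;> linarith
  refine ⟨fun w => F w * (1 - b w ^ (p + 1)), by fun_prop, fun w hw => (cG w (hsub hw)).contDiffWithinAt, fun w hw => ?_, fun t ht => ?_⟩
  · have h1 := hF w (hsub hw)
    have h2 : b w ^ (p + 1) < 1 := pow_lt_one₀ (bI w).1 (lt_of_le_of_ne (bI w).2.1 fun h => hw ((bI w).2.2 h).1) (by omega)
    exact ⟨mul_pos h1.1 (by linarith), by nlinarith [hg1 w]⟩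
  · have : {x | x ∈ Aᶜ ∧ t ≤ F x * (1 - b x ^ (p + 1))} = {x | x ∈ W ∧ t ≤ F x} ∩ (fun w => F w * (1 - b w ^ (p + 1))) ⁻¹' Ici t := by
      ext x
      constructor
      · rintro ⟨h1, h2⟩
        have := hF x (hsub h1)
        exact ⟨⟨hsub h1, by nlinarith [hg1 x]⟩, h2⟩
      · rintro ⟨⟨h1, h2⟩, h3⟩
        refine ⟨fun hx => ?_, h3⟩
        have h3 : t ≤ F x * (1 - b x ^ (p + 1)) := h3
        rw [bM x ⟨hx, h1⟩] at h3
        simp at h3; linarith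
    rw [this]
    exact (hK t ht).of_isClosed_subset (ContinuousOn.preimage_isClosed_of_isClosed (fun w hw => (cG w hw.1).continuousAt.continuousWithinAt) (hK t ht).isClosed isClosed_Ici) inter_subset_left
variable (L) in
theorem nice_compl (p : ℕ) (A : Set (Fin n → ℝ)) (hA : IsClosed A) (hd : DS L A) : Nice L p Aᶜ :=
  tower L p (fun A => Nice L p Aᶜ) (by rw [compl_empty]; exact nice_univ p) (fun m ι A h1 h2 h3 => tube p m ι A h1 h2 h3) A hA hd
end Tube

section VD
variable {E F : Type} [NormedAddCommGroup E] [NormedSpace ℝ E] [NormedAddCommGroup F] [NormedSpace ℝ F]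

/-- `γ` is a curve in `M` through `x` with velocity `v` -/
def Crv (M : Set E) (x v : E) (γ : ℝ → E) : Prop := γ 0 = x ∧ (∀ᶠ t in 𝓝 (0:ℝ), γ t ∈ M) ∧ HasDerivAt γ v 0

theorem CpOn.of_le {p q : ℕ} {f : E → F} {M : Set E} (h : CpOn p f M) (hq : q ≤ p) : CpOn q f M := fun x hx => by
  obtain ⟨U, g, h1, h2, h3, h4⟩ := h x hx
  exact ⟨U, g, h1, h2, h3.of_le (by exact_mod_cast hq), h4⟩

theorem CpOn.continuousOn {p : ℕ} {f : E → F} {M : Set E} (h : CpOn p f M) : ContinuousOn f M := fun x hx => by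
  obtain ⟨U, g, h1, h2, h3, h4⟩ := h x hx
  refine (((h3.continuousOn x h2).continuousAt (h1.mem_nhds h2)).continuousWithinAt (s := M)).congr_of_eventuallyEq ?_ (h4 ⟨hx, h2⟩)
  filter_upwards [self_mem_nhdsWithin, mem_nhdsWithin_of_mem_nhds (h1.mem_nhds h2)] with y a b using h4 ⟨a, b⟩

theorem CpOn.of_cd {p : ℕ} {f : E → F} {M : Set E} (h : ∀ x ∈ M, ∃ U, IsOpen U ∧ x ∈ U ∧ ContDiffOn ℝ p f U) : CpOn p f M := fun x hx => by
  obtain ⟨U, h1, h2, h3⟩ := h x hx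
  exact ⟨U, f, h1, h2, h3, fun _ _ => rfl⟩

theorem CpOn.bi {p : ℕ} {G H : Type} [NormedAddCommGroup G] [NormedSpace ℝ G] [NormedAddCommGroup H] [NormedSpace ℝ H]
    {f : E → F} {f' : E → G} {M : Set E} (B : F → G → H) (hB : ∀ (g : E → F) (g' : E → G) U, ContDiffOn ℝ p g U → ContDiffOn ℝ p g' U →
      ContDiffOn ℝ p (fun x => B (g x) (g' x)) U) (h : CpOn p f M) (h' : CpOn p f' M) : CpOn p (fun x => B (f x) (f' x)) M := fun x hx => by
  obtain ⟨U, g, h1, h2, h3, h4⟩ := h x hx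
  obtain ⟨U', g', h1', h2', h3', h4'⟩ := h' x hx
  refine ⟨U ∩ U', fun x => B (g x) (g' x), h1.inter h1', ⟨h2, h2'⟩, hB _ _ _ (h3.mono inter_subset_left) (h3'.mono inter_subset_right),
    fun y hy => ?_⟩
  simp only
  rw [h4 ⟨hy.1, hy.2.1⟩, h4' ⟨hy.1, hy.2.2⟩]

theorem CpOn.add {p : ℕ} {f f' : E → F} {M : Set E} (h : CpOn p f M) (h' : CpOn p f' M) : CpOn p (fun x => f x + f' x) M :=
  CpOn.bi (fun a b => a + b) (fun _ _ _ h1 h2 => h1.add h2) h h'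
theorem CpOn.mul {p : ℕ} {f f' : E → ℝ} {M : Set E} (h : CpOn p f M) (h' : CpOn p f' M) : CpOn p (fun x => f x * f' x) M :=
  CpOn.bi (fun a b => a * b) (fun _ _ _ h1 h2 => h1.mul h2) h h'
theorem CpOn.const {p : ℕ} {M : Set E} (c : F) : CpOn p (fun _ : E => c) M :=
  CpOn.of_cd fun _ _ => ⟨univ, isOpen_univ, mem_univ _, contDiffOn_const⟩
theorem CpOn.congr {p : ℕ} {f f' : E → F} {M : Set E} (h : CpOn p f M) (he : EqOn f' f M) : CpOn p f' M := fun x hx => by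
  obtain ⟨U, g, h1, h2, h3, h4⟩ := h x hx
  exact ⟨U, g, h1, h2, h3, fun y hy => (he hy.1).trans (h4 hy)⟩

theorem CpOn.hasDerivAt {f : E → ℝ} {M : Set E} {x v : E} {γ : ℝ → E} (hγ : Crv M x v γ) {U : Set E} {g : E → ℝ}
    (h1 : IsOpen U) (h2 : x ∈ U) (h3 : ContDiffOn ℝ 1 g U) (h4 : EqOn f g (M ∩ U)) : HasDerivAt (fun t => f (γ t)) (fderiv ℝ g x v) 0 := by
  obtain ⟨a1, a2, a3⟩ := hγ
  have hd : DifferentiableAt ℝ g (γ 0) := a1 ▸ (h3.contDiffAt (h1.mem_nhds h2)).differentiableAt (by simp)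
  have := hd.hasFDerivAt.comp_hasDerivAt (0 : ℝ) a3
  rw [a1] at this
  refine this.congr_of_eventuallyEq ?_
  filter_upwards [a2, a3.continuousAt.preimage_mem_nhds (h1.mem_nhds (a1 ▸ h2))] with t b1 b2 using h4 ⟨b1, b2⟩

theorem vderiv_ext {M : Set E} {D : E → E} {f : E → ℝ} {x : E} (hD : D x ∈ TangentVecs M x) {U : Set E} {g : E → ℝ}
    (h1 : IsOpen U) (h2 : x ∈ U) (h3 : ContDiffOn ℝ 1 g U) (h4 : EqOn f g (M ∩ U)) : vderiv M D f x = fderiv ℝ g x (D x) := by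
  obtain ⟨γ, hγ⟩ := hD
  have key : ∀ (U : Set E) (g : E → ℝ), IsOpen U → x ∈ U → ContDiffOn ℝ 1 g U →
      Set.EqOn f g (M ∩ U) → fderiv ℝ g x (D x) = deriv (fun t => f (γ t)) 0 := fun U g h1 h2 h3 h4 =>
    (CpOn.hasDerivAt hγ h1 h2 h3 h4).deriv.symm
  have hex : ∃ w : ℝ, ∀ (U : Set E) (g : E → ℝ), IsOpen U → x ∈ U → ContDiffOn ℝ 1 g U →
      Set.EqOn f g (M ∩ U) → fderiv ℝ g x (D x) = w := ⟨_, key⟩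
  rw [vderiv, dif_pos hex]
  exact (hex.choose_spec U g h1 h2 h3 h4).symm

theorem vderiv_crv {M : Set E} {D : E → E} {f : E → ℝ} {x : E} (hx : x ∈ M) (hf : CpOn 1 f M) {γ : ℝ → E} (hγ : Crv M x (D x) γ) :
    HasDerivAt (fun t => f (γ t)) (vderiv M D f x) 0 := by
  obtain ⟨U, g, h1, h2, h3, h4⟩ := hf x hx
  rw [vderiv_ext ⟨γ, hγ⟩ h1 h2 h3 h4]
  exact CpOn.hasDerivAt hγ h1 h2 h3 h4

theorem vderiv_congr {M : Set E} {D D' : E → E} {f f' : E → ℝ} {x : E} (hD : D x = D' x) (h : EqOn f f' M) : vderiv M D f x = vderiv M D' f' x := by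
  have e : ∀ (U : Set E) (g : E → ℝ), EqOn f g (M ∩ U) = EqOn f' g (M ∩ U) := fun U g =>
    propext ⟨fun a y hy => (h hy.1).symm.trans (a hy), fun a y hy => (h hy.1).trans (a hy)⟩
  unfold vderiv
  simp only [hD, e]

theorem CpOn.vderiv {q : ℕ} {M : Set E} {D : E → E} {f : E → ℝ} (hf : CpOn (q + 1) f M) (hD : CpOn q D M)
    (hT : ∀ x ∈ M, D x ∈ TangentVecs M x) : CpOn q (vderiv M D f) M := fun x hx => by
  obtain ⟨U, g, h1, h2, h3, h4⟩ := hf x hx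
  obtain ⟨U', g', h1', h2', h3', h4'⟩ := hD x hx
  refine ⟨U ∩ U', fun y => fderiv ℝ g y (g' y), h1.inter h1', ⟨h2, h2'⟩, ?_, fun y hy => ?_⟩
  · exact ((h3.fderiv_of_isOpen h1 (m := q) (by norm_cast)).mono inter_subset_left).clm_apply (h3'.mono inter_subset_right)
  · rw [vderiv_ext (hT y hy.1) h1 hy.2.1 (h3.of_le (by norm_cast; omega)) h4, h4' ⟨hy.1, hy.2.2⟩]
end VD

section VD2
variable {L : FirstOrder.Language} [L.Structure ℝ] [hL : Fact (DMinimal L)] {n : ℕ}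

theorem dm_vderiv {M : Set (Fin n → ℝ)} (hM : DS L M) {D : (Fin n → ℝ) → Fin n → ℝ} (dD : DM L D) {f : (Fin n → ℝ) → ℝ} (df : DM L f)
    (hT : ∀ x ∈ M, D x ∈ TangentVecs M x) (hf : CpOn 1 f M) : ∃ f', DM L f' ∧ EqOn (vderiv M D f) f' M := by
  set Q : (Fin n → ℝ) → (Fin n → ℝ) → Prop := fun x A => ∀ ε : ℝ, 0 < ε → ∃ δ : ℝ, 0 < δ ∧ ∀ y, y ∈ M → dist y x < δ →
    |f y - f x - ∑ i, A i * (y i - x i)| ≤ ε * dist y x with hQ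
  have d1 : DS L {q : ((((Fin n → ℝ) × (Fin n → ℝ)) × ℝ) × ℝ) × (Fin n → ℝ) | q.2 ∈ M} := DS.mem (f := fun q : ((((Fin n → ℝ) × (Fin n → ℝ)) × ℝ) × ℝ) × (Fin n → ℝ) => q.2) hM (by fun_prop)
  have dQ : DS L {q : (Fin n → ℝ) × (Fin n → ℝ) | Q q.1 q.2} := dsolve
  have dQ' : DS L {q : ((Fin n → ℝ) × ℝ) × (Fin n → ℝ) | Q q.1.1 q.2} := DS.mem (f := fun q : ((Fin n → ℝ) × ℝ) × (Fin n → ℝ) => (q.1.1, q.2)) dQ (by fun_prop)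
  set P : (Fin n → ℝ) → ℝ → Prop := fun x y => ∃ A, Q x A ∧ y = ∑ i, A i * D x i with hP
  refine ⟨fun x => uch (P x), DM.uch dsolve, fun x hx => ?_⟩
  have u : ∀ y, P x y → y = vderiv M D f x := by
    rintro y ⟨A, hA, rfl⟩
    obtain ⟨γ, hγ⟩ := hT x hx
    refine HasDerivAt.unique ?_ (vderiv_crv hx hf hγ)
    obtain ⟨a1, a2, a3⟩ := hγ
    have hl : HasDerivAt (fun t => ∑ i, A i * (γ t i - x i)) (∑ i, A i * D x i) 0 :=
      HasDerivAt.fun_sum fun i _ => (((hasDerivAt_pi.1 a3) i).sub_const (x i)).const_mul (A i)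
    have hr : HasDerivAt (fun t => f (γ t) - f x - ∑ i, A i * (γ t i - x i)) 0 0 := by
      rw [hasDerivAt_iff_isLittleO]
      have h1 : (fun t => f (γ t) - f x - ∑ i, A i * (γ t i - x i)) =o[𝓝 0] fun t => γ t - x := by
        refine Asymptotics.IsLittleO.of_bound fun c hc => ?_
        obtain ⟨δ, hδ, h⟩ := hA c hc
        filter_upwards [a2, a3.continuousAt.preimage_mem_nhds (Metric.ball_mem_nhds _ hδ)] with t b1 b2
        rw [a1] at b2
        rw [← dist_eq_norm]
        exact h _ b1 b2
      have h2 : (fun t => γ t - x) =O[𝓝 0] fun t : ℝ => t - 0 := by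
        have := a3.differentiableAt.isBigO_sub
        rwa [a1] at this
      have := h1.trans_isBigO h2
      simpa [a1] using this
    have := (hr.add hl).add_const (f x)
    rw [zero_add] at this
    refine this.congr_of_eventuallyEq (Eventually.of_forall fun t => ?_)
    simp
  obtain ⟨U, g, h1, h2, h3, h4⟩ := hf x hx
  have hg : DifferentiableAt ℝ g x := (h3.contDiffAt (h1.mem_nhds h2)).differentiableAt (by simp)
  have hlin : ∀ v : Fin n → ℝ, fderiv ℝ g x v = ∑ i, fderiv ℝ g x (Pi.single i 1) * v i := fun v => by
    conv_lhs => rw [← Finset.univ_sum_single v]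
    rw [map_sum]
    refine Finset.sum_congr rfl fun i _ => ?_
    rw [show Pi.single i (v i) = v i • (Pi.single i 1 : Fin n → ℝ) by rw [← Pi.single_smul]; simp, map_smul, smul_eq_mul, mul_comm]
  have hPx : P x (vderiv M D f x) := by
    refine ⟨fun i => fderiv ℝ g x (Pi.single i 1), fun ε hε => ?_, by rw [vderiv_ext (hT x hx) h1 h2 h3 h4, hlin]⟩
    have := (hasFDerivAt_iff_isLittleO.1 hg.hasFDerivAt).bound hε
    obtain ⟨δ, hδ, hb⟩ := Metric.eventually_nhds_iff.1 (this.and (h1.mem_nhds h2))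
    refine ⟨δ, hδ, fun y hy hd => ?_⟩
    obtain ⟨c1, c2⟩ := hb hd
    rw [h4 ⟨hy, c2⟩, h4 ⟨hx, h2⟩, dist_eq_norm]
    rw [hlin] at c1
    exact c1
  exact uch_eq (P := P x) ⟨_, hPx, u⟩ hPx
end VD2

section Fml
variable {L : FirstOrder.Language} [L.Structure ℝ] [hL : Fact (DMinimal L)] {n : ℕ}

theorem niceM {p d : ℕ} {M : Set (Fin n → ℝ)} (hM : IsDpSubmanifold L p d M) (dM : DS L M) : ∃ F W, DM L F ∧ IsOpen W ∧ M ⊆ W ∧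
    ContDiffOn ℝ p F W ∧ (∀ x ∈ M, 0 < F x ∧ F x ≤ 1) ∧ ∀ t : ℝ, 0 < t → IsCompact {x | x ∈ M ∧ t ≤ F x} := by
  have hc : IsOpen (closure M \ M)ᶜ := by
    rw [isOpen_iff_mem_nhds]
    intro x hx
    by_cases hxM : x ∈ M
    · obtain ⟨U, V, φ, ψ, h1, h2, h3, h4, -, -, -, -, h5, h6, h7, h8, h9, h10, h11, h12⟩ := hM.2.2 x hxM
      filter_upwards [h1.mem_nhds h2] with y hy hy2
      refine hy2.2 ?_
      have a1 : y ∈ closure (U ∩ M) := h1.inter_closure ⟨hy, hy2.1⟩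
      have a2 : φ y ∈ closure (φ '' (U ∩ M)) := ((h5.continuousOn y hy).mono inter_subset_left).mem_closure_image a1
      have a3 : φ y ∈ {y : Fin n → ℝ | ∀ i : Fin n, d ≤ (i : ℕ) → y i = 0} := by
        refine closure_minimal (?_ : φ '' (U ∩ M) ⊆ _) ?_ a2
        · rw [inter_comm, h12]; exact inter_subset_right
        · have : {y : Fin n → ℝ | ∀ i : Fin n, d ≤ (i : ℕ) → y i = 0} = ⋂ i : Fin n, ⋂ _ : d ≤ (i : ℕ), {y | y i = 0} := by ext; simp
          rw [this]
          exact isClosed_iInter fun i => isClosed_iInter fun _ => isClosed_eq (continuous_apply i) continuous_const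
      have a4 : φ y ∈ φ '' (M ∩ U) := by rw [h12]; exact ⟨h7 hy, a3⟩
      obtain ⟨z, hz, e⟩ := a4
      rw [← h9 y hy, ← e, h9 z hz.2]
      exact hz.1
    · have : x ∉ closure M := fun h => hx ⟨h, hxM⟩
      filter_upwards [isClosed_closure.isOpen_compl.mem_nhds this] with y hy h using hy h.1
  have d1 : DS L {q : ((Fin n → ℝ) × ℝ) × (Fin n → ℝ) | q.2 ∈ M} := DS.mem (f := fun q : ((Fin n → ℝ) × ℝ) × (Fin n → ℝ) => q.2) dM (by fun_prop)
  have d2 : DS L {x : Fin n → ℝ | x ∈ M} := dM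
  have dc : DS L (closure M \ M) := by
    refine DS.mk (P := fun x => (∀ ε : ℝ, 0 < ε → ∃ y, y ∈ M ∧ dist x y < ε) ∧ ¬ x ∈ M) dsolve fun x => ?_
    rw [Set.mem_sdiff, Metric.mem_closure_iff]
  obtain ⟨F, f1, f2, f3, f4⟩ := nice_compl L p (closure M \ M) ⟨hc⟩ dc
  have hs : M ⊆ (closure M \ M)ᶜ := fun x hx h => h.2 hx
  refine ⟨F, _, f1, hc, hs, f2, fun x hx => f3 x (hs hx), fun t ht => ?_⟩
  convert (f4 t ht).inter_left (isClosed_closure (s := M)) using 1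
  ext x
  simp only [mem_inter_iff, mem_ofPred_eq]
  refine ⟨fun h => ⟨subset_closure h.1, hs h.1, h.2⟩, fun h => ⟨by_contra fun h' => h.2.1 ⟨h.1, h'⟩, h.2.2⟩⟩

theorem CpOn.sum {E : Type} [NormedAddCommGroup E] [NormedSpace ℝ E] {p : ℕ} {M : Set E} {J : Type} (s : Finset J) {f : J → E → ℝ}
    (h : ∀ j ∈ s, CpOn p (f j) M) : CpOn p (fun x => ∑ j ∈ s, f j x) M := by
  induction s using Finset.induction_on with
  | empty => simpa using CpOn.const (0:ℝ)
  | insert a s ha ih =>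
    simp only [Finset.sum_insert ha]
    exact (h a (Finset.mem_insert_self _ _)).add (ih fun j hj => h j (Finset.mem_insert_of_mem hj))

theorem CpOn.comp1 {E : Type} [NormedAddCommGroup E] [NormedSpace ℝ E] {p : ℕ} {M : Set E} {F : E → ℝ} {φ : ℝ → ℝ} {O : Set ℝ} (hO : IsOpen O)
    (h : CpOn p F M) (hφ : ContDiffOn ℝ p φ O) (hF : MapsTo F M O) : CpOn p (fun x => φ (F x)) M := fun x hx => by
  obtain ⟨U, g, h1, h2, h3, h4⟩ := h x hx
  refine ⟨U ∩ g ⁻¹' O, fun y => φ (g y), h3.continuousOn.isOpen_inter_preimage h1 hO, ⟨h2, ?_⟩,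
    hφ.comp (h3.mono inter_subset_left) fun y hy => hy.2, fun y hy => ?_⟩
  · show g x ∈ O
    rw [← h4 ⟨hx, h2⟩]; exact hF hx
  · simp only
    rw [h4 ⟨hy.1, hy.2.1⟩]

theorem cd_iter {p i m : ℕ} {φ : ℝ → ℝ} (hφ : ∀ t ∈ Ioo (0:ℝ) 2, ContDiffAt ℝ p φ t) (h : i + m ≤ p) :
    ContDiffOn ℝ m (iteratedDeriv i φ) (Ioo 0 2) := by
  induction i generalizing m with
  | zero => intro t ht; rw [iteratedDeriv_zero]; exact ((hφ t ht).of_le (by exact_mod_cast (by omega : m ≤ p))).contDiffWithinAt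
  | succ i ih =>
    rw [iteratedDeriv_succ]
    exact (ih (m := m + 1) (by omega)).deriv_of_isOpen isOpen_Ioo (by norm_cast)

theorem formula {p k : ℕ} {M : Set (Fin n → ℝ)} (dM : DS L M) {J : Type} [Fintype J] {D : Fin k → (Fin n → ℝ) → (Fin n → ℝ)}
    (hD : ∀ i, DM L (D i) ∧ CpOn (p - 1) (D i) M ∧ ∀ x ∈ M, D i x ∈ TangentVecs M x) {F : (Fin n → ℝ) → ℝ} (dF : DM L F)
    (cF : CpOn p F M) (hF : MapsTo F M (Ioo 0 2)) {q : J → (Fin n → ℝ) → ℝ} (hq : ∀ j, DM L (q j) ∧ CpOn p (q j) M)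
    (l : List (Fin k)) (hl : l.length ≤ p) : ∃ G : J → ℕ → (Fin n → ℝ) → ℝ, (∀ j i, DM L (G j i) ∧ CpOn (p - l.length) (G j i) M) ∧
      ∀ φ : ℝ → ℝ, (∀ t ∈ Ioo (0:ℝ) 2, ContDiffAt ℝ p φ t) → ∀ a : J → ℝ, ∀ x ∈ M,
        vderivIter M D l (fun x => φ (F x) * ∑ j, a j * q j x) x =
          ∑ j, a j * ∑ i ∈ Finset.range (l.length + 1), iteratedDeriv i φ (F x) * G j i x := by
  induction l with
  | nil =>
    refine ⟨fun j _ => q j, fun j i => hq j, fun φ hφ a x hx => ?_⟩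
    simp only [vderivIter, List.length_nil, zero_add, Finset.range_one, Finset.sum_singleton, iteratedDeriv_zero, Finset.mul_sum]
    exact Finset.sum_congr rfl fun j _ => by ring
  | cons i₀ l ih =>
    rw [List.length_cons] at hl
    obtain ⟨G, hG, hform⟩ := ih (by omega)
    obtain ⟨D1, D2, D3⟩ := hD i₀
    set m := l.length with hm
    obtain ⟨vF, dvF, evF⟩ := dm_vderiv dM D1 dF D3 (cF.of_le (by omega))
    have hvG := fun j i => dm_vderiv dM D1 (hG j i).1 D3 ((hG j i).2.of_le (by omega))
    choose vG dvG evG using hvG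
    have cvF : CpOn (p - (m + 1)) vF M := by
      refine CpOn.congr (CpOn.vderiv (cF.of_le (by omega)) (D2.of_le (by omega)) D3) fun x hx => (evF hx).symm
    have cvG : ∀ j i, CpOn (p - (m + 1)) (vG j i) M := fun j i => 
      CpOn.congr (CpOn.vderiv ((hG j i).2.of_le (by omega)) (D2.of_le (by omega)) D3) fun x hx => (evG j i hx).symm
    have cG : ∀ j i, CpOn (p - (m + 1)) (G j i) M := fun j i => (hG j i).2.of_le (by omega)
    set G' : J → ℕ → (Fin n → ℝ) → ℝ := fun j i x => (if i ≤ m then vG j i x else 0) + (if 1 ≤ i then vF x * G j (i - 1) x else 0) with hG'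
    refine ⟨G', fun j i => ⟨?_, ?_⟩, fun φ hφ a x hx => ?_⟩
    · have e : ∀ (P : Prop) [Decidable P] (f : (Fin n → ℝ) → ℝ), DM L f → DM L fun x => if P then f x else 0 := fun P _ f hf => by
        by_cases h : P <;> simp only [h, if_true, if_false] <;> fun_prop
      exact (e _ _ (dvG j i)).add (e _ _ (dvF.mul (hG j (i-1)).1))
    · rw [List.length_cons]
      have e : ∀ (P : Prop) [Decidable P] (f : (Fin n → ℝ) → ℝ), CpOn (p - (m + 1)) f M → CpOn (p - (m + 1)) (fun x => if P then f x else 0) M := fun P _ f hf => by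
        by_cases h : P <;> simp only [h, if_true, if_false]
        exacts [hf, CpOn.const 0]
      exact (e _ _ (cvG j i)).add (e _ _ (cvF.mul (cG j (i-1))))
    · show vderiv M (D i₀) (vderivIter M D l _) x = _
      rw [vderiv_congr rfl (fun y hy => hform φ hφ a y hy)]
      obtain ⟨γ, hγ⟩ := D3 x hx
      have c1 : CpOn 1 (fun x => ∑ j, a j * ∑ i ∈ Finset.range (m + 1), iteratedDeriv i φ (F x) * G j i x) M := by
        refine CpOn.sum _ fun j _ => (CpOn.const (a j)).mul (CpOn.sum _ fun i hi => ?_)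
        rw [Finset.mem_range] at hi
        exact (CpOn.comp1 isOpen_Ioo (cF.of_le (by omega)) (cd_iter hφ (by omega)) hF).mul ((hG j i).2.of_le (by omega))
      refine (vderiv_crv hx c1 hγ).unique ?_
      have hFd := vderiv_crv hx (cF.of_le (by omega)) hγ
      rw [evF hx] at hFd
      have hGd := fun j i => vderiv_crv hx ((hG j i).2.of_le (q := 1) (by omega)) hγ
      have hγ0 : γ 0 = x := hγ.1
      have hφd : ∀ i, i < m + 1 → HasDerivAt (iteratedDeriv i φ) (iteratedDeriv (i+1) φ (F x)) (F (γ 0)) := fun i hi => by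
        rw [hγ0, iteratedDeriv_succ]
        exact (((cd_iter hφ (m := 1) (by omega)).differentiableOn (by simp)).differentiableAt (isOpen_Ioo.mem_nhds (hF hx))).hasDerivAt
      have key := HasDerivAt.fun_sum (u := Finset.univ) fun j _ => (HasDerivAt.fun_sum (u := Finset.range (m+1)) fun i hi =>
        ((hφd i (Finset.mem_range.1 hi)).comp (0:ℝ) hFd).mul (hGd j i)).const_mul (a j)
      refine (key.congr_deriv ?_).congr_of_eventuallyEq (Eventually.of_forall fun t => rfl)
      refine Finset.sum_congr rfl fun j _ => ?_
      congr 1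
      rw [List.length_cons]
      simp only [hG', mul_add, Finset.sum_add_distrib, Function.comp_apply, hγ0]
      rw [add_comm, Finset.sum_range_succ _ (m+1)]
      simp only [not_le.2 (Nat.lt_succ_self m), if_false, mul_zero, add_zero]
      rw [Finset.sum_range_succ' _ (m+1)]
      simp only [Nat.le_add_left, if_true, Nat.add_sub_cancel, not_le.2 zero_lt_one, if_false, mul_zero, add_zero]
      congr 1
      · refine Finset.sum_congr rfl fun i hi => ?_
        rw [if_pos (Nat.lt_succ_iff.1 (Finset.mem_range.1 hi)), evG j i hx]
      · exact Finset.sum_congr rfl fun i _ => by ring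
end Fml

section Pert
variable {L : FirstOrder.Language} [L.Structure ℝ] [hL : Fact (DMinimal L)] {n : ℕ}

theorem pert {p k : ℕ} {M : Set (Fin n → ℝ)} (dM : DS L M) {J : Type} [Fintype J] {D : Fin k → (Fin n → ℝ) → (Fin n → ℝ)}
    (hD : ∀ i, DM L (D i) ∧ CpOn (p - 1) (D i) M ∧ ∀ x ∈ M, D i x ∈ TangentVecs M x) {F : (Fin n → ℝ) → ℝ} (dF : DM L F)
    (cF : CpOn p F M) (hF : ∀ x ∈ M, 0 < F x ∧ F x ≤ 1) (hK : ∀ t : ℝ, 0 < t → IsCompact {x | x ∈ M ∧ t ≤ F x})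
    {q : J → (Fin n → ℝ) → ℝ} (hq : ∀ j, DM L (q j) ∧ CpOn p (q j) M)
    {ε : (Fin n → ℝ) → ℝ} (dε : DM L ε) (cε : ContinuousOn ε M) (hε : ∀ x ∈ M, 0 < ε x) :
    ∃ φ, DM L φ ∧ (∀ t ∈ Ioo (0:ℝ) 2, ContDiffAt ℝ p φ t ∧ 0 < φ t) ∧ ∀ a : J → ℝ, (∀ j, |a j| ≤ 1) →
      ∀ l : List (Fin k), l.length ≤ p → ∀ x ∈ M, |vderivIter M D l (fun x => φ (F x) * ∑ j, a j * q j x) x| < ε x := by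
  have hF' : MapsTo F M (Ioo 0 2) := fun x hx => ⟨(hF x hx).1, (hF x hx).2.trans_lt one_lt_two⟩
  choose G hG hf using fun l : {l : List (Fin k) // l.length ≤ p} => formula dM hD dF cF hF' hq l.1 l.2
  have : Fintype {l : List (Fin k) // l.length ≤ p} := (List.finite_length_le (Fin k) p).fintype
  set T : (Fin n → ℝ) → ℝ := fun x => ∑ l, ∑ j, ∑ i ∈ Finset.range (p + 1), |G l j i x| with hT
  have dG := fun l j i => (hG l j i).1
  have dT : DM L T := DM.sum _ fun l => DM.sum _ fun j => DM.sum _ fun i => (dG l j i).abs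
  have cT : ContinuousOn T M := continuousOn_finsetSum _ fun l _ => continuousOn_finsetSum _ fun j _ => continuousOn_finsetSum _ fun i _ =>
    (hG l j i).2.continuousOn.abs
  have T0 : ∀ x, 0 ≤ T x := fun x => Finset.sum_nonneg fun l _ => Finset.sum_nonneg fun j _ => Finset.sum_nonneg fun i _ => abs_nonneg _
  have hv0 : ∀ x ∈ M, 0 < ε x / (1 + T x) := fun x hx => div_pos (hε x hx) (add_pos_of_pos_of_nonneg one_pos (T0 x))
  obtain ⟨φ, h1, h2, h3⟩ := FL' p (M := M) (F := F) (v := fun x => ε x / (1 + T x)) dM dF (by fun_prop) hF (by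
    intro t ht
    rcases Set.eq_empty_or_nonempty {x | x ∈ M ∧ t ≤ F x} with h | h
    · exact ⟨1, one_pos, fun z hz hz' => absurd (show z ∈ {x | x ∈ M ∧ t ≤ F x} from ⟨hz, hz'⟩) (by simp [h])⟩
    · obtain ⟨z, hz, hm⟩ := (hK t ht).exists_isMinOn h (f := fun x => ε x / (1 + T x))
        ((cε.div (continuousOn_const.add cT) fun x _ => (add_pos_of_pos_of_nonneg one_pos (T0 x)).ne').mono fun x hx => hx.1)
      exact ⟨_, hv0 z hz.1, fun y hy hy' => hm ⟨hy, hy'⟩⟩)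
  refine ⟨φ, h1, h2, fun a ha l hl x hx => ?_⟩
  rw [hf ⟨l, hl⟩ φ (fun t ht => (h2 t ht).1) a x hx]
  have hv := hv0 x hx
  set v := ε x / (1 + T x) with hvd
  calc _ ≤ ∑ j, ∑ i ∈ Finset.range (p + 1), v * |G ⟨l, hl⟩ j i x| := by
        refine (Finset.abs_sum_le_sum_abs _ _).trans (Finset.sum_le_sum fun j _ => ?_)
        rw [abs_mul]
        refine (mul_le_of_le_one_left (abs_nonneg _) (ha j)).trans ((Finset.abs_sum_le_sum_abs _ _).trans ?_)
        refine (Finset.sum_le_sum_of_subset_of_nonneg (Finset.range_mono (Nat.succ_le_succ hl)) fun _ _ _ => abs_nonneg _).trans ?_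
        refine Finset.sum_le_sum fun i hi => ?_
        rw [abs_mul]
        exact mul_le_mul_of_nonneg_right (h3 x hx i (Nat.lt_succ_iff.1 (Finset.mem_range.1 hi))) (abs_nonneg _)
    _ = v * ∑ j, ∑ i ∈ Finset.range (p + 1), |G ⟨l, hl⟩ j i x| := by simp only [Finset.mul_sum]
    _ ≤ v * T x := mul_le_mul_of_nonneg_left (Finset.single_le_sum (f := fun l => ∑ j, ∑ i ∈ Finset.range (p + 1), |G l j i x|)
        (fun l _ => Finset.sum_nonneg fun j _ => Finset.sum_nonneg fun i _ => abs_nonneg _) (Finset.mem_univ _)) hv.le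
    _ < v * (1 + T x) := by nlinarith
    _ = ε x := div_mul_cancel₀ _ (add_pos_of_pos_of_nonneg one_pos (T0 x)).ne'
end Pert

section PT
open MeasureTheory
variable {E P : Type} [NormedAddCommGroup E] [NormedSpace ℝ E] [FiniteDimensional ℝ E] [MeasurableSpace E] [BorelSpace E]
  [NormedAddCommGroup P] [NormedSpace ℝ P] [FiniteDimensional ℝ P] [MeasurableSpace P] [BorelSpace P]

theorem pt (μ : Measure P) [μ.IsAddHaarMeasure] {V : Set E} (hV : IsOpen V) {c : E → E} {B : E → P →L[ℝ] E}
    (hc : ∀ w ∈ V, DifferentiableAt ℝ c w) (hB : ∀ w ∈ V, DifferentiableAt ℝ B w) (hs : ∀ w ∈ V, Function.Surjective (B w)) :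
    μ {a | ∃ w ∈ V, c w + B w a = 0 ∧ ∃ u, u ≠ 0 ∧ fderiv ℝ c w u + fderiv ℝ B w u a = 0} = 0 := by
  have key : ∀ w₀ ∈ V, ∃ N ∈ 𝓝 w₀, μ {a | ∃ w ∈ N, w ∈ V ∧ c w + B w a = 0 ∧ ∃ u, u ≠ 0 ∧ fderiv ℝ c w u + fderiv ℝ B w u a = 0} = 0 := by
    intro w₀ hw₀
    obtain ⟨C0, hC0⟩ := (B w₀ : P →ₗ[ℝ] E).exists_rightInverse_of_surjective (LinearMap.range_eq_top.2 (hs w₀ hw₀))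
    set C : E →L[ℝ] P := LinearMap.toContinuousLinearMap C0 with hC
    set A : E → E →L[ℝ] E := fun w => (B w).comp C with hA
    have hA0 : A w₀ = (ContinuousLinearEquiv.refl ℝ E : E →L[ℝ] E) := by
      ext e
      exact LinearMap.congr_fun hC0 e
    have hAd : ∀ w ∈ V, DifferentiableAt ℝ A w := fun w hw => (hB w hw).clm_comp (differentiableAt_const C)
    have hN : {w | w ∈ V ∧ A w ∈ range ((↑) : (E ≃L[ℝ] E) → E →L[ℝ] E)} ∈ 𝓝 w₀ := by
      filter_upwards [hV.mem_nhds hw₀, (hAd w₀ hw₀).continuousAt.preimage_mem_nhds (hA0 ▸ (ContinuousLinearEquiv.nhds (ContinuousLinearEquiv.refl ℝ E)))] with w h1 h2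
        using ⟨h1, h2⟩
    refine ⟨_, hN, ?_⟩
    set e : E × P → E := fun q => (A q.1).inverse (c q.1 + B q.1 q.2) with he
    set Θ : E × P → E × P := fun q => (e q, q.2 - C (e q)) with hΘ
    have hed : ∀ w b, w ∈ V → (A w ∈ range ((↑) : (E ≃L[ℝ] E) → E →L[ℝ] E)) → DifferentiableAt ℝ e (w, b) := by
      rintro w b hw ⟨ee, hee⟩
      have h1 : DifferentiableAt ℝ (fun q : E × P => q.1) (w, b) := differentiableAt_fst
      have h2 : DifferentiableAt ℝ (fun q : E × P => A q.1) (w, b) := DifferentiableAt.comp (g := A) (w, b) (hAd w hw) h1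
      have h3 : DifferentiableAt ℝ ContinuousLinearMap.inverse (A w) := hee ▸ (contDiffAt_map_inverse (n := 1) ee).differentiableAt (by simp)
      have h4 : DifferentiableAt ℝ (fun q : E × P => (A q.1).inverse) (w, b) := DifferentiableAt.comp (g := ContinuousLinearMap.inverse) (w, b) h3 h2
      exact h4.clm_apply ((DifferentiableAt.comp (w, b) (hc w hw) h1).add ((DifferentiableAt.comp (w, b) (hB w hw) h1).clm_apply differentiableAt_snd))
    have hinv : ∀ w b, (A w ∈ range ((↑) : (E ≃L[ℝ] E) → E →L[ℝ] E)) → A w (e (w, b)) = c w + B w b := by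
      rintro w b ⟨ee, hee⟩
      simp only [he]
      rw [← hee, ContinuousLinearMap.inverse_equiv]
      simp
    set Bad := {a | ∃ w ∈ {w | w ∈ V ∧ A w ∈ range ((↑) : (E ≃L[ℝ] E) → E →L[ℝ] E)}, w ∈ V ∧ c w + B w a = 0 ∧
      ∃ u, u ≠ 0 ∧ fderiv ℝ c w u + fderiv ℝ B w u a = 0} with hBad
    set S : Set (E × P) := {q | q.1 ∈ V ∧ A q.1 ∈ range ((↑) : (E ≃L[ℝ] E) → E →L[ℝ] E) ∧ ∃ u, u ≠ 0 ∧ fderiv ℝ Θ q (u, 0) = 0} with hS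
    have hΘd : ∀ q ∈ S, DifferentiableAt ℝ Θ q := fun q hq => by
      have := hed q.1 q.2 hq.1 hq.2.1
      exact this.prodMk (differentiableAt_snd.sub (C.differentiableAt.comp _ this))
    have h0 := addHaar_image_eq_zero_of_det_fderivWithin_eq_zero ((Measure.addHaar : Measure E).prod μ) (f := Θ) (s := S) (f' := fun q => fderiv ℝ Θ q)
      (fun q hq => (hΘd q hq).hasFDerivAt.hasFDerivWithinAt) (fun q hq => by
        obtain ⟨-, -, u, hu, hk⟩ := hq
        by_contra hdet
        have := (LinearMap.equivOfDetNeZero (fderiv ℝ Θ q : E × P →ₗ[ℝ] E × P) hdet).injective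
        have h2 := this (a₁ := (u, 0)) (a₂ := 0) (by simpa [LinearMap.equivOfDetNeZero] using hk)
        exact hu (congrArg Prod.fst h2))
    have hsub : (univ : Set E) ×ˢ Bad ⊆ Θ '' S := by
      rintro ⟨x, a⟩ ⟨-, w, ⟨hw, hr⟩, -, hz, u, hu, hk⟩
      have hex : e (w, a + C x) = x := by
        have h1 := hinv w (a + C x) hr
        obtain ⟨ee, hee⟩ := hr
        rw [map_add, ← add_assoc, hz, zero_add] at h1
        have h2 : A w x = B w (C x) := rfl
        rw [← h2, ← hee] at h1
        exact ee.injective h1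
      refine ⟨(w, a + C x), ⟨hw, hr, u, hu, ?_⟩, ?_⟩
      · have hd := hed w (a + C x) hw hr
        have hl : HasDerivAt (fun t : ℝ => w + t • u) u 0 := by simpa using ((hasDerivAt_id (0:ℝ)).smul_const u).const_add w
        have hl2 : HasDerivAt (fun t : ℝ => (w + t • u, a + C x)) (u, (0:P)) 0 := hl.prodMk (hasDerivAt_const _ _)
        have hw0 : w + (0:ℝ) • u = w := by simp
        have e1 : HasDerivAt (fun t : ℝ => e (w + t • u, a + C x)) (fderiv ℝ e (w, a + C x) (u, 0)) 0 := by
          refine HasFDerivAt.comp_hasDerivAt (0:ℝ) (l := e) ?_ hl2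
          rw [hw0]; exact hd.hasFDerivAt
        have c1 : HasDerivAt (fun t : ℝ => c (w + t • u)) (fderiv ℝ c w u) 0 := by
          refine HasFDerivAt.comp_hasDerivAt (0:ℝ) (l := c) ?_ hl
          rw [hw0]; exact (hc w hw).hasFDerivAt
        have b1 : HasDerivAt (fun t : ℝ => B (w + t • u)) (fderiv ℝ B w u) 0 := by
          refine HasFDerivAt.comp_hasDerivAt (0:ℝ) (l := B) ?_ hl
          rw [hw0]; exact (hB w hw).hasFDerivAt
        have l1 := b1.clm_apply (C.hasFDerivAt.comp_hasDerivAt (0:ℝ) e1)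
        have r1 := c1.add (b1.clm_apply (hasDerivAt_const (0:ℝ) (a + C x)))
        have hev : ∀ᶠ t in 𝓝 (0:ℝ), A (w + t • u) ∈ range ((↑) : (E ≃L[ℝ] E) → E →L[ℝ] E) := by
          have hcA : ContinuousAt (fun t : ℝ => A (w + t • u)) 0 := ContinuousAt.comp (g := A) (by rw [hw0]; exact (hAd w hw).continuousAt) hl.continuousAt
          refine hcA.preimage_mem_nhds ?_
          obtain ⟨ee, hee⟩ := hr
          rw [hw0, ← hee]
          exact ContinuousLinearEquiv.nhds ee
        have hu := l1.unique (r1.congr_of_eventuallyEq (by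
          filter_upwards [hev] with t ht using hinv _ _ ht))
        simp only [Function.comp_apply, hw0, hex, map_zero, add_zero, map_add] at hu
        have h3 : A w (fderiv ℝ e (w, a + C x) (u, 0)) = 0 := by
          have h4 : A w (fderiv ℝ e (w, a + C x) (u, 0)) = B w (C (fderiv ℝ e (w, a + C x) (u, 0))) := rfl
          rw [h4]
          have : B w (C (fderiv ℝ e (w, a + C x) (u, 0))) = fderiv ℝ c w u + fderiv ℝ B w u a := by
            rw [← add_assoc, add_comm] at hu
            exact add_right_cancel hu
          rw [this, hk]
        have h5 : fderiv ℝ e (w, a + C x) (u, 0) = 0 := by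
          obtain ⟨ee, hee⟩ := hr
          rw [← hee] at h3
          exact ee.injective (by simpa using h3)
        have h6 : HasFDerivAt Θ ((fderiv ℝ e (w, a + C x)).prod (ContinuousLinearMap.snd ℝ E P - C.comp (fderiv ℝ e (w, a + C x)))) (w, a + C x) :=
          hd.hasFDerivAt.prodMk (hasFDerivAt_snd.sub (C.hasFDerivAt.comp _ hd.hasFDerivAt))
        rw [h6.fderiv]
        simp [h5]
      · simp only [hΘ, hex]
        simp
    have h1 := measure_mono_null hsub h0
    rw [Measure.prod_prod] at h1
    exact (mul_eq_zero.1 h1).resolve_left (isOpen_univ.measure_pos _ univ_nonempty).ne'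
  choose! N hN hN0 using key
  obtain ⟨t, ht, htc, hcov⟩ := TopologicalSpace.countable_cover_nhdsWithin (s := V) (f := N) fun x hx => mem_nhdsWithin_of_mem_nhds (hN x hx)
  refine measure_mono_null ?_ ((measure_biUnion_null_iff htc).2 fun w hw => hN0 w (ht hw))
  rintro a ⟨w, hw, h⟩
  obtain ⟨i, hi, hwi⟩ := mem_iUnion₂.1 (hcov hw)
  exact mem_iUnion₂.2 ⟨i, hi, w, hwi, hw, h⟩
end PT

section Mor
open MeasureTheory
variable {n d : ℕ}

theorem pt' {E J : Type} [NormedAddCommGroup E] [NormedSpace ℝ E] [FiniteDimensional ℝ E] [Fintype J] {V : Set E} (hV : IsOpen V) {c : E → E}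
    {y : J → E → E} (hc : ∀ w ∈ V, DifferentiableAt ℝ c w) (hy : ∀ j, ∀ w ∈ V, DifferentiableAt ℝ (y j) w)
    (hs : ∀ w ∈ V, ∀ e, ∃ a : J → ℝ, ∑ j, a j • y j w = e) :
    ∀ᵐ a : J → ℝ, ∀ w ∈ V, c w + ∑ j, a j • y j w = 0 → ∀ u, fderiv ℝ (fun w => c w + ∑ j, a j • y j w) w u = 0 → u = 0 := by
  borelize E
  set B : E → (J → ℝ) →L[ℝ] E := fun w => ∑ j, (ContinuousLinearMap.proj (R := ℝ) (φ := fun _ : J => ℝ) j).smulRight (y j w) with hB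
  have hBa : ∀ w a, B w a = ∑ j, a j • y j w := fun w a => by simp [hB]
  have hBd : ∀ w ∈ V, DifferentiableAt ℝ B w := fun w hw => DifferentiableAt.fun_sum fun j _ =>
    (ContinuousLinearMap.smulRightL ℝ (J → ℝ) E (ContinuousLinearMap.proj (R := ℝ) (φ := fun _ : J => ℝ) j)).differentiableAt.comp w (hy j w hw)
  have := pt (volume : Measure (J → ℝ)) hV hc hBd fun w hw e => by
    obtain ⟨a, ha⟩ := hs w hw e
    exact ⟨a, by rw [hBa, ha]⟩
  rw [← compl_compl {a | ∃ w ∈ V, _}, ← mem_ae_iff] at this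
  filter_upwards [this] with a ha w hw h0 u hu
  by_contra hu0
  refine ha ⟨w, hw, by rw [hBa, h0], u, hu0, ?_⟩
  rw [← hu]
  have e1 : (fun w => c w + ∑ j, a j • y j w) = fun w => c w + B w a := by funext w; rw [hBa]
  rw [e1, ((hc w hw).hasFDerivAt.fun_add ((hBd w hw).hasFDerivAt.clm_apply (hasFDerivAt_const a w))).fderiv]
  simp

/-- a local parametrization of `M` -/
def Par (M : Set (Fin n → ℝ)) (W : Set (Fin d → ℝ)) (ψ : (Fin d → ℝ) → Fin n → ℝ) : Prop :=
  IsOpen W ∧ ContDiffOn ℝ 2 ψ W ∧ MapsTo ψ W M ∧ ∀ w ∈ W, Function.Injective (fun u => fderiv ℝ ψ w u)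

theorem exists_par {L : FirstOrder.Language} [L.Structure ℝ] {p : ℕ} (hp : 2 ≤ p) {M : Set (Fin n → ℝ)} (hM : IsDpSubmanifold L p d M) (x : Fin n → ℝ)
    (hx : x ∈ M) : ∃ (W : Set (Fin d → ℝ)) (ψ : (Fin d → ℝ) → Fin n → ℝ), Par M W ψ ∧ ∃ U ∈ 𝓝 x, M ∩ U ⊆ ψ '' W := by
  obtain ⟨-, hdn, hM⟩ := hM
  obtain ⟨U, V, φ, ψ, h1, h2, h3, h4, -, -, -, -, h5, h6, h7, h8, h9, h10, h11, h12⟩ := hM x hx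
  set j : (Fin d → ℝ) →L[ℝ] (Fin n → ℝ) := ContinuousLinearMap.pi fun i =>
    if h : (i : ℕ) < d then ContinuousLinearMap.proj (R := ℝ) (φ := fun _ : Fin d => ℝ) ⟨i, h⟩ else 0 with hj
  have hj1 : ∀ v (i : Fin n) (h : (i : ℕ) < d), j v i = v ⟨i, h⟩ := fun v i h => by simp [hj, h]
  have hj2 : ∀ v (i : Fin n), d ≤ (i : ℕ) → j v i = 0 := fun v i h => by simp [hj, not_lt.2 h]
  have hji : Function.Injective j := fun u v h => by
    funext i
    have := congrFun h (Fin.castLE hdn i)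
    rwa [hj1 _ _ (by simp), hj1 _ _ (by simp)] at this
  have hpp : (2 : WithTop ℕ∞) ≤ (p : WithTop ℕ∞) := by exact_mod_cast hp
  have hWo : IsOpen (j ⁻¹' V) := h3.preimage j.continuous
  have hc : ContDiffOn ℝ 2 (fun w => ψ (j w)) (j ⁻¹' V) := (h6.of_le hpp).comp j.contDiff.contDiffOn fun w hw => hw
  refine ⟨j ⁻¹' V, fun w => ψ (j w), ⟨hWo, hc, fun w hw => ?_, fun w hw => ?_⟩, U, h1.mem_nhds h2, fun z hz => ?_⟩
  · have : j w ∈ φ '' (M ∩ U) := by rw [h12]; exact ⟨hw, hj2 w⟩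
    obtain ⟨z, hz, e⟩ := this
    show ψ (j w) ∈ M
    rw [← e, h9 z hz.2]
    exact hz.1
  · have hd1 := ((hc.contDiffAt (hWo.mem_nhds hw)).differentiableAt (by simp)).hasFDerivAt
    have hd2 := (((h5.of_le hpp).contDiffAt (h1.mem_nhds (h8 hw))).differentiableAt (by simp)).hasFDerivAt
    have hd3 := (HasFDerivAt.comp w hd2 hd1).unique (j.hasFDerivAt.congr_of_eventuallyEq (by
      filter_upwards [hWo.mem_nhds hw] with z hz using h10 _ hz))
    intro u v huv
    apply hji
    rw [← hd3]
    simp only [ContinuousLinearMap.comp_apply]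
    exact congrArg _ huv
  · have : φ z ∈ V ∩ {y | ∀ i : Fin n, d ≤ (i : ℕ) → y i = 0} := h12 ▸ mem_image_of_mem φ hz
    have e : j (fun i => φ z (Fin.castLE hdn i)) = φ z := by
      funext i
      by_cases hi : (i : ℕ) < d
      · rw [hj1 _ _ hi]; rfl
      · rw [hj2 _ _ (not_lt.1 hi), this.2 i (not_lt.1 hi)]
    exact ⟨fun i => φ z (Fin.castLE hdn i), by show j _ ∈ V; rw [e]; exact this.1, by simp only; rw [e, h9 z hz.2]⟩

theorem cd_par {M : Set (Fin n → ℝ)} {W : Set (Fin d → ℝ)} {ψ : (Fin d → ℝ) → Fin n → ℝ} (h : Par M W ψ) {f : (Fin n → ℝ) → ℝ} (hf : CpOn 2 f M)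
    {w : Fin d → ℝ} (hw : w ∈ W) : ContDiffAt ℝ 2 (fun z => f (ψ z)) w := by
  obtain ⟨a1, a2, a3, -⟩ := h
  obtain ⟨U, g, h1, h2, h3, h4⟩ := hf _ (a3 hw)
  have hψ := a2.contDiffAt (a1.mem_nhds hw)
  refine ((h3.contDiffAt (h1.mem_nhds h2)).comp w hψ).congr_of_eventuallyEq ?_
  filter_upwards [a1.mem_nhds hw, hψ.continuousAt.preimage_mem_nhds (h1.mem_nhds h2)] with z b1 b2 using h4 ⟨a3 b1, b2⟩

/-- chart gradient -/
def gr (ψ : (Fin d → ℝ) → Fin n → ℝ) (f : (Fin n → ℝ) → ℝ) (w : Fin d → ℝ) : Fin d → ℝ := gradVec (fun z => f (ψ z)) w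

theorem hasFDerivAt_gr {M : Set (Fin n → ℝ)} {W : Set (Fin d → ℝ)} {ψ : (Fin d → ℝ) → Fin n → ℝ} (h : Par M W ψ) {f : (Fin n → ℝ) → ℝ} (hf : CpOn 2 f M)
    {w : Fin d → ℝ} (hw : w ∈ W) : DifferentiableAt ℝ (gr ψ f) w ∧
      ∀ u i, fderiv ℝ (gr ψ f) w u i = iteratedFDeriv ℝ 2 (fun z => f (ψ z)) w ![u, Pi.single i 1] := by
  have h1 : DifferentiableAt ℝ (fderiv ℝ fun z => f (ψ z)) w := ((cd_par h hf hw).fderiv_right (m := 1) (by norm_num)).differentiableAt (by simp)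
  have h2 : HasFDerivAt (gr ψ f) (ContinuousLinearMap.pi fun i => (ContinuousLinearMap.apply ℝ ℝ (Pi.single i 1 : Fin d → ℝ)).comp (fderiv ℝ (fderiv ℝ fun z => f (ψ z)) w)) w := by
    rw [hasFDerivAt_pi]
    intro i
    exact (ContinuousLinearMap.hasFDerivAt (ContinuousLinearMap.apply ℝ ℝ (Pi.single i 1 : Fin d → ℝ))).comp w h1.hasFDerivAt
  refine ⟨h2.differentiableAt, fun u i => ?_⟩
  rw [h2.fderiv, iteratedFDeriv_two_apply]
  simp

theorem gr_lin {J : Type} [Fintype J] {M : Set (Fin n → ℝ)} {W : Set (Fin d → ℝ)} {ψ : (Fin d → ℝ) → Fin n → ℝ} (h : Par M W ψ) {f : (Fin n → ℝ) → ℝ} (hf : CpOn 2 f M)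
    {q : J → (Fin n → ℝ) → ℝ} (hq : ∀ j, CpOn 2 (q j) M) (a : J → ℝ)
    {w : Fin d → ℝ} (hw : w ∈ W) : gr ψ (fun x => f x + ∑ j, a j * q j x) w = gr ψ f w + ∑ j, a j • gr ψ (q j) w := by
  have h1 := ((cd_par h hf hw).differentiableAt (by simp)).hasFDerivAt
  have h2 := fun j => ((cd_par h (hq j) hw).differentiableAt (by simp)).hasFDerivAt
  have h3 := h1.add (HasFDerivAt.fun_sum (u := Finset.univ) fun j _ => (h2 j).const_mul (a j))
  funext i
  simp only [gr, gradVec, Pi.add_apply, Finset.sum_apply, Pi.smul_apply, smul_eq_mul]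
  refine (congrArg (fun l : (Fin d → ℝ) →L[ℝ] ℝ => l (Pi.single i 1)) (HasFDerivAt.fderiv h3)).trans ?_
  simp

theorem gr_crit {M : Set (Fin n → ℝ)} {W : Set (Fin d → ℝ)} {ψ : (Fin d → ℝ) → Fin n → ℝ} (h : Par M W ψ) {f : (Fin n → ℝ) → ℝ} (hf : CpOn 2 f M)
    {w : Fin d → ℝ} (hw : w ∈ W) (hc : IsCritPtOn f M (ψ w)) : gr ψ f w = 0 := by
  have h1 := (cd_par h hf hw).differentiableAt (by simp)
  have hψ := (h.2.1.contDiffAt (h.1.mem_nhds hw)).differentiableAt (by simp)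
  funext i
  set u : Fin d → ℝ := Pi.single i 1
  have hl : HasDerivAt (fun t : ℝ => w + t • u) u 0 := by simpa using ((hasDerivAt_id (0:ℝ)).smul_const u).const_add w
  have hw0 : w + (0:ℝ) • u = w := by simp
  have e1 : HasDerivAt (fun t : ℝ => ψ (w + t • u)) (fderiv ℝ ψ w u) 0 := by
    refine HasFDerivAt.comp_hasDerivAt (0:ℝ) (l := ψ) ?_ hl
    rw [hw0]; exact hψ.hasFDerivAt
  have e2 : HasDerivAt (fun t : ℝ => f (ψ (w + t • u))) (fderiv ℝ (fun z => f (ψ z)) w u) 0 := by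
    refine HasFDerivAt.comp_hasDerivAt (0:ℝ) (l := fun z => f (ψ z)) ?_ hl
    rw [hw0]; exact h1.hasFDerivAt
  refine e2.unique (hc.2 _ _ (by simp only [hw0]) ?_ e1)
  filter_upwards [hl.continuousAt.preimage_mem_nhds (h.1.mem_nhds (hw0.symm ▸ hw))] with t ht using h.2.2.1 ht

theorem gr_solve {M : Set (Fin n → ℝ)} {W : Set (Fin d → ℝ)} {ψ : (Fin d → ℝ) → Fin n → ℝ} (h : Par M W ψ) {κ : (Fin n → ℝ) → ℝ} (hκ : CpOn 2 κ M)
    (hκ0 : ∀ x ∈ M, 0 < κ x) {w : Fin d → ℝ} (hw : w ∈ W) (α : ℝ) (e : Fin d → ℝ) : ∃ η : (Fin n → ℝ) →L[ℝ] ℝ, ∀ Q : (Fin n → ℝ) → ℝ,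
      Q (ψ w) = α → HasFDerivAt Q η (ψ w) → gr ψ (fun x => κ x * Q x) w = e := by
  have hψ := ((h.2.1.contDiffAt (h.1.mem_nhds hw)).differentiableAt (by simp)).hasFDerivAt
  have hk := ((cd_par h hκ hw).differentiableAt (by simp)).hasFDerivAt
  obtain ⟨ρ0, hρ⟩ := (fderiv ℝ ψ w : (Fin d → ℝ) →ₗ[ℝ] (Fin n → ℝ)).exists_leftInverse_of_injective (LinearMap.ker_eq_bot.2 (h.2.2.2 w hw))
  set ρ : (Fin n → ℝ) →L[ℝ] (Fin d → ℝ) := LinearMap.toContinuousLinearMap ρ0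
  have hρ' : ∀ u, ρ (fderiv ℝ ψ w u) = u := fun u => LinearMap.congr_fun hρ u
  set ee : (Fin d → ℝ) →L[ℝ] ℝ := ∑ i, e i • ContinuousLinearMap.proj (R := ℝ) (φ := fun _ : Fin d => ℝ) i with hee
  have hei : ∀ i, ee (Pi.single i 1) = e i := fun i => by simp [hee, Pi.single_apply]
  refine ⟨(κ (ψ w))⁻¹ • (ee - α • fderiv ℝ (fun z => κ (ψ z)) w).comp ρ, fun Q hQ hd => ?_⟩
  have h1 := hk.mul (hd.comp w hψ)
  funext i
  refine (congrArg (fun l : (Fin d → ℝ) →L[ℝ] ℝ => l (Pi.single i 1)) (HasFDerivAt.fderiv h1)).trans ?_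
  have := (hκ0 _ (h.2.2.1 hw)).ne'
  simp only [add_apply, smul_apply, ContinuousLinearMap.comp_apply, hρ', sub_apply,
    hei, smul_eq_mul, Function.comp_apply, hQ]
  field_simp
  ring
end Mor

section Mor2
open MeasureTheory
variable {n d : ℕ}

/-- the finite family of polynomials -/
abbrev JJ (n : ℕ) : Type := Fin n × Fin 4 × Option (Fin n)
/-- the polynomial with a given index -/
def qq (j : JJ n) (z : Fin n → ℝ) : ℝ := z j.1 ^ (j.2.1 : ℕ) * (match j.2.2 with | none => 1 | some i => z i)

theorem qq_span (i : Fin n) (c : Fin 4 → ℝ) (b0 : ℝ) (η : (Fin n → ℝ) →L[ℝ] ℝ) : ∃ a : JJ n → ℝ, ∀ z,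
    ∑ j, a j * qq j z = (∑ k, c k * z i ^ (k : ℕ)) * (b0 + η z) := by
  refine ⟨fun j => if j.1 = i then c j.2.1 * (match j.2.2 with | none => b0 | some l => η (Pi.single l 1)) else 0, fun z => ?_⟩
  have hη : η z = ∑ l, η (Pi.single l 1) * z l := by
    conv_lhs => rw [← Finset.univ_sum_single z]
    rw [map_sum]
    refine Finset.sum_congr rfl fun i _ => ?_
    rw [show Pi.single i (z i) = z i • (Pi.single i 1 : Fin n → ℝ) by rw [← Pi.single_smul]; simp, map_smul, smul_eq_mul, mul_comm]
  simp only [Fintype.sum_prod_type, ite_mul, zero_mul]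
  rw [Finset.sum_eq_single i (fun b _ hb => by simp [hb]) (by simp)]
  rw [Finset.sum_mul]
  refine Finset.sum_congr rfl fun k _ => ?_
  simp only [if_true, Fintype.sum_option, qq]
  rw [hη, mul_add, Finset.mul_sum]
  congr 1
  · ring
  · exact Finset.sum_congr rfl fun l _ => by ring

theorem chi {X Y : ℝ} (h : X ≠ Y) : ∃ c : Fin 4 → ℝ, ∀ χ : ℝ → ℝ, χ = (fun t => ∑ k, c k * t ^ (k : ℕ)) → χ X = 1 ∧ χ Y = 0 ∧
    HasDerivAt χ 0 X ∧ HasDerivAt χ 0 Y := by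
  have h' : X - Y ≠ 0 := sub_ne_zero.2 h
  refine ⟨![3*Y^2/(X-Y)^2 + 2*Y^3/(X-Y)^3, -6*Y/(X-Y)^2 - 6*Y^2/(X-Y)^3, 3/(X-Y)^2 + 6*Y/(X-Y)^3, -2/(X-Y)^3], ?_⟩
  rintro χ rfl
  have e : (fun t : ℝ => ∑ k : Fin 4, (![3*Y^2/(X-Y)^2 + 2*Y^3/(X-Y)^3, -6*Y/(X-Y)^2 - 6*Y^2/(X-Y)^3, 3/(X-Y)^2 + 6*Y/(X-Y)^3, -2/(X-Y)^3] k) * t ^ (k : ℕ))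
      = fun t => 3 * ((t - Y) / (X - Y)) ^ 2 - 2 * ((t - Y) / (X - Y)) ^ 3 := by
    funext t
    simp only [Fin.sum_univ_four, Matrix.cons_val, Fin.val_zero, Fin.val_one, Fin.val_two, show ((3 : Fin 4) : ℕ) = 3 from rfl]
    field_simp
    ring
  rw [e]
  have hd : ∀ t, HasDerivAt (fun t => 3 * ((t - Y) / (X - Y)) ^ 2 - 2 * ((t - Y) / (X - Y)) ^ 3)
      (6 * ((t - Y) / (X - Y)) * (1 / (X - Y)) - 6 * ((t - Y) / (X - Y)) ^ 2 * (1 / (X - Y))) t := fun t => by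
    have h1 : HasDerivAt (fun t => (t - Y) / (X - Y)) (1 / (X - Y)) t := ((hasDerivAt_id t).sub_const Y).div_const _
    refine (((h1.pow 2).const_mul 3).sub ((h1.pow 3).const_mul 2)).congr_deriv ?_
    norm_num
    ring
  refine ⟨by simp only [div_self h']; norm_num, by simp, ?_, ?_⟩
  · convert hd X using 1
    rw [div_self h']; ring
  · convert hd Y using 1
    simp

theorem interp {x y : Fin n → ℝ} (h : x ≠ y) (α β : ℝ) (η ζ : (Fin n → ℝ) →L[ℝ] ℝ) : ∃ a : JJ n → ℝ, ∀ Q : (Fin n → ℝ) → ℝ,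
    Q = (fun z => ∑ j, a j * qq j z) → Q x = α ∧ HasFDerivAt Q η x ∧ Q y = β ∧ HasFDerivAt Q ζ y := by
  obtain ⟨i, hi⟩ := Function.ne_iff.1 h
  obtain ⟨c, hc⟩ := chi hi
  set χ : ℝ → ℝ := fun t => ∑ k, c k * t ^ (k : ℕ) with hχ
  obtain ⟨c1, c2, c3, c4⟩ := hc χ rfl
  obtain ⟨a1, h1⟩ := qq_span i c (α - η x - (β - ζ y)) (η - ζ)
  obtain ⟨a2, h2⟩ := qq_span i (fun k => if k = 0 then 1 else 0) (β - ζ y) ζ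
  refine ⟨a1 + a2, ?_⟩
  rintro Q rfl
  have e : (fun z => ∑ j, (a1 + a2) j * qq j z) = fun z => χ (z i) * (α - η x - (β - ζ y) + (η - ζ) z) + (β - ζ y + ζ z) := by
    funext z
    simp only [Pi.add_apply, add_mul, Finset.sum_add_distrib]
    rw [h1 z, h2 z]
    simp [Fin.sum_univ_four, hχ]
  rw [e]
  have hd : ∀ w : Fin n → ℝ, HasDerivAt χ 0 (w i) → HasFDerivAt (fun z : Fin n → ℝ => χ (z i) * (α - η x - (β - ζ y) + (η - ζ) z) + (β - ζ y + ζ z))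
      (χ (w i) • (η - ζ) + ζ) w := fun w hw => by
    have g1 : HasFDerivAt (fun z : Fin n → ℝ => χ (z i)) (0 : (Fin n → ℝ) →L[ℝ] ℝ) w := by
      refine (HasDerivAt.comp_hasFDerivAt w hw (ContinuousLinearMap.proj (R := ℝ) (φ := fun _ : Fin n => ℝ) i).hasFDerivAt).congr_fderiv ?_
      simp
    refine ((g1.fun_mul ((η - ζ).hasFDerivAt.const_add _)).fun_add (ζ.hasFDerivAt.const_add _)).congr_fderiv ?_
    simp
  refine ⟨?_, (hd x c3).congr_fderiv ?_, ?_, (hd y c4).congr_fderiv ?_⟩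
  · simp only [c1, sub_apply]; ring
  · rw [c1]; simp
  · simp only [c2]; ring
  · rw [c2]; simp

theorem cd_qq (p : ℕ) (j : JJ n) : ContDiff ℝ p (qq j) := by
  obtain ⟨i, k, _ | l⟩ := j <;> unfold qq <;> fun_prop

theorem dm_qq {L : FirstOrder.Language} [L.Structure ℝ] [hL : Fact (DMinimal L)] (j : JJ n) : DM L (qq j) := by
  obtain ⟨i, k, _ | l⟩ := j <;> unfold qq <;> fun_prop

variable {M : Set (Fin n → ℝ)} {h κ : (Fin n → ℝ) → ℝ}

theorem mor1 (ch : CpOn 2 h M) (hκ : CpOn 2 κ M) (hκ0 : ∀ x ∈ M, 0 < κ x)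
    {W : Set (Fin d → ℝ)} {ψ : (Fin d → ℝ) → Fin n → ℝ} (hψ : Par M W ψ) : ∀ᵐ a : JJ n → ℝ, ∀ w ∈ W,
      gr ψ (fun x => h x + ∑ j, a j * (κ x * qq j x)) w = 0 → ∀ u, fderiv ℝ (gr ψ (fun x => h x + ∑ j, a j * (κ x * qq j x))) w u = 0 → u = 0 := by
  have hq : ∀ j : JJ n, CpOn 2 (fun x => κ x * qq j x) M := fun j => hκ.mul (CpOn.of_cd fun x _ => ⟨univ, isOpen_univ, mem_univ _, (cd_qq 2 j).contDiffOn⟩)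
  have := pt' (J := JJ n) hψ.1 (c := gr ψ h) (y := fun j => gr ψ (fun x => κ x * qq j x)) (fun w hw => (hasFDerivAt_gr hψ ch hw).1)
    (fun j w hw => (hasFDerivAt_gr hψ (hq j) hw).1) (fun w hw e => by
      by_cases hy : ∃ y, ψ w ≠ y
      · obtain ⟨y, hy⟩ := hy
        obtain ⟨η, hη⟩ := gr_solve hψ hκ hκ0 hw 0 e
        obtain ⟨a, ha⟩ := interp hy 0 0 η 0
        refine ⟨a, ?_⟩
        obtain ⟨b1, b2, -⟩ := ha _ rfl
        rw [← hη _ b1 b2]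
        have := gr_lin hψ (CpOn.const 0) hq a hw
        have e0 : gr ψ (fun _ => (0:ℝ)) w = 0 := by funext i; simp [gr, gradVec]
        rw [e0, zero_add] at this
        rw [← this]
        congr 1
        funext x
        rw [zero_add, Finset.mul_sum]
        exact Finset.sum_congr rfl fun j _ => by ring
      · push Not at hy
        have hs : ∀ u v : Fin d → ℝ, u = v := fun u v => hψ.2.2.2 w hw ((hy _).symm.trans (hy _))
        exact ⟨0, hs _ _⟩)
  filter_upwards [this] with a ha w hw h0 u hu
  rw [gr_lin hψ ch hq a hw] at h0
  refine ha w hw h0 u ?_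
  rw [← hu]
  congr 1
  refine Filter.EventuallyEq.fderiv_eq ?_
  filter_upwards [hψ.1.mem_nhds hw] with z hz using (gr_lin hψ ch hq a hz).symm

theorem mor2 (ch : CpOn 2 h M) (hκ : CpOn 2 κ M) (hκ0 : ∀ x ∈ M, 0 < κ x)
    {W : Set (Fin d → ℝ)} {ψ : (Fin d → ℝ) → Fin n → ℝ} (hψ : Par M W ψ) {W' : Set (Fin d → ℝ)} {ψ' : (Fin d → ℝ) → Fin n → ℝ} (hψ' : Par M W' ψ') :
    ∀ᵐ a : JJ n → ℝ, ∀ g, g = (fun x => h x + ∑ j, a j * (κ x * qq j x)) → ∀ w ∈ W, ∀ w' ∈ W', ψ w ≠ ψ' w' →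
      gr ψ g w = 0 → gr ψ' g w' = 0 → g (ψ w) ≠ g (ψ' w') := by
  have hq : ∀ j : JJ n, CpOn 2 (fun x => κ x * qq j x) M := fun j => hκ.mul (CpOn.of_cd fun x _ => ⟨univ, isOpen_univ, mem_univ _, (cd_qq 2 j).contDiffOn⟩)
  set Γ : ((Fin n → ℝ) → ℝ) → (Fin d → ℝ) × (Fin d → ℝ) × ℝ → (Fin d → ℝ) × (Fin d → ℝ) × ℝ := fun f v =>
    (gr ψ f v.1, gr ψ' f v.2.1, f (ψ v.1) - f (ψ' v.2.1)) with hΓ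
  set V : Set ((Fin d → ℝ) × (Fin d → ℝ) × ℝ) := {v | (v.1 ∈ W ∧ v.2.1 ∈ W') ∧ ψ v.1 - ψ' v.2.1 ∈ ({0}ᶜ : Set (Fin n → ℝ))} with hV
  have hVo : IsOpen V := by
    have o1 : IsOpen {v : (Fin d → ℝ) × (Fin d → ℝ) × ℝ | v.1 ∈ W ∧ v.2.1 ∈ W'} :=
      (hψ.1.preimage continuous_fst).inter (hψ'.1.preimage (continuous_fst.comp continuous_snd))
    refine ContinuousOn.isOpen_inter_preimage (f := fun v : (Fin d → ℝ) × (Fin d → ℝ) × ℝ => ψ v.1 - ψ' v.2.1) ?_ o1 isOpen_compl_singleton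
    exact (hψ.2.1.continuousOn.comp continuousOn_fst fun v hv => hv.1).sub
      (hψ'.2.1.continuousOn.comp (continuous_fst.comp continuous_snd).continuousOn fun v hv => hv.2)
  have hΓd : ∀ f, CpOn 2 f M → ∀ v ∈ V, DifferentiableAt ℝ (Γ f) v := fun f hf v hv => by
    have d1 : DifferentiableAt ℝ (fun v : (Fin d → ℝ) × (Fin d → ℝ) × ℝ => v.1) v := by fun_prop
    have d2 : DifferentiableAt ℝ (fun v : (Fin d → ℝ) × (Fin d → ℝ) × ℝ => v.2.1) v := by fun_prop
    exact (DifferentiableAt.comp v (hasFDerivAt_gr hψ hf hv.1.1).1 d1).prodMk ((DifferentiableAt.comp v (hasFDerivAt_gr hψ' hf hv.1.2).1 d2).prodMk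
      ((DifferentiableAt.comp (g := fun z => f (ψ z)) v ((cd_par hψ hf hv.1.1).differentiableAt (by simp)) d1).sub
        (DifferentiableAt.comp (g := fun z => f (ψ' z)) v ((cd_par hψ' hf hv.1.2).differentiableAt (by simp)) d2)))
  have hlin : ∀ f, CpOn 2 f M → ∀ a : JJ n → ℝ, ∀ v ∈ V, Γ (fun x => f x + ∑ j, a j * (κ x * qq j x)) v = Γ f v + ∑ j, a j • Γ (fun x => κ x * qq j x) v :=
    fun f hf a v hv => by
    simp only [hΓ]
    rw [gr_lin hψ hf hq a hv.1.1, gr_lin hψ' hf hq a hv.1.2]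
    refine Prod.ext ?_ (Prod.ext ?_ ?_)
    · simp [Prod.fst_sum]
    · simp [Prod.fst_sum, Prod.snd_sum]
    · simp [Prod.snd_sum, mul_sub, Finset.sum_sub_distrib]; ring
  have := pt' (J := JJ n) hVo (c := Γ h) (y := fun j => Γ (fun x => κ x * qq j x)) (hΓd h ch) (fun j => hΓd _ (hq j)) (fun v hv e => by
    have k1 := hκ0 _ (hψ.2.2.1 hv.1.1)
    obtain ⟨η, hη⟩ := gr_solve hψ hκ hκ0 hv.1.1 (e.2.2 / κ (ψ v.1)) e.1
    obtain ⟨ζ, hζ⟩ := gr_solve hψ' hκ hκ0 hv.1.2 0 e.2.1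
    obtain ⟨a, ha⟩ := interp (sub_ne_zero.1 hv.2) (e.2.2 / κ (ψ v.1)) 0 η ζ
    refine ⟨a, ?_⟩
    obtain ⟨b1, b2, b3, b4⟩ := ha _ rfl
    have := hlin _ (CpOn.const 0) a v hv
    have e0 : Γ (fun _ => (0:ℝ)) v = 0 := by
      refine Prod.ext ?_ (Prod.ext ?_ ?_)
      · funext i; simp [hΓ, gr, gradVec]
      · funext i; simp [hΓ, gr, gradVec]
      · simp [hΓ]
    rw [e0, zero_add] at this
    rw [← this]
    have e1 : (fun x => 0 + ∑ j : JJ n, a j * (κ x * qq j x)) = fun x => κ x * ∑ j, a j * qq j x := by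
      funext x
      rw [zero_add, Finset.mul_sum]
      exact Finset.sum_congr rfl fun j _ => by ring
    rw [e1]
    refine Prod.ext (hη _ b1 b2) (Prod.ext (hζ _ b3 b4) ?_)
    simp only [hΓ]
    rw [b1, b3]
    field_simp
    ring)
  filter_upwards [this] with a ha g hg w hw w' hw' hne g1 g2 g3
  have hv : (w, w', (0:ℝ)) ∈ V := ⟨⟨hw, hw'⟩, sub_ne_zero.2 hne⟩
  have hz : Γ g (w, w', 0) = 0 := Prod.ext g1 (Prod.ext g2 (sub_eq_zero.2 g3))
  have cg : CpOn 2 g M := hg ▸ ch.add (CpOn.sum _ fun j _ => (CpOn.const (a j)).mul (hq j))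
  have hu := ha (w, w', 0) hv (by rw [← hlin h ch a _ hv, ← hg, hz]) (0, 0, 1) (by
    have e1 : fderiv ℝ (fun w => Γ h w + ∑ j, a j • Γ (fun x => κ x * qq j x) w) (w, w', 0) = fderiv ℝ (Γ g) (w, w', 0) := by
      refine Filter.EventuallyEq.fderiv_eq ?_
      filter_upwards [hVo.mem_nhds hv] with z hz using by rw [hg, hlin h ch a z hz]
    rw [e1]
    have hl : HasDerivAt (fun t : ℝ => (w, w', t)) ((0 : Fin d → ℝ), (0 : Fin d → ℝ), (1:ℝ)) 0 :=
      (hasDerivAt_const _ _).prodMk ((hasDerivAt_const _ _).prodMk (hasDerivAt_id _))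
    exact (HasFDerivAt.comp_hasDerivAt (0:ℝ) (l := Γ g) (hΓd g cg _ hv).hasFDerivAt hl).unique (hasDerivAt_const (0:ℝ) (Γ g (w, w', 0))))
  have := congrArg (fun q : (Fin d → ℝ) × (Fin d → ℝ) × ℝ => q.2.2) hu
  simp at this

theorem mor (ch : CpOn 2 h M) (hκ : CpOn 2 κ M) (hκ0 : ∀ x ∈ M, 0 < κ x)
    (hP : ∀ x ∈ M, ∃ (W : Set (Fin d → ℝ)) (ψ : (Fin d → ℝ) → Fin n → ℝ), Par M W ψ ∧ ∃ U ∈ 𝓝 x, M ∩ U ⊆ ψ '' W) :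
    ∀ᵐ a : JJ n → ℝ, IsMorseOn (fun x => h x + ∑ j, a j * (κ x * qq j x)) M d := by
  have hq : ∀ j : JJ n, CpOn 2 (fun x => κ x * qq j x) M := fun j => hκ.mul (CpOn.of_cd fun x _ => ⟨univ, isOpen_univ, mem_univ _, (cd_qq 2 j).contDiffOn⟩)
  choose! W ψ hW U hU hMU using hP
  obtain ⟨t, ht, htc, hcov⟩ := TopologicalSpace.countable_cover_nhdsWithin (s := M) (f := U) fun x hx => mem_nhdsWithin_of_mem_nhds (hU x hx)
  have A1 := (ae_ball_iff htc).2 fun x hx => mor1 ch hκ hκ0 (hW x (ht hx))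
  have A2 := (ae_ball_iff htc).2 fun x hx => (ae_ball_iff htc).2 fun y hy => mor2 ch hκ hκ0 (hW x (ht hx)) (hW y (ht hy))
  filter_upwards [A1, A2] with a h1 h2
  set g := fun x => h x + ∑ j, a j * (κ x * qq j x) with hg
  have cg : CpOn 2 g M := ch.add (CpOn.sum _ fun j _ => (CpOn.const (a j)).mul (hq j))
  have hcov' : ∀ x ∈ M, ∃ i ∈ t, ∃ w ∈ W i, ψ i w = x := fun x hx => by
    obtain ⟨i, hi, hxi⟩ := mem_iUnion₂.1 (hcov hx)
    obtain ⟨w, hw, e⟩ := hMU i (ht hi) ⟨hx, hxi⟩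
    exact ⟨i, hi, w, hw, e⟩
  constructor
  · intro x hx
    obtain ⟨i, hi, w, hw, rfl⟩ := hcov' x hx.1
    have hP := hW i (ht hi)
    refine ⟨hx, W i, ψ i, w, hP.1, hw, hP.2.1, rfl, hP.2.2.1, hP.2.2.2 w hw, fun v hv => ?_⟩
    by_contra hcon
    push Not at hcon
    refine hv (h1 i hi w hw (gr_crit hP cg hw hx) v ?_)
    funext l
    exact ((hasFDerivAt_gr hP cg hw).2 v l).trans (hcon _)
  · intro x y hx hy hne
    obtain ⟨i, hi, w, hw, rfl⟩ := hcov' x hx.1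
    obtain ⟨j, hj, w', hw', rfl⟩ := hcov' y hy.1
    exact h2 i hi j hj g rfl w hw w' hw' hne (gr_crit (hW i (ht hi)) cg hw hx) (gr_crit (hW j (ht hj)) cg hw' hy)
end Mor2

theorem vderivIter_congr {E : Type} [NormedAddCommGroup E] [NormedSpace ℝ E] {k : ℕ} {M : Set E} {D D' : Fin k → E → E} (hD : ∀ i, EqOn (D i) (D' i) M)
    {f f' : E → ℝ} (h : EqOn f f' M) (l : List (Fin k)) : EqOn (vderivIter M D l f) (vderivIter M D' l f') M := by
  induction l with
  | nil => exact h
  | cons i l ih => exact fun x hx => vderiv_congr (hD i hx) ih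


/-- density of definable Morse functions. -/
theorem stmt0 (L : FirstOrder.Language) [L.Structure ℝ] (hL : DMinimal L)
    (p n d k : ℕ) (hp : 2 ≤ p)
    (M : Set (Fin n → ℝ)) (hM : IsDpSubmanifold L p d M)
    (h : (Fin n → ℝ) → ℝ) (hhdef : IsDefFunOn L M h) (hhC : CpOn p h M)
    (D : Fin k → (Fin n → ℝ) → (Fin n → ℝ))
    (hD : ∀ i, IsDefMapOn L M (D i) ∧ CpOn (p - 1) (D i) M ∧
      ∀ x ∈ M, D i x ∈ TangentVecs M x)
    (ε : (Fin n → ℝ) → ℝ) (hεdef : IsDefFunOn L M ε) (hεc : ContinuousOn ε M)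
    (hεpos : ∀ x ∈ M, 0 < ε x) :
    ∃ g : (Fin n → ℝ) → ℝ, IsDefFunOn L M g ∧ CpOn p g M ∧ IsMorseOn g M d ∧
      ∀ α : List (Fin k), α.length ≤ p →
        ∀ x ∈ M, |vderivIter M D α (fun y => g y - h y) x| < ε x := by
  have : Fact (DMinimal L) := ⟨hL⟩
  have dM : DS L M := hM.1
  have dh := DM.funOn hM.1 hhdef
  have dε := DM.funOn hM.1 hεdef
  set h0 : (Fin n → ℝ) → ℝ := fun x => if x ∈ M then h x else 0 with hh0
  have eh : EqOn h0 h M := fun x hx => if_pos hx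
  have ch : CpOn p h0 M := hhC.congr eh
  set D' : Fin k → (Fin n → ℝ) → Fin n → ℝ := fun i x => if x ∈ M then D i x else 0 with hD'
  have eD : ∀ i, EqOn (D i) (D' i) M := fun i x hx => (if_pos hx).symm
  obtain ⟨F, W, dF, hW, hMW, cF, hF, hK⟩ := niceM hM dM
  have cF' : CpOn p F M := CpOn.of_cd fun x hx => ⟨W, hW, hMW hx, cF⟩
  have hq : ∀ (q : ℕ) (j : JJ n), CpOn q (qq j) M := fun q j => CpOn.of_cd fun x _ => ⟨univ, isOpen_univ, mem_univ _, (cd_qq q j).contDiffOn⟩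
  obtain ⟨φ, dφ, hφ, hb⟩ := pert (D := D') (ε := fun x => if x ∈ M then ε x else 0) (q := qq) dM (fun i => ⟨DM.mapOn hM.1 (hD i).1,
      (hD i).2.1.congr fun x hx => (eD i hx).symm, fun x hx => by rw [← eD i hx]; exact (hD i).2.2 x hx⟩) dF cF' hF hK
    (fun j => ⟨dm_qq j, hq p j⟩) dε (hεc.congr fun x hx => if_pos hx) (fun x hx => by simp only [if_pos hx]; exact hεpos x hx)
  have hF' : MapsTo F M (Ioo 0 2) := fun x hx => ⟨(hF x hx).1, (hF x hx).2.trans_lt one_lt_two⟩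
  have cκ : CpOn p (fun x => φ (F x)) M := CpOn.comp1 isOpen_Ioo cF' (fun t ht => (hφ t ht).1.contDiffWithinAt) hF'
  have hae := mor (d := d) (ch.of_le hp) (cκ.of_le hp) (fun x hx => (hφ _ (hF' hx)).2) (fun x hx => exists_par hp hM x hx)
  obtain ⟨a, ha1, ha2⟩ : ∃ a : JJ n → ℝ, a ∈ Metric.ball (0 : JJ n → ℝ) 1 ∧ IsMorseOn (fun x => h0 x + ∑ j, a j * (φ (F x) * qq j x)) M d := by
    by_contra hcon
    push Not at hcon
    have h0' : MeasureTheory.volume (Metric.ball (0 : JJ n → ℝ) 1) = 0 := by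
      refine MeasureTheory.measure_mono_null (fun a ha => ?_) (MeasureTheory.ae_iff.1 hae)
      exact hcon a ha
    exact (Metric.isOpen_ball.measure_pos _ ⟨0, Metric.mem_ball_self one_pos⟩).ne' h0'
  have ha : ∀ j, |a j| ≤ 1 := fun j => by
    rw [mem_ball_zero_iff] at ha1
    exact (norm_le_pi_norm a j).trans ha1.le
  refine ⟨_, DM.toFunOn dM (dh.add (DM.sum _ fun j => (DM.const (a j)).mul ((dφ.comp dF).mul (dm_qq j)))),
    ch.add (CpOn.sum _ fun j _ => (CpOn.const (a j)).mul (cκ.mul (hq p j))), ha2, fun l hl x hx => ?_⟩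
  have := hb a ha l hl x hx
  simp only [if_pos hx] at this
  rw [vderivIter_congr (f' := fun x => φ (F x) * ∑ j, a j * qq j x) eD (fun y hy => ?_) l hx]
  · exact this
  · have e := eh hy
    show h0 y + _ - h y = φ (F y) * ∑ j, a j * qq j y
    rw [← e, add_sub_cancel_left, Finset.mul_sum]
    exact Finset.sum_congr rfl fun j _ => by ring

end DMinPaper
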